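/- (Hochman's upcrossing theorem for groups of polynomial growth) Let Γ be a finitely generated group of polynomial growth with word metric. For every interval (α,β) ⊂ ℝ and every sufficiently small δ > 0, there exist constants c > 0 and ρ ∈ (0,1) such that for every stationary process (S_{B(g,r)}) and every k ≥ 1: ℙ({x : the sequence (S_{B(i)}(x))_{i≥1} has at least k upcrossings across (α,β)}) ≤ cρ^k + ℙ({x : there exists n > k such that S_{B(n)}(x) > β and B(n) can be δ-filled by pairwise disjoint balls V₁,…,V_m with S_{V_i}(x) < α for all i}). -/

import Mathlib

open Filter MeasureTheory

/-- The word norm of `g` with respect to a generating set `S` of a group. -/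
noncomputable def wordNorm {Γ : Type*} [Group Γ] (S : Set Γ) (g : Γ) : ℕ :=
  sInf {n : ℕ | ∃ f : Fin n → Γ, (∀ i, f i ∈ S ∨ (f i)⁻¹ ∈ S) ∧ g = (List.ofFn f).prod}

/-- The closed ball of radius `r` around `g` for the right-invariant word metric
`d(x,y) = ‖x y⁻¹‖`. -/
def wordBall {Γ : Type*} [Group Γ] (S : Set Γ) (g : Γ) (r : ℕ) : Set Γ :=
  {y : Γ | wordNorm S (g * y⁻¹) ≤ r}

/-- A length function on a group which is subadditive, symmetric, proper and geodesic. -/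
structure GeodesicLength {Γ : Type*} [Group Γ] (N : Γ → ℕ) : Prop where
  eq_one : N 1 = 0
  inv : ∀ g, N g⁻¹ = N g
  mul_le : ∀ g h, N (g * h) ≤ N g + N h
  split : ∀ g a, a ≤ N g → ∃ u v, g = u * v ∧ N u = a ∧ N v + a = N g
  finite : ∀ r, {g | N g ≤ r}.Finite

namespace GeodesicLength

variable {Γ : Type*} [Group Γ] {N : Γ → ℕ} (hN : GeodesicLength N)
include hN

theorem dist_comm (x y : Γ) : N (x * y⁻¹) = N (y * x⁻¹) := by
  rw [← hN.inv]; simp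

theorem dist_triangle (x y z : Γ) : N (x * z⁻¹) ≤ N (x * y⁻¹) + N (y * z⁻¹) := by
  have := hN.mul_le (x * y⁻¹) (y * z⁻¹)
  simpa [mul_assoc] using this

theorem finite_ball (g : Γ) (r : ℕ) : {y : Γ | N (g * y⁻¹) ≤ r}.Finite := by
  refine ((hN.finite r).image (fun h => h⁻¹ * g)).subset ?_
  intro y hy
  exact ⟨g * y⁻¹, hy, by simp⟩

/-- The closed ball of radius `r` around `g` as a finite set. -/
noncomputable def ball (g : Γ) (r : ℕ) : Finset Γ := (hN.finite_ball g r).toFinset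

theorem mem_ball {g y : Γ} {r : ℕ} : y ∈ hN.ball g r ↔ N (g * y⁻¹) ≤ r := by
  simp [ball]

/-- The growth function. -/
noncomputable def growth (r : ℕ) : ℕ := (hN.ball 1 r).card

theorem card_ball (g : Γ) (r : ℕ) : (hN.ball g r).card = hN.growth r := by
  unfold growth
  refine Finset.card_bij' (fun y _ => y * g⁻¹) (fun y _ => y * g) ?_ ?_ ?_ ?_ <;>
    simp [mem_ball, mul_assoc]

theorem self_mem_ball (g : Γ) (r : ℕ) : g ∈ hN.ball g r := by
  simp [mem_ball, hN.eq_one]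

theorem growth_pos (r : ℕ) : 0 < hN.growth r :=
  Finset.card_pos.2 ⟨1, hN.self_mem_ball 1 r⟩

theorem ball_mono (g : Γ) {r s : ℕ} (h : r ≤ s) : hN.ball g r ⊆ hN.ball g s := by
  intro y hy
  rw [mem_ball] at *
  omega

theorem growth_mono {r s : ℕ} (h : r ≤ s) : hN.growth r ≤ hN.growth s :=
  Finset.card_le_card (hN.ball_mono 1 h)

theorem ball_subset_ball {g h : Γ} {r s : ℕ} (H : N (g * h⁻¹) + r ≤ s) :
    hN.ball h r ⊆ hN.ball g s := by
  intro y hy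
  rw [mem_ball] at *
  have := hN.dist_triangle g h y
  omega

theorem dist_le_of_not_disjoint {g h : Γ} {r s : ℕ} (H : ¬ Disjoint (hN.ball g r) (hN.ball h s)) :
    N (g * h⁻¹) ≤ r + s := by
  rw [Finset.not_disjoint_iff] at H
  obtain ⟨y, h1, h2⟩ := H
  rw [mem_ball] at *
  have := hN.dist_triangle g y h
  have := hN.dist_comm h y
  omega

theorem growth_two_pow_mul {D : ℝ} (hD : ∀ n, (hN.growth (2 * n) : ℝ) ≤ D * hN.growth n) (s n : ℕ) :
    (hN.growth (2 ^ s * n) : ℝ) ≤ D ^ s * hN.growth n := by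
  have hD0 : 0 ≤ D := by
    have h0 := hD 0
    have := hN.growth_pos 0
    by_contra! h
    have h1 : (0 : ℝ) < hN.growth 0 := by exact_mod_cast this
    simp at h0
    nlinarith
  induction s with
  | zero => simp
  | succ s ih =>
    calc (hN.growth (2 ^ (s + 1) * n) : ℝ) = hN.growth (2 * (2 ^ s * n)) := by congr 2; ring
      _ ≤ D * hN.growth (2 ^ s * n) := hD _
      _ ≤ D * (D ^ s * hN.growth n) := by gcongr
      _ = _ := by ring

theorem one_le_of_doubling {D : ℝ} (hD : ∀ n, (hN.growth (2 * n) : ℝ) ≤ D * hN.growth n) : 1 ≤ D := by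
  have h0 := hD 0
  have h1 : (0 : ℝ) < hN.growth 0 := by exact_mod_cast hN.growth_pos 0
  simp at h0
  nlinarith

end GeodesicLength

/-- A greedy selection: a maximal independent family dominating all elements in rank. -/
theorem exists_greedy {ι : Type*} (I : Finset ι) (rk : ι → ℕ) (C : ι → ι → Prop)
    (hrefl : ∀ i ∈ I, C i i) (hsymm : ∀ i j, C i j → C j i) :
    ∃ J ⊆ I, (∀ i ∈ J, ∀ j ∈ J, i ≠ j → ¬ C i j) ∧ ∀ i ∈ I, ∃ j ∈ J, rk i ≤ rk j ∧ C i j := by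
  classical
  induction I using Finset.strongInduction with
  | H I ih =>
    by_cases hI : I = ∅
    · subst hI; exact ⟨∅, by simp⟩
    obtain ⟨m, hm, hmax⟩ := Finset.exists_max_image I rk (Finset.nonempty_iff_ne_empty.2 hI)
    have hsub : I.filter (fun i => ¬ C i m) ⊂ I := by
      rw [Finset.filter_ssubset]
      exact ⟨m, hm, by simpa using hrefl m hm⟩
    obtain ⟨J, hJ, h1, h2⟩ := ih _ hsub (fun i hi => hrefl i (hsub.1 hi))
    refine ⟨insert m J, ?_, ?_, ?_⟩
    · intro x hx
      rcases Finset.mem_insert.1 hx with rfl | hx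
      · exact hm
      · exact hsub.1 (hJ hx)
    · intro i hi j hj hij
      rcases Finset.mem_insert.1 hi with rfl | hi' <;> rcases Finset.mem_insert.1 hj with rfl | hj'
      · exact absurd rfl hij
      · intro h; exact (Finset.mem_filter.1 (hJ hj')).2 (hsymm _ _ h)
      · intro h; exact (Finset.mem_filter.1 (hJ hi')).2 h
      · exact h1 i hi' j hj' hij
    · intro i hi
      by_cases hc : C i m
      · exact ⟨m, by simp, hmax i hi, hc⟩
      · obtain ⟨j, hj, h⟩ := h2 i (by simp [hi, hc])
        exact ⟨j, by simp [hj], h⟩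

namespace GeodesicLength

variable {Γ : Type*} [Group Γ] {N : Γ → ℕ} (hN : GeodesicLength N)
include hN

theorem annulus_step {D : ℝ} (hD : ∀ n, (hN.growth (2 * n) : ℝ) ≤ D * hN.growth n) (R w : ℕ)
    (hw : 4 * w ≤ R) :
    (hN.growth R : ℝ) - hN.growth (R - w) ≤
      D ^ 3 / (1 + D ^ 3) * ((hN.growth R : ℝ) - hN.growth (R - 4 * w)) := by
  classical
  have hD1 := hN.one_le_of_doubling hD
  set A := hN.ball 1 R \ hN.ball 1 (R - w) with hA
  have hAcard : (A.card : ℝ) = hN.growth R - hN.growth (R - w) := by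
    rw [hA, Finset.card_sdiff_of_subset (hN.ball_mono 1 (by omega)),
      Nat.cast_sub (Finset.card_le_card (hN.ball_mono 1 (by omega)))]
    rfl
  obtain ⟨M, hMA, hMsep, hMdom⟩ := exists_greedy A (fun _ => 0)
    (fun x y => N (x * y⁻¹) ≤ 6 * w) (by simp [hN.eq_one])
    (fun x y h => by rw [hN.dist_comm]; exact h)
  have hnorm : ∀ y ∈ A, R - w < N y ∧ N y ≤ R := by
    intro y hy
    simp only [hA, Finset.mem_sdiff, mem_ball, one_mul, hN.inv] at hy
    omega
  have hmove : ∀ y ∈ A, ∃ v, N (y * v⁻¹) = 2 * w ∧ N v + 2 * w = N y := by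
    intro y hy
    have := hnorm y hy
    obtain ⟨u, v, h1, h2, h3⟩ := hN.split y (2 * w) (by omega)
    exact ⟨v, by rw [h1]; simpa using h2, h3⟩
  choose! v hv1 hv2 using hmove
  have hcov : A.card ≤ M.card * hN.growth (6 * w) := by
    calc A.card ≤ (M.biUnion fun y => hN.ball y (6 * w)).card := by
          apply Finset.card_le_card
          intro x hx
          obtain ⟨j, hj, -, h⟩ := hMdom x hx
          rw [Finset.mem_biUnion]
          exact ⟨j, hj, by rw [mem_ball, hN.dist_comm]; exact h⟩
      _ ≤ _ := Finset.card_biUnion_le_card_mul _ _ _ (fun y _ => (hN.card_ball y _).le)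
  have hpack : M.card * hN.growth w ≤ hN.growth (R - w) - hN.growth (R - 4 * w) := by
    have h1 : (M.biUnion fun y => hN.ball (v y) w).card = M.card * hN.growth w := by
      rw [Finset.card_biUnion]
      · simp [card_ball]
      · intro x hx y hy hxy
        by_contra hc
        have h1 := hN.dist_le_of_not_disjoint hc
        have h2 := hMsep x hx y hy hxy
        have h3 := hN.dist_triangle x (v x) y
        have h4 := hN.dist_triangle (v x) (v y) y
        have h5 := hN.dist_comm (v y) y
        have h6 := hv1 x (hMA hx)
        have h7 := hv1 y (hMA hy)
        omega
    rw [← h1]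
    have h2 : hN.growth (R - w) - hN.growth (R - 4 * w) =
        (hN.ball 1 (R - w) \ hN.ball 1 (R - 4 * w)).card := by
      rw [Finset.card_sdiff_of_subset (hN.ball_mono 1 (by omega))]; rfl
    rw [h2]
    apply Finset.card_le_card
    intro z hz
    rw [Finset.mem_biUnion] at hz
    obtain ⟨y, hy, hz⟩ := hz
    rw [mem_ball] at hz
    simp only [Finset.mem_sdiff, mem_ball, one_mul, hN.inv]
    have h3 := hnorm y (hMA hy)
    have h4 := hv2 y (hMA hy)
    have h5 := hN.dist_triangle z (v y) 1
    have h6 := hN.dist_triangle (v y) z 1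
    have h7 := hN.dist_comm (v y) z
    simp only [inv_one, mul_one] at h5 h6
    omega
  have h6 : (hN.growth (6 * w) : ℝ) ≤ D ^ 3 * hN.growth w :=
    le_trans (by exact_mod_cast hN.growth_mono (by omega)) (hN.growth_two_pow_mul hD 3 w)
  have hpack' : (M.card : ℝ) * hN.growth w ≤ hN.growth (R - w) - hN.growth (R - 4 * w) := by
    have hle : hN.growth (R - 4 * w) ≤ hN.growth (R - w) := hN.growth_mono (by omega)
    rw [← Nat.cast_sub hle]
    exact_mod_cast hpack
  have hcov' : (A.card : ℝ) ≤ M.card * hN.growth (6 * w) := by exact_mod_cast hcov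
  have h7 : (A.card : ℝ) ≤ D ^ 3 * (hN.growth (R - w) - hN.growth (R - 4 * w)) := by
    calc (A.card : ℝ) ≤ M.card * hN.growth (6 * w) := hcov'
      _ ≤ M.card * (D ^ 3 * hN.growth w) := by gcongr
      _ = D ^ 3 * (M.card * hN.growth w) := by ring
      _ ≤ _ := by gcongr
  rw [hAcard] at h7
  have hpos : 0 < 1 + D ^ 3 := by positivity
  rw [div_mul_eq_mul_div, le_div_iff₀ hpos]
  nlinarith

theorem annular_decay {D : ℝ} (hD : ∀ n, (hN.growth (2 * n) : ℝ) ≤ D * hN.growth n) {ε : ℝ}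
    (hε : 0 < ε) :
    ∃ l : ℕ, 1 ≤ l ∧ ∀ R w : ℕ, l * w ≤ R →
      (hN.growth (R + w) : ℝ) ≤ (1 + ε) * hN.growth R := by
  have hD1 := hN.one_le_of_doubling hD
  set θ : ℝ := D ^ 3 / (1 + D ^ 3) with hθ
  have hθ0 : 0 ≤ θ := by positivity
  have hθ1 : θ < 1 := by rw [hθ, div_lt_one (by positivity)]; linarith
  obtain ⟨j, hj⟩ := exists_pow_lt_of_lt_one (show 0 < ε / (1 + ε) by positivity) hθ1
  have key : ∀ j R w : ℕ, 4 ^ j * w ≤ R →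
      (hN.growth R : ℝ) - hN.growth (R - w) ≤ θ ^ j * (hN.growth R - hN.growth (R - 4 ^ j * w)) := by
    intro j R
    induction j with
    | zero => intro w _; simp
    | succ j ih =>
      intro w hw
      have h1 : 4 ^ j * (4 * w) ≤ R := by rw [pow_succ] at hw; linarith
      have h2 : 4 * w ≤ R := le_trans (Nat.le_mul_of_pos_left _ (by positivity)) h1
      calc (hN.growth R : ℝ) - hN.growth (R - w) ≤ θ * (hN.growth R - hN.growth (R - 4 * w)) :=
            hN.annulus_step hD R w h2
        _ ≤ θ * (θ ^ j * (hN.growth R - hN.growth (R - 4 ^ j * (4 * w)))) := by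
            gcongr; exact ih _ h1
        _ = _ := by rw [show 4 ^ j * (4 * w) = 4 ^ (j + 1) * w by ring]; ring
  refine ⟨4 ^ j, Nat.one_le_pow _ _ (by norm_num), fun R w h => ?_⟩
  have h1 := key j (R + w) w (by omega)
  simp only [Nat.add_sub_cancel] at h1
  have h2 : θ ^ j * ((hN.growth (R + w) : ℝ) - hN.growth (R + w - 4 ^ j * w)) ≤
      ε / (1 + ε) * hN.growth (R + w) := by
    have h0 : (0 : ℝ) ≤ hN.growth (R + w - 4 ^ j * w) := by positivity
    have h3 : (0 : ℝ) ≤ hN.growth (R + w) - hN.growth (R + w - 4 ^ j * w) := by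
      rw [sub_nonneg]; exact_mod_cast hN.growth_mono (by omega)
    exact mul_le_mul hj.le (by linarith) h3 (by positivity)
  have h3 : (hN.growth (R + w) : ℝ) - hN.growth R ≤ ε / (1 + ε) * hN.growth (R + w) := h1.trans h2
  have h4 : (hN.growth (R + w) : ℝ) * (1 / (1 + ε)) ≤ hN.growth R := by
    have : (1 : ℝ) / (1 + ε) = 1 - ε / (1 + ε) := by field_simp; ring
    rw [this]; linarith
  rw [mul_one_div, div_le_iff₀ (by positivity)] at h4
  linarith

end GeodesicLength

namespace GeodesicLength

variable {Γ : Type*} [Group Γ] {N : Γ → ℕ} (hN : GeodesicLength N)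
include hN

/-- A covering lemma: points surrounded by balls at many well separated scales can be almost covered
by a disjoint subfamily of these balls. -/
theorem covering {D : ℝ} (hD : ∀ n, (hN.growth (2 * n) : ℝ) ≤ D * hN.growth n) {ε : ℝ}
    {l : ℕ} (hl1 : 1 ≤ l)
    (hl : ∀ R w : ℕ, l * w ≤ R → (hN.growth (R + w) : ℝ) ≤ (1 + ε) * hN.growth R)
    {q : ℕ} (hq : D ^ 2 ≤ ε * q) (hq0 : 0 < q) (Y : Finset Γ) (c : Γ → Γ) (ρ : ℕ → Γ → ℕ)
    (hρ : ∀ y ∈ Y, ∀ i j, i < j → j < q → 2 * l * ρ i y < ρ j y)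
    (hc : ∀ y ∈ Y, N (y * (c y)⁻¹) ≤ ρ 0 y) :
    ∃ F ⊆ Y ×ˢ Finset.range q,
      (∀ p ∈ F, ∀ p' ∈ F, p ≠ p' →
        Disjoint (hN.ball (c p.1) (ρ p.2 p.1)) (hN.ball (c p'.1) (ρ p'.2 p'.1))) ∧
      ∀ U : Set Γ, (∀ z, z ∈ U ↔ ∃ p ∈ F, z ∈ hN.ball (c p.1) (ρ p.2 p.1)) →
      ∀ W : Finset Γ, (∀ z ∈ W, z ∈ Y ∧ z ∉ U) →
        (W.card : ℝ) ≤ 2 * ε * ∑ p ∈ F, (hN.growth (ρ p.2 p.1) : ℝ) := by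
  classical
  have hD1 := hN.one_le_of_doubling hD
  obtain ⟨F, hF, hdis, hdom⟩ := exists_greedy (Y ×ˢ Finset.range q) (fun p => ρ p.2 p.1)
    (fun p p' => ¬ Disjoint (hN.ball (c p.1) (ρ p.2 p.1)) (hN.ball (c p'.1) (ρ p'.2 p'.1)))
    (fun p _ => by
      rw [Finset.not_disjoint_iff]
      exact ⟨c p.1, hN.self_mem_ball _ _, hN.self_mem_ball _ _⟩)
    (fun p p' h => by rwa [disjoint_comm])
  refine ⟨F, hF, fun p hp p' hp' hne => not_not.1 (hdis p hp p' hp' hne), ?_⟩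
  intro U hU W hW
  have hρ0 : ∀ y ∈ Y, ∀ j < q, ρ 0 y ≤ ρ j y := by
    intro y hy j hj
    rcases Nat.eq_zero_or_pos j with rfl | h
    · rfl
    · have := hρ y hy 0 j h hj; nlinarith
  -- chosen balls near each point of `Y`
  have hnear : ∀ y ∈ Y, ∀ j < q, ∃ p ∈ F, ρ j y ≤ ρ p.2 p.1 ∧
      N (c p.1 * y⁻¹) ≤ ρ p.2 p.1 + 2 * ρ j y := by
    intro y hy j hj
    obtain ⟨p, hp, h1, h2⟩ := hdom (y, j) (by simp [hy, hj])
    refine ⟨p, hp, h1, ?_⟩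
    have h3 := hN.dist_le_of_not_disjoint h2
    have h4 := hN.dist_triangle y (c y) (c p.1)
    have h5 := hN.dist_comm y (c p.1)
    have h6 := hc y hy
    have h7 := hρ0 y hy j hj
    simp only at h3
    omega
  set W1 := W.filter (fun y => ∃ p ∈ F, y ∈ hN.ball (c p.1) (ρ p.2 p.1 + ρ p.2 p.1 / l)) with hW1
  set W2 := W.filter (fun y => ¬ ∃ p ∈ F, y ∈ hN.ball (c p.1) (ρ p.2 p.1 + ρ p.2 p.1 / l)) with hW2
  have hsum : W.card = W1.card + W2.card := (Finset.card_filter_add_card_filter_not _).symm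
  have hb1 : (W1.card : ℝ) ≤ ε * ∑ p ∈ F, (hN.growth (ρ p.2 p.1) : ℝ) := by
    calc (W1.card : ℝ) ≤ ((F.biUnion fun p =>
          hN.ball (c p.1) (ρ p.2 p.1 + ρ p.2 p.1 / l) \ hN.ball (c p.1) (ρ p.2 p.1)).card : ℝ) := by
          norm_cast
          apply Finset.card_le_card
          intro y hy
          rw [hW1, Finset.mem_filter] at hy
          obtain ⟨hy, p, hp, h⟩ := hy
          rw [Finset.mem_biUnion]
          refine ⟨p, hp, Finset.mem_sdiff.2 ⟨h, fun h' => ?_⟩⟩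
          exact (hW y hy).2 ((hU y).2 ⟨p, hp, h'⟩)
      _ ≤ ∑ p ∈ F, ((hN.ball (c p.1) (ρ p.2 p.1 + ρ p.2 p.1 / l) \
            hN.ball (c p.1) (ρ p.2 p.1)).card : ℝ) := by
          exact_mod_cast Finset.card_biUnion_le
      _ ≤ ∑ p ∈ F, ε * (hN.growth (ρ p.2 p.1) : ℝ) := by
          gcongr with p hp
          rw [Finset.card_sdiff_of_subset (hN.ball_mono _ (Nat.le_add_right _ _)),
            Nat.cast_sub (Finset.card_le_card (hN.ball_mono _ (Nat.le_add_right _ _))), hN.card_ball, hN.card_ball]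
          have := hl (ρ p.2 p.1) (ρ p.2 p.1 / l) (Nat.mul_div_le _ _)
          linarith
      _ = _ := by rw [Finset.mul_sum]
  have hb2 : (q : ℝ) * W2.card ≤ D ^ 2 * ∑ p ∈ F, (hN.growth (ρ p.2 p.1) : ℝ) := by
    have hmany : ∀ y ∈ W2, q ≤ (F.filter fun p => y ∈ hN.ball (c p.1) (3 * ρ p.2 p.1)).card := by
      intro y hy
      rw [hW2, Finset.mem_filter] at hy
      obtain ⟨hyW, hno⟩ := hy
      have hyY := (hW y hyW).1
      choose! p hp h1 h2 using hnear y hyY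
      have h3 : ∀ j < q, ρ (p j).2 (p j).1 ≤ 2 * l * ρ j y := by
        intro j hj
        by_contra! h
        refine hno ⟨p j, hp j hj, ?_⟩
        rw [mem_ball]
        have : 2 * ρ j y ≤ ρ (p j).2 (p j).1 / l := by
          rw [Nat.le_div_iff_mul_le (by omega)]
          nlinarith
        have := h2 j hj
        omega
      have hinj : Set.InjOn p (Finset.range q) := by
        have aux : ∀ i j, i < j → j < q → p i ≠ p j := by
          intro i j hij hj he
          have h4 := h3 i (by omega)
          have h5 := h1 j hj
          have h6 := hρ y hyY i j hij hj
          rw [he] at h4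
          omega
        intro i hi j hj he
        simp only [Finset.coe_range, Set.mem_Iio] at hi hj
        rcases lt_trichotomy i j with h | h | h
        · exact absurd he (aux i j h hj)
        · exact h
        · exact absurd he.symm (aux j i h hi)
      calc q = (Finset.range q).card := by simp
        _ = ((Finset.range q).image p).card := (Finset.card_image_of_injOn hinj).symm
        _ ≤ _ := by
          apply Finset.card_le_card
          intro x hx
          rw [Finset.mem_image] at hx
          obtain ⟨j, hj, rfl⟩ := hx
          rw [Finset.mem_range] at hj
          rw [Finset.mem_filter, mem_ball]
          refine ⟨hp j hj, ?_⟩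
          have := h1 j hj
          have := h2 j hj
          omega
    have hcount : q * W2.card ≤ ∑ p ∈ F, hN.growth (3 * ρ p.2 p.1) := by
      calc q * W2.card = ∑ y ∈ W2, q := by simp [mul_comm]
        _ ≤ ∑ y ∈ W2, (F.filter fun p => y ∈ hN.ball (c p.1) (3 * ρ p.2 p.1)).card :=
            Finset.sum_le_sum hmany
        _ = ∑ p ∈ F, (W2.filter fun y => y ∈ hN.ball (c p.1) (3 * ρ p.2 p.1)).card := by
            simp only [Finset.card_filter]
            exact Finset.sum_comm
        _ ≤ _ := by
          apply Finset.sum_le_sum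
          intro p _
          rw [← hN.card_ball (c p.1)]
          apply Finset.card_le_card
          intro y hy
          exact (Finset.mem_filter.1 hy).2
    calc (q : ℝ) * W2.card ≤ ∑ p ∈ F, (hN.growth (3 * ρ p.2 p.1) : ℝ) := by exact_mod_cast hcount
      _ ≤ ∑ p ∈ F, D ^ 2 * (hN.growth (ρ p.2 p.1) : ℝ) := by
          gcongr with p hp
          refine le_trans ?_ (hN.growth_two_pow_mul hD 2 _)
          exact_mod_cast hN.growth_mono (by omega)
      _ = _ := by rw [Finset.mul_sum]
  have hS0 : (0 : ℝ) ≤ ∑ p ∈ F, (hN.growth (ρ p.2 p.1) : ℝ) := by positivity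
  have hb2' : (W2.card : ℝ) ≤ ε * ∑ p ∈ F, (hN.growth (ρ p.2 p.1) : ℝ) := by
    have hq' : (0 : ℝ) < q := by exact_mod_cast hq0
    have h1 : (q : ℝ) * W2.card ≤ (q : ℝ) * (ε * ∑ p ∈ F, (hN.growth (ρ p.2 p.1) : ℝ)) := by
      refine hb2.trans ?_
      have := mul_le_mul_of_nonneg_right hq hS0
      linarith
    exact le_of_mul_le_mul_left h1 hq'
  rw [hsum]
  push_cast
  linarith

end GeodesicLength

namespace GeodesicLength

variable {Γ : Type*} [Group Γ] {N : Γ → ℕ} (hN : GeodesicLength N)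
include hN

/-- Every element of a finite family of balls is close to a locally maximal one. -/
theorem exists_locally_maximal (A : Finset Γ) (R : Γ → ℕ) (h : Γ) (hh : h ∈ A) (hpos : ∀ g ∈ A, 1 ≤ R g) :
    ∃ g ∈ A, (∀ g' ∈ A, ¬ Disjoint (hN.ball g' (R g')) (hN.ball g (R g)) → R g' ≤ 2 * R g) ∧
      N (h * g⁻¹) + 3 * R h ≤ 3 * R g := by
  obtain ⟨B, hB⟩ : ∃ B, ∀ g ∈ A, R g ≤ B := ⟨A.sup R, fun g hg => Finset.le_sup hg⟩
  generalize hm : B - R h = m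
  induction m using Nat.strong_induction_on generalizing h with
  | _ m ih =>
    by_cases hmax : ∀ g' ∈ A, ¬ Disjoint (hN.ball g' (R g')) (hN.ball h (R h)) → R g' ≤ 2 * R h
    · exact ⟨h, hh, hmax, by simp [hN.eq_one]⟩
    push Not at hmax
    obtain ⟨h', hh', hd, hlt⟩ := hmax
    have h1 := hB h' hh'
    have h2 := hpos h hh
    obtain ⟨g, hg, hg1, hg2⟩ := ih (B - R h') (by omega) h' hh' rfl
    refine ⟨g, hg, hg1, ?_⟩
    have h3 := hN.dist_le_of_not_disjoint hd
    have h4 := hN.dist_triangle h h' g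
    have h5 := hN.dist_comm h h'
    omega

theorem growth_of_not_fill {D : ℝ} (hD : ∀ n, (hN.growth (2 * n) : ℝ) ≤ D * hN.growth n) {δ : ℝ}
    (hδ : 0 < δ) [DecidableEq Γ] :
    ∃ η > (0 : ℝ), ∃ q Λ : ℕ, 0 < q ∧ 1 ≤ Λ ∧ ∀ (A : Finset Γ) (r : ℕ → Γ → ℕ) (R : Γ → ℕ),
      (∀ g ∈ A, ∀ i j, i < j → j < q → Λ * r i g ≤ r j g) → (∀ g ∈ A, 1 ≤ r 0 g) →
      (∀ g ∈ A, ∀ i < q, Λ * r i g ≤ R g) →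
      (∀ g ∈ A, ∀ F : Finset (Γ × ℕ), (∀ p ∈ F, p.1 ∈ A ∧ p.2 < q) →
        (∀ p ∈ F, ∀ p' ∈ F, p ≠ p' →
          Disjoint (hN.ball p.1 (r p.2 p.1)) (hN.ball p'.1 (r p'.2 p'.1))) →
        (∀ p ∈ F, hN.ball p.1 (r p.2 p.1) ⊆ hN.ball g (R g)) →
        δ * hN.growth (R g) ≤
          ((hN.ball g (R g) \ F.biUnion fun p => hN.ball p.1 (r p.2 p.1)).card : ℝ)) →
      (1 + η) * ((A.biUnion fun g => hN.ball g (r 0 g)).card : ℝ) ≤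
        (A.biUnion fun g => hN.ball g (R g)).card := by
  have hD1 := hN.one_le_of_doubling hD
  obtain ⟨l, hl1, hl⟩ := hN.annular_decay hD (show 0 < δ / 8 by positivity)
  obtain ⟨q, hq⟩ := exists_nat_ge (D ^ 2 / (δ / 8))
  have hq' : D ^ 2 ≤ δ / 8 * q := by
    rw [div_le_iff₀ (by positivity)] at hq; linarith
  have hq0 : 0 < q := by
    rcases Nat.eq_zero_or_pos q with rfl | h
    · simp at hq'; nlinarith
    · exact h
  refine ⟨δ / (4 * D ^ 3), by positivity, q, 4 * (l + 1), hq0, by omega, ?_⟩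
  intro A r R hr hr1 hR hno
  set O := A.biUnion fun g => hN.ball g (r 0 g) with hO
  set O' := A.biUnion fun g => hN.ball g (R g) with hO'
  by_contra! hsmall
  have hpos : ∀ g ∈ A, 1 ≤ R g := by
    intro g hg
    have h1 := hR g hg 0 hq0
    have h2 := hr1 g hg
    nlinarith
  have hr0 : ∀ g ∈ A, r 0 g ≤ R g := by
    intro g hg
    have h1 := hR g hg 0 hq0
    nlinarith
  have hOO' : O ⊆ O' := by
    apply Finset.biUnion_mono
    intro g hg
    exact hN.ball_mono g (hr0 g hg)
  -- locally maximal balls and a disjoint subfamily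
  obtain ⟨G, hG, hdis, hdom⟩ := exists_greedy
    (A.filter fun g => ∀ g' ∈ A, ¬ Disjoint (hN.ball g' (R g')) (hN.ball g (R g)) → R g' ≤ 2 * R g) R
    (fun g g' => ¬ Disjoint (hN.ball g (R g)) (hN.ball g' (R g')))
    (fun p _ => by
      rw [Finset.not_disjoint_iff]
      exact ⟨p, hN.self_mem_ball _ _, hN.self_mem_ball _ _⟩)
    (fun p p' h => by rwa [disjoint_comm])
  have hGA : ∀ g ∈ G, g ∈ A := fun g hg => (Finset.mem_filter.1 (hG hg)).1
  have hGmax : ∀ g ∈ G, ∀ g' ∈ A, ¬ Disjoint (hN.ball g' (R g')) (hN.ball g (R g)) → R g' ≤ 2 * R g :=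
    fun g hg => (Finset.mem_filter.1 (hG hg)).2
  have hdisj : (G : Set Γ).PairwiseDisjoint fun g => hN.ball g (R g) := by
    intro x hx y hy hxy
    exact not_not.1 (hdis x hx y hy hxy)
  have hOcov : O ⊆ G.biUnion fun g => hN.ball g (6 * R g) := by
    intro y hy
    rw [hO, Finset.mem_biUnion] at hy
    obtain ⟨h, hh, hy⟩ := hy
    obtain ⟨g, hg, hg1, hg2⟩ := hN.exists_locally_maximal A R h hh hpos
    obtain ⟨g', hg', h1, h2⟩ := hdom g (Finset.mem_filter.2 ⟨hg, hg1⟩)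
    rw [Finset.mem_biUnion]
    refine ⟨g', hg', ?_⟩
    have h3 := hN.dist_le_of_not_disjoint h2
    rw [mem_ball] at hy ⊢
    have h4 := hN.dist_triangle g' g h
    have h5 := hN.dist_triangle g' h y
    have h6 := hN.dist_comm g' g
    have h7 := hN.dist_comm g h
    have h8 := hr0 h hh
    omega
  have hOle : (O.card : ℝ) ≤ D ^ 3 * ∑ g ∈ G, (hN.growth (R g) : ℝ) := by
    calc (O.card : ℝ) ≤ ((G.biUnion fun g => hN.ball g (6 * R g)).card : ℝ) := by
          exact_mod_cast Finset.card_le_card hOcov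
      _ ≤ ∑ g ∈ G, ((hN.ball g (6 * R g)).card : ℝ) := by exact_mod_cast Finset.card_biUnion_le
      _ ≤ ∑ g ∈ G, D ^ 3 * (hN.growth (R g) : ℝ) := by
          gcongr with g hg
          rw [hN.card_ball]
          refine le_trans ?_ (hN.growth_two_pow_mul hD 3 _)
          exact_mod_cast hN.growth_mono (by omega)
      _ = _ := by rw [Finset.mul_sum]
  have hdiff : ∑ g ∈ G, ((hN.ball g (R g) \ O).card : ℝ) ≤ O'.card - O.card := by
    have h1 : (O' \ O).card = O'.card - O.card := Finset.card_sdiff_of_subset hOO'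
    have h2 : ((O' \ O).card : ℝ) = O'.card - O.card := by
      rw [h1, Nat.cast_sub (Finset.card_le_card hOO')]
    rw [← h2, ← Nat.cast_sum, ← Finset.card_biUnion]
    · norm_cast
      apply Finset.card_le_card
      intro y hy
      rw [Finset.mem_biUnion] at hy
      obtain ⟨g, hg, hy⟩ := hy
      rw [Finset.mem_sdiff] at hy ⊢
      exact ⟨Finset.mem_biUnion.2 ⟨g, hGA g hg, hy.1⟩, hy.2⟩
    · intro x hx y hy hxy
      exact (hdisj hx hy hxy).mono Finset.sdiff_subset Finset.sdiff_subset
  obtain ⟨g, hg, hgO⟩ : ∃ g ∈ G, ((hN.ball g (R g) \ O).card : ℝ) < δ / 4 * hN.growth (R g) := by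
    by_contra! hall
    have h1 := Finset.sum_le_sum hall
    rw [← Finset.mul_sum] at h1
    have h2 : δ / (4 * D ^ 3) * (O.card : ℝ) ≤ δ / 4 * ∑ g ∈ G, (hN.growth (R g) : ℝ) := by
      calc δ / (4 * D ^ 3) * (O.card : ℝ)
          ≤ δ / (4 * D ^ 3) * (D ^ 3 * ∑ g ∈ G, (hN.growth (R g) : ℝ)) := by gcongr
        _ = _ := by field_simp
    linarith
  -- the ball around `g` is filled
  obtain ⟨w, hw⟩ : ∃ w, w = 4 * R g / (4 * (l + 1)) := ⟨_, rfl⟩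
  have hwR : (l + 1) * w ≤ R g := by
    have h1 : 4 * (l + 1) * w ≤ 4 * R g := hw ▸ Nat.mul_div_le _ _
    linarith
  have hwR' : w ≤ R g := by nlinarith
  have hann : (hN.growth (R g) : ℝ) - hN.growth (R g - w) ≤ δ / 8 * hN.growth (R g) := by
    have h1 := hl (R g - w) w (by rw [add_mul, one_mul] at hwR; omega)
    rw [Nat.sub_add_cancel hwR'] at h1
    have h2 : (hN.growth (R g - w) : ℝ) ≤ hN.growth (R g) := by
      exact_mod_cast hN.growth_mono (Nat.sub_le _ _)
    nlinarith
  set Y := O.filter fun y => y ∈ hN.ball g (R g - w) with hY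
  have hcen : ∀ y ∈ O, ∃ h ∈ A, y ∈ hN.ball h (r 0 h) := fun y hy => by
    rw [hO, Finset.mem_biUnion] at hy; exact hy
  choose! c hcA hcb using hcen
  have hYO : ∀ y ∈ Y, y ∈ O := fun y hy => (Finset.mem_filter.1 hy).1
  obtain ⟨F, hFY, hFdis, hFcov⟩ := hN.covering hD hl1 hl hq' hq0 Y c (fun j y => r j (c y))
    (fun y hy i j hij hj => by
      have hA := hcA y (hYO y hy)
      have h1 := hr _ hA i j hij hj
      have h2 : 1 ≤ r i (c y) := by
        rcases Nat.eq_zero_or_pos i with rfl | hi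
        · exact hr1 _ hA
        · have h3 := hr _ hA 0 i hi (by omega)
          have h4 := hr1 _ hA
          nlinarith
      nlinarith)
    (fun y hy => by
      have := hcb y (hYO y hy)
      rw [mem_ball, hN.dist_comm] at this
      exact this)
  have hsubB : ∀ p ∈ F, hN.ball (c p.1) (r p.2 (c p.1)) ⊆ hN.ball g (R g) := by
    intro p hp
    have h1 := Finset.mem_product.1 (hFY hp)
    have hpO := hYO _ h1.1
    have hA := hcA _ hpO
    have h2 := (Finset.mem_filter.1 h1.1).2
    have h3 := hcb _ hpO
    have hlt := Finset.mem_range.1 h1.2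
    have h4 : R (c p.1) ≤ 2 * R g := by
      apply hGmax g hg _ hA
      rw [Finset.not_disjoint_iff]
      exact ⟨p.1, hN.ball_mono _ (hr0 _ hA) h3, hN.ball_mono _ (Nat.sub_le _ _) h2⟩
    have h5 := hR _ hA p.2 hlt
    have h6 : r 0 (c p.1) ≤ r p.2 (c p.1) := by
      rcases Nat.eq_zero_or_pos p.2 with h | h
      · rw [h]
      · have := hr _ hA 0 p.2 h hlt
        nlinarith
    have h7 : 2 * r p.2 (c p.1) ≤ w := by
      rw [hw, Nat.le_div_iff_mul_le (by omega)]
      nlinarith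
    apply hN.ball_subset_ball
    rw [mem_ball] at h2 h3
    have h8 := hN.dist_triangle g p.1 (c p.1)
    have h9 := hN.dist_comm p.1 (c p.1)
    omega
  set F' := F.image fun p => (c p.1, p.2) with hF'
  have hF'dis : ∀ p ∈ F', ∀ p' ∈ F', p ≠ p' →
      Disjoint (hN.ball p.1 (r p.2 p.1)) (hN.ball p'.1 (r p'.2 p'.1)) := by
    intro p hp p' hp' hne
    rw [hF', Finset.mem_image] at hp hp'
    obtain ⟨a, ha, rfl⟩ := hp
    obtain ⟨b, hb, rfl⟩ := hp'
    exact hFdis a ha b hb (fun h => hne (by rw [h]))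
  have hU : F'.biUnion (fun p => hN.ball p.1 (r p.2 p.1)) =
      F.biUnion fun p => hN.ball (c p.1) (r p.2 (c p.1)) := by
    rw [hF', Finset.image_biUnion]
  have hfill := hno g (hGA g hg) F' (by
    intro p hp
    rw [hF', Finset.mem_image] at hp
    obtain ⟨a, ha, rfl⟩ := hp
    have h1 := Finset.mem_product.1 (hFY ha)
    exact ⟨hcA _ (hYO _ h1.1), Finset.mem_range.1 h1.2⟩) hF'dis (by
    intro p hp
    rw [hF', Finset.mem_image] at hp
    obtain ⟨a, ha, rfl⟩ := hp
    exact hsubB a ha)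
  rw [hU] at hfill
  set U := F.biUnion fun p => hN.ball (c p.1) (r p.2 (c p.1)) with hUdef
  have hUcard : ∑ p ∈ F, (hN.growth (r p.2 (c p.1)) : ℝ) ≤ hN.growth (R g) := by
    have h1 : U.card = ∑ p ∈ F, hN.growth (r p.2 (c p.1)) := by
      rw [hUdef, Finset.card_biUnion]
      · simp [card_ball]
      · intro x hx y hy hxy; exact hFdis x hx y hy hxy
    have h2 : U.card ≤ hN.growth (R g) := by
      rw [← hN.card_ball g]
      exact Finset.card_le_card (Finset.biUnion_subset.2 hsubB)
    rw [h1] at h2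
    exact_mod_cast h2
  have hYU := hFcov (U : Set Γ) (fun z => by simp [hUdef]) (Y \ U) (fun z hz => by
    rw [Finset.mem_sdiff] at hz; exact ⟨hz.1, by simpa using hz.2⟩)
  have hsub3 : hN.ball g (R g) \ U ⊆ (hN.ball g (R g) \ hN.ball g (R g - w)) ∪
      ((hN.ball g (R g) \ O) ∪ (Y \ U)) := by
    intro z hz
    rw [Finset.mem_sdiff] at hz
    simp only [Finset.mem_union, Finset.mem_sdiff, hY, Finset.mem_filter]
    tauto
  have hcard3 : ((hN.ball g (R g) \ U).card : ℝ) ≤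
      ((hN.growth (R g) : ℝ) - hN.growth (R g - w)) + ((hN.ball g (R g) \ O).card + (Y \ U).card) := by
    have h1 : (hN.ball g (R g) \ hN.ball g (R g - w)).card =
        hN.growth (R g) - hN.growth (R g - w) := by
      rw [Finset.card_sdiff_of_subset (hN.ball_mono _ (Nat.sub_le _ _)), hN.card_ball, hN.card_ball]
    rw [← Nat.cast_sub (hN.growth_mono (Nat.sub_le _ _)), ← h1]
    norm_cast
    refine (Finset.card_le_card hsub3).trans ((Finset.card_union_le _ _).trans ?_)
    gcongr
    exact Finset.card_union_le _ _
  have hfpos : (0 : ℝ) < hN.growth (R g) := by exact_mod_cast hN.growth_pos _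
  nlinarith

end GeodesicLength

namespace GeodesicLength

variable {Γ : Type*} [Group Γ] {N : Γ → ℕ} (hN : GeodesicLength N)
include hN

/-- Radii along which the growth function jumps by a definite factor grow geometrically. -/
theorem radii_separated {D : ℝ} (hD : ∀ n, (hN.growth (2 * n) : ℝ) ≤ D * hN.growth n) {δ : ℝ}
    (hδ : 0 < δ) (hδ1 : δ < 1) (Λ : ℕ) :
    ∃ L : ℕ, 1 ≤ L ∧ ∀ (i j : ℕ → ℕ) (m₀ k : ℕ), (∀ m, m + 1 < k → j m ≤ i (m + 1)) →
      (∀ m, m₀ ≤ m → m < k → (hN.growth (i m) : ℝ) ≤ (1 - δ) * hN.growth (j m)) →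
      ∀ m n, m₀ ≤ m → L ≤ n → m + n < k → Λ * i m ≤ i (m + n) := by
  have hD1 := hN.one_le_of_doubling hD
  obtain ⟨s, hs⟩ : ∃ s, Λ ≤ 2 ^ s := ⟨Λ, Nat.lt_two_pow_self.le⟩
  obtain ⟨L, hL⟩ := exists_pow_lt_of_lt_one (show 0 < 1 / D ^ s by positivity)
    (show 1 - δ < 1 by linarith)
  refine ⟨L + 1, by omega, fun i j m₀ k hji hgr => ?_⟩
  have key : ∀ m n, m₀ ≤ m → m + n < k →
      (hN.growth (i m) : ℝ) ≤ (1 - δ) ^ n * hN.growth (i (m + n)) := by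
    intro m n hm
    induction n with
    | zero => intro; simp
    | succ n ih =>
      intro h
      have h1 := ih (by omega)
      have h2 := hgr (m + n) (by omega) (by omega)
      have h3 : (hN.growth (j (m + n)) : ℝ) ≤ hN.growth (i (m + (n + 1))) := by
        exact_mod_cast hN.growth_mono (hji (m + n) (by omega))
      calc (hN.growth (i m) : ℝ) ≤ (1 - δ) ^ n * hN.growth (i (m + n)) := h1
        _ ≤ (1 - δ) ^ n * ((1 - δ) * hN.growth (i (m + (n + 1)))) := by
          have : 0 < 1 - δ := by linarith
          gcongr
          exact h2.trans (by gcongr)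
        _ = _ := by ring
  intro m n hm hn hk
  by_contra! hlt
  have h1 := key m n hm hk
  have h2 : (hN.growth (i (m + n)) : ℝ) ≤ D ^ s * hN.growth (i m) := by
    refine le_trans ?_ (hN.growth_two_pow_mul hD s _)
    exact_mod_cast hN.growth_mono (hlt.le.trans (Nat.mul_le_mul_right _ hs))
  have h3 : (1 - δ) ^ n ≤ (1 - δ) ^ L :=
    pow_le_pow_of_le_one (by linarith) (by linarith) (by omega)
  have h4 : (0 : ℝ) < hN.growth (i (m + n)) := by exact_mod_cast hN.growth_pos _
  have h5 : D ^ s * (1 - δ) ^ n < 1 := by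
    have : (1 - δ) ^ n < 1 / D ^ s := h3.trans_lt hL
    rw [lt_div_iff₀ (by positivity)] at this
    linarith
  have h6 : D ^ s * (hN.growth (i m) : ℝ) ≤ D ^ s * ((1 - δ) ^ n * hN.growth (i (m + n))) := by
    gcongr
  nlinarith

/-- The deterministic estimate behind the upcrossing theorem: a set of centres carrying `k` pairs of
radii, none of whose outer balls is filled by disjoint inner balls, has exponentially small density. -/
theorem card_upcrossing_le {D : ℝ} (hD : ∀ n, (hN.growth (2 * n) : ℝ) ≤ D * hN.growth n) {δ : ℝ}
    (hδ : 0 < δ) (hδ1 : δ < 1) [DecidableEq Γ] :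
    ∃ c > (0 : ℝ), ∃ ρ ∈ Set.Ioo (0 : ℝ) 1, ∀ k, 1 ≤ k → ∀ (A : Finset Γ) (i j : Γ → ℕ → ℕ) (R : ℕ),
      (∀ g ∈ A, ∀ m < k, 1 ≤ i g m ∧ i g m < j g m ∧ j g m ≤ R) →
      (∀ g ∈ A, ∀ m, m + 1 < k → j g m < i g (m + 1)) →
      (∀ g ∈ A, ∀ m < k, k < j g m → ∀ F : Finset (Γ × ℕ),
        (∀ p ∈ F, p.1 ∈ A ∧ ∃ m' < k, p.2 = i p.1 m') →
        (∀ p ∈ F, ∀ p' ∈ F, p ≠ p' → Disjoint (hN.ball p.1 p.2) (hN.ball p'.1 p'.2)) →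
        (∀ p ∈ F, hN.ball p.1 p.2 ⊆ hN.ball g (j g m)) →
        δ * hN.growth (j g m) ≤
          ((hN.ball g (j g m) \ F.biUnion fun p => hN.ball p.1 p.2).card : ℝ)) →
      (A.card : ℝ) ≤ c * ρ ^ k * (A.biUnion fun g => hN.ball g R).card := by
  obtain ⟨η, hη, q, Λ, hq0, hΛ, hgrow⟩ := hN.growth_of_not_fill hD hδ
  obtain ⟨L, hL1, hsep⟩ := hN.radii_separated hD hδ hδ1 Λ
  set P := (q + 1) * L with hP
  have hP0 : 0 < P := by positivity
  set x : ℝ := 1 / (1 + η) with hx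
  have hx0 : 0 < x := by positivity
  have hx1 : x < 1 := by rw [hx, div_lt_one (by positivity)]; linarith
  set ρ : ℝ := x ^ (((4 * P : ℕ) : ℝ)⁻¹) with hρ
  have hρP : ρ ^ (4 * P) = x := Real.rpow_inv_natCast_pow hx0.le (by omega)
  have hρ0 : 0 < ρ := Real.rpow_pos_of_pos hx0 _
  have hρ1 : ρ < 1 := by
    apply Real.rpow_lt_one hx0.le hx1
    have : (0 : ℝ) < (4 * P : ℕ) := by exact_mod_cast (by omega : 0 < 4 * P)
    positivity
  refine ⟨(ρ ^ (4 * P + 8))⁻¹, by positivity, ρ, ⟨hρ0, hρ1⟩, ?_⟩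
  intro k hk A i j R hij hji hno
  -- it is enough to gain `t` factors
  obtain ⟨m₀, hm₀⟩ : ∃ m₀, m₀ = (k + 1) / 2 := ⟨_, rfl⟩
  have hlow : ∀ g ∈ A, ∀ m < k, 2 * m + 1 ≤ i g m := by
    intro g hg m
    induction m with
    | zero => intro h; simpa using (hij g hg 0 h).1
    | succ m ih =>
      intro h
      have h1 := ih (by omega)
      have h2 := hij g hg m (by omega)
      have h3 := hji g hg m h
      omega
  have hmono : ∀ g ∈ A, ∀ m n, m + n < k → i g m ≤ i g (m + n) := by
    intro g hg m n
    induction n with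
    | zero => intro; simp
    | succ n ih =>
      intro h
      have h1 := ih (by omega)
      have h2 := hij g hg (m + n) (by omega)
      have h3 := hji g hg (m + n) h
      rw [← add_assoc]
      omega
  have hone : ∀ g ∈ A, ∀ m, m₀ ≤ m → m < k →
      (hN.growth (i g m) : ℝ) ≤ (1 - δ) * hN.growth (j g m) := by
    intro g hg m hm hmk
    have h1 := hij g hg m hmk
    have h2 := hlow g hg m hmk
    have hsub : hN.ball g (i g m) ⊆ hN.ball g (j g m) := hN.ball_mono g h1.2.1.le
    have h3 := hno g hg m hmk (by omega) {(g, i g m)} (by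
      intro p hp
      rw [Finset.mem_singleton] at hp
      subst hp
      exact ⟨hg, m, hmk, rfl⟩) (by
      intro p hp p' hp' hne
      rw [Finset.mem_singleton] at hp hp'
      exact absurd (hp.trans hp'.symm) hne) (by
      intro p hp
      rw [Finset.mem_singleton] at hp
      subst hp
      exact hsub)
    rw [Finset.singleton_biUnion, Finset.card_sdiff_of_subset hsub,
      Nat.cast_sub (Finset.card_le_card hsub), hN.card_ball, hN.card_ball] at h3
    linarith
  have hΛsep : ∀ g ∈ A, ∀ m n, m₀ ≤ m → L ≤ n → m + n < k → Λ * i g m ≤ i g (m + n) := by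
    intro g hg
    exact hsep (i g) (j g) m₀ k (fun m hm => (hji g hg m hm).le) (hone g hg)
  have hstep : ∀ t, m₀ + t * P < k → (1 + η) ^ t * (A.card : ℝ) ≤
      (A.biUnion fun g => hN.ball g (i g (m₀ + t * P))).card := by
    intro t
    induction t with
    | zero =>
      intro _
      simp only [pow_zero, one_mul, Nat.cast_le]
      apply Finset.card_le_card
      intro g hg
      exact Finset.mem_biUnion.2 ⟨g, hg, hN.self_mem_ball _ _⟩
    | succ t ih =>
      intro ht
      have hPt : (t + 1) * P = t * P + q * L + L := by rw [hP]; ring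
      rw [hPt] at ht
      have hlev : ∀ l, l ≤ q → l * L ≤ q * L := fun l hl => Nat.mul_le_mul_right _ hl
      have hlt : ∀ a b, a < b → a * L + L ≤ b * L := fun a b hab => by
        have := Nat.mul_le_mul_right L (Nat.succ_le_of_lt hab)
        rw [Nat.succ_eq_add_one, add_mul, one_mul] at this; exact this
      have h1 := hgrow A (fun l g => i g (m₀ + t * P + l * L)) (fun g => j g (m₀ + t * P + q * L))
        (fun g hg a b hab hb => by
          have e1 := hlt a b hab
          have e2 := hlev b hb.le
          have := hΛsep g hg (m₀ + t * P + a * L) (b * L - a * L) (by omega) (by omega) (by omega)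
          rwa [show m₀ + t * P + a * L + (b * L - a * L) = m₀ + t * P + b * L by omega] at this)
        (fun g hg => by
          have := hij g hg (m₀ + t * P + 0 * L) (by omega)
          exact this.1)
        (fun g hg a ha => by
          have e1 := hlt a q ha
          have := hΛsep g hg (m₀ + t * P + a * L) (q * L - a * L) (by omega) (by omega) (by omega)
          rw [show m₀ + t * P + a * L + (q * L - a * L) = m₀ + t * P + q * L by omega] at this
          exact this.trans (hij g hg _ (by omega)).2.1.le)
        (fun g hg F hF hdis hsub => by
          have e1 := hij g hg (m₀ + t * P + q * L) (by omega)
          have e2 := hlow g hg (m₀ + t * P + q * L) (by omega)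
          have := hno g hg (m₀ + t * P + q * L) (by omega) (by omega)
            (F.image fun p => (p.1, i p.1 (m₀ + t * P + p.2 * L))) (by
              intro p hp
              rw [Finset.mem_image] at hp
              obtain ⟨a, ha, rfl⟩ := hp
              have e3 := hlev a.2 (hF a ha).2.le
              exact ⟨(hF a ha).1, m₀ + t * P + a.2 * L, by omega, rfl⟩) (by
              intro p hp p' hp' hne
              rw [Finset.mem_image] at hp hp'
              obtain ⟨a, ha, rfl⟩ := hp
              obtain ⟨b, hb, rfl⟩ := hp'
              exact hdis a ha b hb (fun h => hne (by rw [h]))) (by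
              intro p hp
              rw [Finset.mem_image] at hp
              obtain ⟨a, ha, rfl⟩ := hp
              exact hsub a ha)
          rw [Finset.image_biUnion] at this
          exact this)
      have h2 := ih (by omega)
      have h3 : (A.biUnion fun g => hN.ball g (j g (m₀ + t * P + q * L))).card ≤
          (A.biUnion fun g => hN.ball g (i g (m₀ + (t + 1) * P))).card := by
        apply Finset.card_le_card
        apply Finset.biUnion_mono
        intro g hg
        apply hN.ball_mono
        have e1 := hji g hg (m₀ + t * P + q * L) (by omega)
        have e2 := hmono g hg (m₀ + t * P + q * L + 1) (L - 1) (by omega)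
        rw [show m₀ + t * P + q * L + 1 + (L - 1) = m₀ + (t + 1) * P by rw [hPt]; omega] at e2
        omega
      simp only [zero_mul, add_zero] at h1
      calc (1 + η) ^ (t + 1) * (A.card : ℝ) = (1 + η) * ((1 + η) ^ t * A.card) := by ring
        _ ≤ (1 + η) * (A.biUnion fun g => hN.ball g (i g (m₀ + t * P))).card := by gcongr
        _ ≤ _ := h1
        _ ≤ _ := by exact_mod_cast h3
  have hU : A.card ≤ (A.biUnion fun g => hN.ball g R).card := by
    apply Finset.card_le_card
    intro g hg
    exact Finset.mem_biUnion.2 ⟨g, hg, hN.self_mem_ball _ _⟩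
  have hfinal : ∀ t, k ≤ 4 * P * t + (4 * P + 8) → x ^ t ≤ (ρ ^ (4 * P + 8))⁻¹ * ρ ^ k := by
    intro t ht
    rw [← hρP, ← pow_mul, inv_mul_eq_div, le_div_iff₀ (by positivity), ← pow_add]
    exact pow_le_pow_of_le_one hρ0.le hρ1.le ht
  rcases Nat.lt_or_ge k 2 with hk2 | hk2
  · have h1 := hfinal 0 (by omega)
    rw [pow_zero] at h1
    calc (A.card : ℝ) ≤ 1 * (A.biUnion fun g => hN.ball g R).card := by
          rw [one_mul]; exact_mod_cast hU
      _ ≤ _ := by gcongr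
  · obtain ⟨t, ht⟩ : ∃ t, t = (k - 1 - m₀) / P := ⟨_, rfl⟩
    have h1 : t * P ≤ k - 1 - m₀ := by rw [ht]; exact Nat.div_mul_le_self _ _
    have h2 : k - 1 - m₀ < t * P + P := by
      have := Nat.lt_div_mul_add (a := k - 1 - m₀) hP0
      rwa [← ht] at this
    have h3 := hstep t (by omega)
    have h4 : (A.biUnion fun g => hN.ball g (i g (m₀ + t * P))).card ≤
        (A.biUnion fun g => hN.ball g R).card := by
      apply Finset.card_le_card
      apply Finset.biUnion_mono
      intro g hg
      apply hN.ball_mono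
      have := hij g hg (m₀ + t * P) (by omega)
      omega
    have h5 := hfinal t (by
      have : 4 * P * t = 4 * (t * P) := by ring
      omega)
    have h6 : (A.card : ℝ) ≤ x ^ t * (A.biUnion fun g => hN.ball g R).card := by
      rw [hx, div_pow, one_pow, div_mul_eq_mul_div, one_mul, le_div_iff₀ (by positivity)]
      calc (A.card : ℝ) * (1 + η) ^ t = (1 + η) ^ t * A.card := mul_comm _ _
        _ ≤ _ := h3
        _ ≤ _ := by exact_mod_cast h4
    exact h6.trans (by gcongr)

end GeodesicLength

section WordLength

variable {Γ : Type*} [Group Γ] {S : Set Γ}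

theorem exists_word_of_closure_eq_top (hS : Subgroup.closure S = ⊤) (g : Γ) :
    ∃ n, ∃ f : Fin n → Γ, (∀ i, f i ∈ S ∨ (f i)⁻¹ ∈ S) ∧ g = (List.ofFn f).prod := by
  have hg : g ∈ Subgroup.closure S := hS ▸ Subgroup.mem_top g
  rw [← Subgroup.mem_toSubmonoid, Subgroup.closure_toSubmonoid] at hg
  obtain ⟨l, hl, rfl⟩ := Submonoid.exists_list_of_mem_closure hg
  refine ⟨l.length, l.get, fun i => by simpa using hl _ (List.get_mem l i), ?_⟩
  rw [List.ofFn_get]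

theorem wordNorm_le_iff (hS : Subgroup.closure S = ⊤) {g : Γ} {n : ℕ} :
    wordNorm S g ≤ n ↔ ∃ l : List Γ, l.length ≤ n ∧ (∀ x ∈ l, x ∈ S ∨ x⁻¹ ∈ S) ∧ g = l.prod := by
  have hne : {n : ℕ | ∃ f : Fin n → Γ, (∀ i, f i ∈ S ∨ (f i)⁻¹ ∈ S) ∧ g = (List.ofFn f).prod}.Nonempty :=
    exists_word_of_closure_eq_top hS g
  constructor
  · intro h
    obtain ⟨f, hf, hg⟩ := Nat.sInf_mem hne
    refine ⟨List.ofFn f, by rw [List.length_ofFn]; exact h, ?_, hg⟩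
    intro x hx
    rw [List.mem_ofFn] at hx
    obtain ⟨i, rfl⟩ := hx
    exact hf i
  · rintro ⟨l, hl, hmem, rfl⟩
    refine le_trans (Nat.sInf_le ?_) hl
    exact ⟨l.get, fun i => hmem _ (List.get_mem l i), by rw [List.ofFn_get]⟩

theorem geodesicLength_wordNorm (hfin : S.Finite) (hS : Subgroup.closure S = ⊤) :
    GeodesicLength (wordNorm S) := by
  have hmul : ∀ g h : Γ, wordNorm S (g * h) ≤ wordNorm S g + wordNorm S h := by
    intro g h
    obtain ⟨l, hl, hm, rfl⟩ := (wordNorm_le_iff hS (g := g)).1 le_rfl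
    obtain ⟨l', hl', hm', rfl⟩ := (wordNorm_le_iff hS (g := h)).1 le_rfl
    rw [wordNorm_le_iff hS]
    refine ⟨l ++ l', by rw [List.length_append]; omega, ?_, by simp⟩
    intro x hx
    rcases List.mem_append.1 hx with h | h
    · exact hm x h
    · exact hm' x h
  have hinv : ∀ g : Γ, wordNorm S g⁻¹ ≤ wordNorm S g := by
    intro g
    obtain ⟨l, hl, hm, hg⟩ := (wordNorm_le_iff hS (g := g)).1 le_rfl
    rw [wordNorm_le_iff hS]
    refine ⟨(l.map fun x => x⁻¹).reverse, by simpa using hl, ?_, ?_⟩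
    · intro x hx
      simp only [List.mem_reverse, List.mem_map] at hx
      obtain ⟨a, ha, rfl⟩ := hx
      rw [inv_inv]
      exact (hm a ha).symm
    · rw [hg, List.prod_inv_reverse]
  refine ⟨?_, fun g => le_antisymm (hinv g) (by simpa using hinv g⁻¹), hmul, ?_, ?_⟩
  · rw [← Nat.le_zero, wordNorm_le_iff hS]
    exact ⟨[], by simp⟩
  · intro g a ha
    obtain ⟨l, hl, hm, hg⟩ := (wordNorm_le_iff hS (g := g)).1 le_rfl
    have hprod : g = (l.take a).prod * (l.drop a).prod := by
      rw [← List.prod_append, List.take_append_drop, hg]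
    have h1 : wordNorm S (l.take a).prod ≤ a :=
      (wordNorm_le_iff hS).2 ⟨_, by simp, fun x hx => hm x (List.mem_of_mem_take hx), rfl⟩
    have h2 : wordNorm S (l.drop a).prod ≤ wordNorm S g - a :=
      (wordNorm_le_iff hS).2 ⟨_, by rw [List.length_drop]; omega,
        fun x hx => hm x (List.mem_of_mem_drop hx), rfl⟩
    have h3 := hmul (l.take a).prod (l.drop a).prod
    rw [← hprod] at h3
    exact ⟨_, _, hprod, by omega, by omega⟩
  · intro r
    have hT : (S ∪ (fun x => x⁻¹) '' S).Finite := hfin.union (hfin.image _)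
    have : Finite (S ∪ (fun x => x⁻¹) '' S : Set Γ) := hT
    have hfl : {l : List (S ∪ (fun x => x⁻¹) '' S : Set Γ) | l.length ≤ r}.Finite :=
      List.finite_length_le _ r
    refine (hfl.image (fun l => (l.map Subtype.val).prod)).subset ?_
    intro g hg
    obtain ⟨l, hl, hm, rfl⟩ := (wordNorm_le_iff hS).1 hg
    refine ⟨l.pmap Subtype.mk (fun x hx => ?_), ?_, ?_⟩
    · rcases hm x hx with h | h
      · exact Or.inl h
      · exact Or.inr ⟨x⁻¹, h, by simp⟩
    · simpa using hl
    · simp [List.map_pmap]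

end WordLength

section Transference

variable {Γ : Type*} [Group Γ]

/-- `k` upcrossings across `(α, β)` of the sequence of averages around `g`, at radii at most `R`. -/
def UpcrossingBy (α β : ℝ) (k R : ℕ) (g : Γ) (ω : Γ × ℕ → ℝ) : Prop :=
  ∃ i j : ℕ → ℕ,
    (∀ m < k, (1 ≤ i m ∧ i m < j m ∧ ω (g, i m) < α ∧ β < ω (g, j m)) ∧ j m ≤ R) ∧
    (∀ m, m + 1 < k → j m < i (m + 1))

/-- Some ball around `g` of radius `n > k` with average above `β` is `δ`-filled by disjoint balls with
averages below `α`. -/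
def FilledAt (S : Set Γ) (α β δ : ℝ) (k : ℕ) (g : Γ) (ω : Γ × ℕ → ℝ) : Prop :=
  ∃ n : ℕ, k < n ∧ β < ω (g, n) ∧
    ∃ (m : ℕ) (ctr : Fin m → Γ) (rad : Fin m → ℕ),
      (∀ i, wordBall S (ctr i) (rad i) ⊆ wordBall S g n) ∧
      (Pairwise fun i i' =>
        Disjoint (wordBall S (ctr i) (rad i)) (wordBall S (ctr i') (rad i'))) ∧
      ((Nat.card ↥(wordBall S g n \ ⋃ i, wordBall S (ctr i) (rad i)) : ℝ)
        < δ * (Nat.card (wordBall S g n) : ℝ)) ∧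
      (∀ i, ω (ctr i, rad i) < α)

theorem measurableSet_upcrossingBy (α β : ℝ) (k R : ℕ) (g : Γ) :
    MeasurableSet {ω | UpcrossingBy α β k R g ω} := by
  have : {ω | UpcrossingBy α β k R g ω} = ⋃ a : Fin k → ℕ, ⋃ b : Fin k → ℕ,
      {ω | (∀ m : Fin k, (1 ≤ a m ∧ a m < b m ∧ ω (g, a m) < α ∧ β < ω (g, b m)) ∧ b m ≤ R) ∧
        ∀ m, ∀ h : m + 1 < k, b ⟨m, by omega⟩ < a ⟨m + 1, h⟩} := by
    ext ω
    simp only [Set.mem_iUnion, Set.mem_ofPred_eq]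
    constructor
    · rintro ⟨i, j, h1, h2⟩
      exact ⟨fun m => i m, fun m => j m, fun m => h1 m m.2, fun m h => h2 m h⟩
    · rintro ⟨a, b, h1, h2⟩
      refine ⟨fun m => if h : m < k then a ⟨m, h⟩ else 0, fun m => if h : m < k then b ⟨m, h⟩ else 0,
        fun m hm => ?_, fun m hm => ?_⟩
      · simpa [hm] using h1 ⟨m, hm⟩
      · have : m < k := by omega
        simpa [hm, this] using h2 m hm
  rw [this]
  refine MeasurableSet.iUnion fun a => MeasurableSet.iUnion fun b => ?_
  simp only [Set.ofPred_and, Set.ofPred_forall]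
  refine MeasurableSet.inter (MeasurableSet.iInter fun m => ?_) (MeasurableSet.iInter fun m =>
    MeasurableSet.iInter fun h => MeasurableSet.const _)
  exact ((MeasurableSet.const _).inter ((MeasurableSet.const _).inter
    ((measurableSet_lt (measurable_pi_apply _) measurable_const).inter
      (measurableSet_lt measurable_const (measurable_pi_apply _))))).inter (MeasurableSet.const _)

theorem measurableSet_filledAt [Countable Γ] (S : Set Γ) (α β δ : ℝ) (k : ℕ) (g : Γ) :
    MeasurableSet {ω | FilledAt S α β δ k g ω} := by
  simp only [FilledAt, Set.ofPred_exists, Set.ofPred_and, Set.ofPred_forall]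
  refine MeasurableSet.iUnion fun n => (MeasurableSet.const _).inter
    ((measurableSet_lt measurable_const (measurable_pi_apply _)).inter
      (MeasurableSet.iUnion fun m => MeasurableSet.iUnion fun ctr => MeasurableSet.iUnion fun rad => ?_))
  exact (MeasurableSet.iInter fun _ => MeasurableSet.const _).inter ((MeasurableSet.const _).inter
    ((MeasurableSet.const _).inter (MeasurableSet.iInter fun i =>
      measurableSet_lt (measurable_pi_apply _) measurable_const)))

theorem wordBall_mul (S : Set Γ) (c h : Γ) (r : ℕ) :
    wordBall S (c * h) r = (fun y => y * h⁻¹) ⁻¹' wordBall S c r := by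
  ext y
  simp [wordBall, mul_assoc]

theorem upcrossingBy_translate (α β : ℝ) (k R : ℕ) (g : Γ) (ω : Γ × ℕ → ℝ) :
    UpcrossingBy α β k R 1 (fun p => ω (p.1 * g, p.2)) ↔ UpcrossingBy α β k R g ω := by
  simp [UpcrossingBy]

theorem filledAt_translate (S : Set Γ) (α β δ : ℝ) (k : ℕ) (g : Γ) (ω : Γ × ℕ → ℝ) :
    FilledAt S α β δ k 1 (fun p => ω (p.1 * g, p.2)) ↔ FilledAt S α β δ k g ω := by
  have hinj : Function.Injective fun y : Γ => y * g⁻¹ := mul_left_injective _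
  have hsurj : Function.Surjective fun y : Γ => y * g⁻¹ := fun y => ⟨y * g, by simp⟩
  have hcard : ∀ s : Set Γ, Nat.card ((fun y : Γ => y * g⁻¹) ⁻¹' s : Set Γ) = Nat.card s :=
    fun s => Nat.card_preimage_of_injective hinj (by rw [hsurj.range_eq]; exact Set.subset_univ _)
  have hball : ∀ n, wordBall S g n = (fun y => y * g⁻¹) ⁻¹' wordBall S 1 n := by
    intro n
    have := wordBall_mul S 1 g n
    rwa [one_mul] at this
  have aux : ∀ (n m : ℕ) (ctr : Fin m → Γ) (rad : Fin m → ℕ),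
      ((∀ i, wordBall S (ctr i * g) (rad i) ⊆ wordBall S g n) ∧
      (Pairwise fun i i' =>
        Disjoint (wordBall S (ctr i * g) (rad i)) (wordBall S (ctr i' * g) (rad i'))) ∧
      ((Nat.card ↥(wordBall S g n \ ⋃ i, wordBall S (ctr i * g) (rad i)) : ℝ)
        < δ * (Nat.card (wordBall S g n) : ℝ)) ∧
      (∀ i, ω (ctr i * g, rad i) < α)) ↔
      ((∀ i, wordBall S (ctr i) (rad i) ⊆ wordBall S 1 n) ∧
      (Pairwise fun i i' =>
        Disjoint (wordBall S (ctr i) (rad i)) (wordBall S (ctr i') (rad i'))) ∧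
      ((Nat.card ↥(wordBall S 1 n \ ⋃ i, wordBall S (ctr i) (rad i)) : ℝ)
        < δ * (Nat.card (wordBall S 1 n) : ℝ)) ∧
      (∀ i, ω (ctr i * g, rad i) < α)) := by
    intro n m ctr rad
    simp only [wordBall_mul, hball, hsurj.preimage_subset_preimage_iff,
      Set.disjoint_preimage_iff hsurj, ← Set.preimage_iUnion, ← Set.preimage_sdiff, hcard]
  unfold FilledAt
  refine exists_congr fun n => and_congr Iff.rfl (and_congr (by simp) ?_)
  constructor
  · rintro ⟨m, ctr, rad, h⟩
    exact ⟨m, fun i => ctr i * g, rad, (aux n m ctr rad).2 h⟩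
  · rintro ⟨m, ctr, rad, h⟩
    refine ⟨m, fun i => ctr i * g⁻¹, rad, (aux n m _ rad).1 ?_⟩
    simpa using h

theorem GeodesicLength.coe_ball {S : Set Γ} (hN : GeodesicLength (wordNorm S)) (g : Γ) (r : ℕ) :
    (hN.ball g r : Set Γ) = wordBall S g r := by
  ext y
  simp [hN.mem_ball, wordBall]

theorem GeodesicLength.card_upcrossing_not_filled_le {S : Set Γ} (hN : GeodesicLength (wordNorm S))
    {D : ℝ} (hD : ∀ n, (hN.growth (2 * n) : ℝ) ≤ D * hN.growth n) {δ : ℝ}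
    (hδ : 0 < δ) (hδ1 : δ < 1) :
    ∃ c > (0 : ℝ), ∃ ρ ∈ Set.Ioo (0 : ℝ) 1, ∀ k, 1 ≤ k → ∀ (α β : ℝ) (ω : Γ × ℕ → ℝ) (M R : ℕ)
      (A : Finset Γ), A ⊆ hN.ball 1 M →
      (∀ g ∈ A, UpcrossingBy α β k R g ω ∧ ¬ FilledAt S α β δ k g ω) →
      (A.card : ℝ) ≤ c * ρ ^ k * hN.growth (M + R) := by
  classical
  obtain ⟨c, hc, ρ, hρ, H⟩ := hN.card_upcrossing_le hD hδ hδ1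
  refine ⟨c, hc, ρ, hρ, fun k hk α β ω M R A hAM hA => ?_⟩
  choose! i j h1 h2 using fun g hg => (hA g hg).1
  refine (H k hk A i j R (fun g hg m hm => ?_) h2 (fun g hg m hm hkm F hF hdis hsub => ?_)).trans ?_
  · obtain ⟨⟨a1, a2, a3, a4⟩, a5⟩ := h1 g hg m hm
    exact ⟨a1, a2, a5⟩
  · by_contra! hlt
    refine (hA g hg).2 ⟨j g m, hkm, (h1 g hg m hm).1.2.2.2, F.card,
      fun a => (F.equivFin.symm a : Γ × ℕ).1, fun a => (F.equivFin.symm a : Γ × ℕ).2,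
      fun a => ?_, fun a b hab => ?_, ?_, fun a => ?_⟩
    · rw [← hN.coe_ball, ← hN.coe_ball, Finset.coe_subset]
      exact hsub _ (F.equivFin.symm a).2
    · simp only
      rw [← hN.coe_ball, ← hN.coe_ball, Finset.disjoint_coe]
      refine hdis _ (F.equivFin.symm a).2 _ (F.equivFin.symm b).2 fun h => hab ?_
      exact F.equivFin.symm.injective (Subtype.ext h)
    · have e1 : (wordBall S g (j g m) \ ⋃ a, wordBall S (F.equivFin.symm a : Γ × ℕ).1
          (F.equivFin.symm a : Γ × ℕ).2) =
          ((hN.ball g (j g m) \ F.biUnion fun p => hN.ball p.1 p.2 : Finset Γ) : Set Γ) := by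
        rw [Finset.coe_sdiff, hN.coe_ball, Finset.coe_biUnion]
        congr 1
        ext y
        simp only [Set.mem_iUnion, hN.coe_ball, Finset.mem_coe]
        constructor
        · rintro ⟨a, ha⟩
          exact ⟨_, (F.equivFin.symm a).2, ha⟩
        · rintro ⟨p, hp, hy⟩
          exact ⟨F.equivFin ⟨p, hp⟩, by simpa using hy⟩
      rw [e1, ← hN.coe_ball, Nat.card_coe_set_eq, Nat.card_coe_set_eq, Set.ncard_coe_finset,
        Set.ncard_coe_finset, hN.card_ball]
      exact hlt
    · obtain ⟨hpA, m', hm', he⟩ := hF _ (F.equivFin.symm a).2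
      have := (h1 _ hpA m' hm').1.2.2.1
      rw [← he] at this
      exact this
  · have : 0 ≤ c * ρ ^ k := mul_nonneg hc.le (pow_nonneg hρ.1.le _)
    gcongr
    apply Finset.card_le_card
    rw [Finset.biUnion_subset]
    intro g hg
    apply hN.ball_subset_ball
    have := hN.mem_ball.1 (hAM hg)
    omega

theorem GeodesicLength.measure_upcrossing_le [Countable Γ] {S : Set Γ}
    (hN : GeodesicLength (wordNorm S))
    {D : ℝ} (hD : ∀ n, (hN.growth (2 * n) : ℝ) ≤ D * hN.growth n) {δ : ℝ}
    (hδ : 0 < δ) (hδ1 : δ < 1) :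
    ∃ c > (0 : ℝ), ∃ ρ ∈ Set.Ioo (0 : ℝ) 1, ∀ (X : Type) (_ : MeasurableSpace X) (P : Measure X)
      (F : Γ → ℕ → X → ℝ), (∀ g r, Measurable (F g r)) →
      (∀ h : Γ, Measure.map (fun x => fun p : Γ × ℕ => F (p.1 * h) p.2 x) P =
        Measure.map (fun x => fun p : Γ × ℕ => F p.1 p.2 x) P) →
      IsProbabilityMeasure P → ∀ k, 1 ≤ k → ∀ (α β : ℝ) (R : ℕ),
      P {x | UpcrossingBy α β k R 1 (fun p => F p.1 p.2 x) ∧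
        ¬ FilledAt S α β δ k 1 (fun p => F p.1 p.2 x)} ≤ ENNReal.ofReal (c * ρ ^ k) := by
  classical
  obtain ⟨c, hc, ρ, hρ, H⟩ := hN.card_upcrossing_not_filled_le hD hδ hδ1
  have hD1 := hN.one_le_of_doubling hD
  refine ⟨c * D, by positivity, ρ, hρ, fun X _ P F hF hst hP k hk α β R => ?_⟩
  set W : Γ → Set X := fun g => {x | UpcrossingBy α β k R g (fun p => F p.1 p.2 x) ∧
    ¬ FilledAt S α β δ k g (fun p => F p.1 p.2 x)} with hW
  set 𝓦 : Set (Γ × ℕ → ℝ) := {ω | UpcrossingBy α β k R 1 ω ∧ ¬ FilledAt S α β δ k 1 ω} with h𝓦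
  have h𝓦m : MeasurableSet 𝓦 :=
    (measurableSet_upcrossingBy α β k R 1).inter (measurableSet_filledAt S α β δ k 1).compl
  have hφm : ∀ h : Γ, Measurable fun x => fun p : Γ × ℕ => F (p.1 * h) p.2 x :=
    fun h => measurable_pi_lambda _ fun p => hF _ _
  have hWpre : ∀ g, W g = (fun x => fun p : Γ × ℕ => F (p.1 * g) p.2 x) ⁻¹' 𝓦 := by
    intro g
    ext x
    have e1 := upcrossingBy_translate α β k R g (fun p => F p.1 p.2 x)
    have e2 := filledAt_translate S α β δ k g (fun p => F p.1 p.2 x)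
    simp only [hW, h𝓦, Set.mem_preimage, Set.mem_ofPred_eq, ← e1, ← e2]
  have hWm : ∀ g, MeasurableSet (W g) := fun g => by rw [hWpre]; exact hφm g h𝓦m
  have hWP : ∀ g, P (W g) = P (W 1) := by
    intro g
    rw [hWpre g, hWpre 1, ← Measure.map_apply (hφm g) h𝓦m, ← Measure.map_apply (hφm 1) h𝓦m, hst g, hst 1]
  have hsum : (hN.growth R : ENNReal) * P (W 1) ≤ ENNReal.ofReal (c * ρ ^ k * hN.growth (R + R)) := by
    calc (hN.growth R : ENNReal) * P (W 1) = ∑ g ∈ hN.ball 1 R, P (W g) := by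
          simp [hWP, GeodesicLength.growth]
      _ = ∑ g ∈ hN.ball 1 R, ∫⁻ x, (W g).indicator 1 x ∂P := by
          simp [lintegral_indicator_one, hWm]
      _ = ∫⁻ x, ∑ g ∈ hN.ball 1 R, (W g).indicator 1 x ∂P := by
          rw [lintegral_finsetSum]
          intro g _
          exact measurable_one.indicator (hWm g)
      _ ≤ ∫⁻ _, ENNReal.ofReal (c * ρ ^ k * hN.growth (R + R)) ∂P := by
          apply lintegral_mono
          intro x
          have h1 := H k hk α β (fun p => F p.1 p.2 x) R R ((hN.ball 1 R).filter fun g => x ∈ W g)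
            (Finset.filter_subset _ _) (fun g hg => (Finset.mem_filter.1 hg).2)
          have h2 : ∑ g ∈ hN.ball 1 R, (W g).indicator (1 : X → ENNReal) x =
              (((hN.ball 1 R).filter fun g => x ∈ W g).card : ENNReal) := by
            rw [Finset.card_filter]
            push_cast
            refine Finset.sum_congr rfl fun g _ => ?_
            simp [Set.indicator_apply]
          simp only [h2]
          rw [← ENNReal.ofReal_natCast]
          exact ENNReal.ofReal_le_ofReal h1
      _ = _ := by simp
  have hgR : (0 : ℝ) < hN.growth R := by exact_mod_cast hN.growth_pos R
  have hfin : ENNReal.ofReal (c * ρ ^ k * hN.growth (R + R)) ≤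
      (hN.growth R : ENNReal) * ENNReal.ofReal (c * D * ρ ^ k) := by
    rw [← ENNReal.ofReal_natCast, ← ENNReal.ofReal_mul hgR.le]
    apply ENNReal.ofReal_le_ofReal
    have := hD R
    rw [two_mul] at this
    have h0 : 0 ≤ c * ρ ^ k := mul_nonneg hc.le (pow_nonneg hρ.1.le _)
    nlinarith
  have h3 := hsum.trans hfin
  rwa [ENNReal.mul_le_mul_iff_right] at h3
  · exact_mod_cast (hN.growth_pos R).ne'
  · exact ENNReal.natCast_ne_top _

theorem upcrossing_inequality_of_doubling {S : Set Γ} (hN : GeodesicLength (wordNorm S))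
    [Countable Γ] {D : ℝ} (hD : ∀ n, (hN.growth (2 * n) : ℝ) ≤ D * hN.growth n) (α β : ℝ) {δ : ℝ}
    (hδ : 0 < δ) (hδ1 : δ < 1) :
    ∃ c > (0:ℝ), ∃ ρ ∈ Set.Ioo (0:ℝ) 1,
      ∀ (X : Type) (_ : MeasurableSpace X) (P : Measure X), IsProbabilityMeasure P →
      ∀ F : Γ → ℕ → X → ℝ, (∀ g r, Measurable (F g r)) →
      (∀ h : Γ, Measure.map (fun x => fun p : Γ × ℕ => F (p.1 * h) p.2 x) P =
        Measure.map (fun x => fun p : Γ × ℕ => F p.1 p.2 x) P) →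
      ∀ k : ℕ, 1 ≤ k →
      P {x | ∃ i j : ℕ → ℕ,
          (∀ m < k, 1 ≤ i m ∧ i m < j m ∧ F 1 (i m) x < α ∧ β < F 1 (j m) x) ∧
          (∀ m, m + 1 < k → j m < i (m + 1))}
        ≤ ENNReal.ofReal (c * ρ ^ k) +
          P {x | FilledAt S α β δ k 1 (fun p => F p.1 p.2 x)} := by
  obtain ⟨c, hc, ρ, hρ, H⟩ := hN.measure_upcrossing_le hD hδ hδ1
  refine ⟨c, hc, ρ, hρ, fun X _ P hP F hF hst k hk => ?_⟩
  set V := {x | FilledAt S α β δ k 1 (fun p => F p.1 p.2 x)} with hV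
  set W : ℕ → Set X := fun R => {x | UpcrossingBy α β k R 1 (fun p => F p.1 p.2 x) ∧
    ¬ FilledAt S α β δ k 1 (fun p => F p.1 p.2 x)} with hW
  have hmono : Monotone W := by
    rintro R R' hR x ⟨⟨i, j, h1, h2⟩, h3⟩
    exact ⟨⟨i, j, fun m hm => ⟨(h1 m hm).1, (h1 m hm).2.trans hR⟩, h2⟩, h3⟩
  have hsub : {x | ∃ i j : ℕ → ℕ,
      (∀ m < k, 1 ≤ i m ∧ i m < j m ∧ F 1 (i m) x < α ∧ β < F 1 (j m) x) ∧
      (∀ m, m + 1 < k → j m < i (m + 1))} ⊆ (⋃ R, W R) ∪ V := by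
    rintro x ⟨i, j, h1, h2⟩
    by_cases hx : x ∈ V
    · exact Or.inr hx
    · refine Or.inl (Set.mem_iUnion.2 ⟨(Finset.range k).sup j, ⟨i, j, fun m hm => ⟨h1 m hm, ?_⟩, h2⟩, hx⟩)
      exact Finset.le_sup (Finset.mem_range.2 hm)
  calc _ ≤ P ((⋃ R, W R) ∪ V) := measure_mono hsub
    _ ≤ P (⋃ R, W R) + P V := measure_union_le _ _
    _ ≤ _ := by
      gcongr
      rw [hmono.measure_iUnion]
      exact iSup_le fun R => H X _ P F hF hst hP k hk α β R

end Transference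

section PolynomialGrowth

open scoped Pointwise

/-- Growth of degree at most `d`: for each finite subset `T`, the number of products of `n`
elements of `T` is `O(n ^ d)`. -/
def PolyGrowth (d : ℕ) (G : Type*) [Group G] : Prop :=
  ∀ T : Set G, T.Finite → ∃ C : ℕ, ∀ n : ℕ, 1 ≤ n → (T ^ n).ncard ≤ C * n ^ d

theorem Set.Finite.pow_nat {G : Type*} [Monoid G] {T : Set G} (hT : T.Finite) (n : ℕ) :
    (T ^ n).Finite := by
  induction n with
  | zero => rw [pow_zero]; exact Set.finite_one
  | succ n ih => rw [pow_succ]; exact ih.mul hT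

theorem Set.pow_mono_of_one_mem {G : Type*} [Monoid G] {T : Set G} (hT : (1 : G) ∈ T) {m n : ℕ}
    (h : m ≤ n) : T ^ m ⊆ T ^ n := Set.pow_subset_pow_right hT h

/-- A finitely generated group has a finite symmetric generating set containing `1`. -/
theorem exists_symmetric_generators {G : Type*} [Group G] (hG : Group.FG G) :
    ∃ T : Set G, T.Finite ∧ (1 : G) ∈ T ∧ (∀ x ∈ T, x⁻¹ ∈ T) ∧ ∀ g, ∃ n, g ∈ T ^ n := by
  obtain ⟨S, hS⟩ := hG.out
  have hS' := S.finite_toSet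
  generalize (S : Set G) = S at hS hS'
  refine ⟨S ∪ S⁻¹ ∪ {1}, (hS'.union hS'.inv).union (by simp), by simp, ?_, fun g => ?_⟩
  · rintro x ((hx | hx) | hx)
    · exact Or.inl (Or.inr (by simpa using hx))
    · exact Or.inl (Or.inl (by simpa using hx))
    · exact Or.inr (by simpa using hx)
  · have hg : g ∈ Subgroup.closure S := hS ▸ Subgroup.mem_top g
    induction hg using Subgroup.closure_induction'' with
    | one => exact ⟨0, by simp⟩
    | mem x hx => exact ⟨1, by rw [pow_one]; exact Or.inl (Or.inl hx)⟩
    | inv_mem x hx => exact ⟨1, by rw [pow_one]; exact Or.inl (Or.inr (by simpa using hx))⟩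
    | mul x y _ _ hx hy =>
      obtain ⟨m, hm⟩ := hx
      obtain ⟨n, hn⟩ := hy
      exact ⟨m + n, by rw [pow_add]; exact Set.mul_mem_mul hm hn⟩

namespace PolyGrowth

variable {G H : Type*} [Group G] [Group H] {d : ℕ}

theorem of_injective (hG : PolyGrowth d G) (f : H →* G) (hf : Function.Injective f) :
    PolyGrowth d H := by
  intro T hT
  obtain ⟨C, hC⟩ := hG (f '' T) (hT.image f)
  refine ⟨C, fun n hn => ?_⟩
  rw [← Set.ncard_image_of_injective _ hf, Set.image_pow]
  exact hC n hn

theorem subgroup (hG : PolyGrowth d G) (K : Subgroup G) : PolyGrowth d K :=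
  hG.of_injective K.subtype K.subtype_injective

/-- A family of pairwise distinct products of `n` factors from a finite set is of
polynomial size. -/
theorem card_le (hG : PolyGrowth d G) {T : Set G} (hT : T.Finite) :
    ∃ C : ℕ, ∀ n : ℕ, 1 ≤ n → ∀ {ι : Type} (s : Finset ι) (f : ι → G), Set.InjOn f s →
      (∀ i ∈ s, f i ∈ T ^ n) → s.card ≤ C * n ^ d := by
  obtain ⟨C, hC⟩ := hG T hT
  refine ⟨C, fun n hn ι s f hf hs => le_trans ?_ (hC n hn)⟩
  rw [← Set.ncard_coe_finset s, ← hf.ncard_image]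
  exact Set.ncard_le_ncard (by rintro _ ⟨i, hi, rfl⟩; exact hs i hi) (hT.pow_nat n)

/-- A set of words of length `n` whose right translates by powers of `t` are pairwise disjoint has
at most `O(n ^ d)` elements in a group of growth of degree `d + 1`. -/
theorem ncard_le_of_mul_pow_injective {T U : Set G} {t : G} (hU : U.Finite) (hTU : T ⊆ U) (htU : t ∈ U)
    (h1 : (1 : G) ∈ U) {C : ℕ} (hC : ∀ n, 1 ≤ n → (U ^ n).ncard ≤ C * n ^ (d + 1))
    {n : ℕ} (hn : 1 ≤ n) (A : Set G) (hA : A ⊆ T ^ n)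
    (hinj : ∀ a ∈ A, ∀ b ∈ A, ∀ i j : ℕ, a * t ^ i = b * t ^ j → a = b ∧ i = j) :
    A.ncard ≤ C * 2 ^ (d + 1) * n ^ d := by
  have hsub : (fun p : G × ℕ => p.1 * t ^ p.2) '' (A ×ˢ (Set.Iio n)) ⊆ U ^ (2 * n) := by
    rintro _ ⟨⟨a, i⟩, ⟨ha, hi⟩, rfl⟩
    rw [two_mul, pow_add]
    exact Set.mul_mem_mul (Set.pow_subset_pow_left hTU (hA ha))
      (Set.pow_mono_of_one_mem h1 (Set.mem_Iio.1 hi).le (Set.pow_mem_pow htU))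
  have h := Set.ncard_le_ncard hsub (hU.pow_nat _)
  rw [Set.InjOn.ncard_image, Set.ncard_prod, Set.ncard_Iio_nat] at h
  · have h2 := h.trans (hC (2 * n) (by omega))
    have h3 : n * A.ncard ≤ n * (C * 2 ^ (d + 1) * n ^ d) := by
      calc n * A.ncard = A.ncard * n := mul_comm _ _
        _ ≤ _ := h2
        _ = _ := by ring
    exact Nat.le_of_mul_le_mul_left h3 (by omega)
  · rintro ⟨a, i⟩ ⟨ha, -⟩ ⟨b, j⟩ ⟨hb, -⟩ h
    obtain ⟨rfl, rfl⟩ := hinj a ha b hb i j h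
    rfl

theorem ker (hG : PolyGrowth (d + 1) G) (f : G →* H) {t : G}
    (ht : Function.Injective fun n : ℕ => f t ^ n) : PolyGrowth d f.ker := by
  intro T hT
  set T' : Set G := f.ker.subtype '' T
  have hT' : T'.Finite := hT.image _
  obtain ⟨C, hC⟩ := hG (T' ∪ {t, 1}) (hT'.union (by simp))
  refine ⟨C * 2 ^ (d + 1), fun n hn => ?_⟩
  rw [← Set.ncard_image_of_injective _ f.ker.subtype_injective, Set.image_pow]
  refine ncard_le_of_mul_pow_injective (T := T') (t := t) (hT'.union (by simp)) Set.subset_union_left (by simp)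
    (by simp) hC hn _ subset_rfl ?_
  have hker : ∀ a ∈ T' ^ n, f a = 1 := by
    intro a ha
    rw [← Set.image_pow] at ha
    obtain ⟨b, -, rfl⟩ := ha
    exact b.2
  intro a ha b hb i j h
  have hij : i = j := by
    apply ht
    have := congrArg f h
    simpa [hker a ha, hker b hb] using this
  subst hij
  exact ⟨mul_right_cancel h, rfl⟩

theorem of_surjective_of_mem_ker (hG : PolyGrowth (d + 1) G) (f : G →* H)
    (hf : Function.Surjective f) {z : G} (hz : f z = 1)
    (hz' : Function.Injective fun n : ℕ => z ^ n) : PolyGrowth d H := by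
  intro T hT
  obtain ⟨g, hg⟩ := hf.hasRightInverse
  set T' : Set G := g '' T
  have hT' : T'.Finite := hT.image _
  obtain ⟨C, hC⟩ := hG (T' ∪ {z, 1}) (hT'.union (by simp))
  refine ⟨C * 2 ^ (d + 1), fun n hn => ?_⟩
  have : T = f '' T' := by
    rw [Set.image_image]; simp [hg _]
  rw [this, ← Set.image_pow]
  obtain ⟨A, hA, hAinj⟩ := Set.SurjOn.exists_bijOn_subset (Set.surjOn_image f (T' ^ n))
  rw [← hAinj.image_eq, hAinj.injOn.ncard_image]
  refine ncard_le_of_mul_pow_injective (T := T') (t := z) (hT'.union (by simp)) Set.subset_union_left (by simp)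
    (by simp) hC hn _ hA ?_
  intro a ha b hb i j h
  have hab : a = b := by
    apply hAinj.injOn ha hb
    simpa [hz] using congrArg f h
  subst hab
  exact ⟨rfl, hz' (mul_left_cancel h)⟩

theorem finite_of_zero (hG : PolyGrowth 0 G) (hfg : Group.FG G) : Finite G := by
  obtain ⟨T, hT, h1, -, hgen⟩ := exists_symmetric_generators hfg
  obtain ⟨C, hC⟩ := hG T hT
  by_contra hinf
  rw [not_finite_iff_infinite] at hinf
  obtain ⟨U, hU⟩ := Infinite.exists_subset_card_eq G (C + 1)
  choose n hn using hgen
  have hsub : (U : Set G) ⊆ T ^ (U.sup n + 1) := fun g hg =>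
    Set.pow_mono_of_one_mem h1 ((Finset.le_sup (f := n) hg).trans (Nat.le_succ _)) (hn g)
  have := (Set.ncard_le_ncard hsub (hT.pow_nat _)).trans (hC _ (by omega))
  rw [Set.ncard_coe_finset] at this
  simp at this
  omega

end PolyGrowth

end PolynomialGrowth

section HarmonicLimit

open scoped Topology Pointwise

/-- The limit of a bounded real sequence along a fixed free ultrafilter. -/
noncomputable def ultraLim (a : ℕ → ℝ) : ℝ := limUnder (hyperfilter ℕ : Filter ℕ) a

theorem tendsto_ultraLim {a : ℕ → ℝ} {M : ℝ} (h : ∀ n, |a n| ≤ M) :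
    Tendsto a (hyperfilter ℕ) (𝓝 (ultraLim a)) := by
  obtain ⟨l, -, hl⟩ := (isCompact_Icc (a := -M) (b := M)).ultrafilter_le_nhds
    ((hyperfilter ℕ).map a) (by
      rw [le_principal_iff]
      exact Filter.mem_map.2 (Filter.univ_mem' fun n => abs_le.1 (h n)))
  exact tendsto_nhds_limUnder ⟨l, hl⟩

/-- A real-valued function is harmonic for the random walk with steps uniformly distributed among
the `σ i`. -/
def IsHarmonic {G ι : Type*} [Group G] [Fintype ι] (σ : ι → G) (u : G → ℝ) : Prop :=
  ∀ x, ∑ i, u (x * σ i) = Fintype.card ι * u x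

variable {G E κ : Type*} [Group G] [AddCommGroup E] [Module ℝ E] [Fintype κ]
  {B : LinearMap.BilinForm ℝ E} {π : G →* Module.End ℝ E} {τ : κ → G}

theorem ext_of_bilin (hsym : ∀ v w, B v w = B w v) (v w : E) :
    B (v - w) (v - w) = B v v - 2 * B v w + B w w := by
  simp only [map_sub, LinearMap.sub_apply, hsym w v]; ring

theorem bilin_add_le (hpos : ∀ v, 0 ≤ B v v) (hsym : ∀ v w, B v w = B w v) (v w : E) :
    B (v + w) (v + w) ≤ 2 * B v v + 2 * B w w := by
  have h := hpos (v - w)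
  rw [ext_of_bilin hsym] at h
  have : B (v + w) (v + w) = B v v + 2 * B v w + B w w := by
    simp only [map_add, LinearMap.add_apply, hsym w v]; ring
  linarith

/-- The averaging operator of the random walk with steps `τ i`. -/
noncomputable def avgOp (π : G →* Module.End ℝ E) (τ : κ → G) : Module.End ℝ E :=
  (Fintype.card κ : ℝ)⁻¹ • ∑ i, π (τ i)

theorem sum_step [Nonempty κ] (v : E) :
    ∑ i, π (τ i) v = (Fintype.card κ : ℝ) • avgOp π τ v := by
  rw [avgOp, LinearMap.smul_apply, smul_smul, mul_inv_cancel₀, one_smul, LinearMap.sum_apply]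
  exact_mod_cast Fintype.card_ne_zero

theorem sum_two_step [Nonempty κ] (v : E) :
    ∑ p : κ × κ, π (τ p.1 * τ p.2) v = (Fintype.card κ : ℝ) ^ 2 • (avgOp π τ (avgOp π τ v)) := by
  rw [Fintype.sum_prod_type]
  simp only [map_mul, Module.End.mul_apply, ← map_sum, sum_step, map_smul]
  simp only [← Finset.smul_sum, sum_step, smul_smul]
  rw [sq]

theorem avgOp_symm (hinv : ∀ g v w, B (π g v) (π g w) = B v w) {e : κ ≃ κ}
    (he : ∀ i, τ (e i) = (τ i)⁻¹) (v w : E) : B (avgOp π τ v) w = B v (avgOp π τ w) := by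
  simp only [avgOp, LinearMap.smul_apply, LinearMap.sum_apply, map_smul, map_sum, smul_eq_mul]
  congr 1
  rw [← Equiv.sum_comp e (fun i => B v (π (τ i) w))]
  refine Finset.sum_congr rfl fun i _ => ?_
  rw [he, ← hinv (τ i) v, ← Module.End.mul_apply, ← map_mul]
  simp

theorem sum_energy [Nonempty κ] (hsym : ∀ v w, B v w = B w v)
    (hinv : ∀ g v w, B (π g v) (π g w) = B v w) {e : κ ≃ κ}
    (he : ∀ i, τ (e i) = (τ i)⁻¹) (v : E) :
    ∑ p : κ × κ, B (π (τ p.1 * τ p.2) v - v) (π (τ p.1 * τ p.2) v - v) =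
      2 * (Fintype.card κ : ℝ) ^ 2 * (B v v - B (avgOp π τ v) (avgOp π τ v)) := by
  have h1 : ∀ g, B (π g v - v) (π g v - v) = 2 * B v v - 2 * B (π g v) v := by
    intro g
    rw [ext_of_bilin hsym, hinv]; ring
  simp only [h1]
  rw [Finset.sum_sub_distrib, ← Finset.mul_sum, ← Finset.mul_sum]
  have h2 : ∑ p : κ × κ, B (π (τ p.1 * τ p.2) v) v =
      (Fintype.card κ : ℝ) ^ 2 * B (avgOp π τ v) (avgOp π τ v) := by
    rw [← LinearMap.sum_apply, ← map_sum, sum_two_step, map_smul, LinearMap.smul_apply,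
      avgOp_symm hinv he, smul_eq_mul]
  rw [h2]
  simp [Fintype.card_prod]
  ring

theorem bilin_second_difference (hsym : ∀ v w, B v w = B w v)
    (hinv : ∀ g v w, B (π g v) (π g w) = B v w) {e : κ ≃ κ}
    (he : ∀ i, τ (e i) = (τ i)⁻¹) (v : E) :
    B (avgOp π τ (avgOp π τ v) - v) (avgOp π τ (avgOp π τ v) - v) =
      (B v v - B (avgOp π τ v) (avgOp π τ v)) - (B (avgOp π τ v) (avgOp π τ v) -
      B (avgOp π τ (avgOp π τ v)) (avgOp π τ (avgOp π τ v))) := by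
  rw [ext_of_bilin hsym, avgOp_symm hinv he (avgOp π τ v) v]
  ring

/-- Rescaled differences of almost invariant vectors converge to a nonconstant Lipschitz harmonic
function. -/
theorem exists_harmonic_of_seq [Nonempty κ] (hpos : ∀ v, 0 ≤ B v v)
    (hsym : ∀ v w, B v w = B w v)
    (hinv : ∀ g v w, B (π g v) (π g w) = B v w)
    {e : κ ≃ κ} (he : ∀ i, τ (e i) = (τ i)⁻¹) {i₀ : κ} (hi₀ : τ i₀ = 1)
    (hgen : ∀ g, ∃ n : ℕ, g ∈ Set.range τ ^ n) (f : ℕ → E)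
    (b b' : ℕ → ℝ) (hb : ∀ n, b n = B (f n) (f n) - B (avgOp π τ (f n)) (avgOp π τ (f n)))
    (hb' : ∀ n, b' n = B (avgOp π τ (f n)) (avgOp π τ (f n)) -
      B (avgOp π τ (avgOp π τ (f n))) (avgOp π τ (avgOp π τ (f n))))
    (hb0 : ∀ n, 0 < b n) (hbb : Tendsto (fun n => (b n - b' n) / b n) atTop (𝓝 0)) :
    ∃ u : G → ℝ, IsHarmonic (fun p : κ × κ => τ p.1 * τ p.2) u ∧
      (∃ L, ∀ x i, |u (x * τ i) - u x| ≤ L) ∧ ∃ x, u x ≠ u 1 := by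
  set P := avgOp π τ with hP
  have hPs := avgOp_symm hinv he
  set K : ℝ := (Fintype.card κ : ℝ) with hK
  have hK0 : 0 < K := by rw [hK]; exact_mod_cast Fintype.card_pos
  set c : ℕ → G → E := fun n x => π x (f n) - f n with hc
  have hc1 : ∀ n, c n 1 = 0 := fun n => by simp [hc]
  have hcmul : ∀ n x y, c n (x * y) = c n x + π x (c n y) := fun n x y => by
    simp only [hc, map_mul, Module.End.mul_apply, map_sub]; abel
  set N : ℕ → G → G → ℝ := fun n x y => B (c n x) (c n y) / b n with hN
  have hN0 : ∀ n x, 0 ≤ N n x x := fun n x => div_nonneg (hpos _) (hb0 n).le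
  have hCS : ∀ n x y z, (B (π z (c n x)) (c n y) / b n) ^ 2 ≤ N n x x * N n y y := by
    intro n x y z
    have h := B.apply_sq_le_of_symm hpos ⟨fun v w => by simpa using hsym v w⟩ (π z (c n x)) (c n y)
    rw [hinv] at h
    rw [div_pow, hN, div_mul_div_comm, ← sq]
    exact div_le_div_of_nonneg_right h (sq_nonneg _)
  have hsum : ∀ n, ∑ p : κ × κ, N n (τ p.1 * τ p.2) (τ p.1 * τ p.2) = 2 * K ^ 2 := by
    intro n
    simp only [hN]
    rw [← Finset.sum_div, sum_energy hsym hinv he, div_eq_iff (hb0 n).ne', hb]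
  have hNτ2 : ∀ n (p : κ × κ), N n (τ p.1 * τ p.2) (τ p.1 * τ p.2) ≤ 2 * K ^ 2 := by
    intro n p
    rw [← hsum n]
    exact Finset.single_le_sum (f := fun p : κ × κ => N n (τ p.1 * τ p.2) (τ p.1 * τ p.2))
      (fun q _ => hN0 _ _) (Finset.mem_univ p)
  have hNτ : ∀ n i, N n (τ i) (τ i) ≤ 2 * K ^ 2 := by
    intro n i
    simpa [hi₀] using hNτ2 n (i, i₀)
  have hNmul : ∀ n x y, N n (x * y) (x * y) ≤ 2 * N n x x + 2 * N n y y := by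
    intro n x y
    simp only [hN, hcmul]
    rw [← mul_div_assoc, ← mul_div_assoc, ← add_div]
    refine div_le_div_of_nonneg_right ?_ (hb0 n).le
    refine (bilin_add_le hpos hsym _ _).trans_eq ?_
    rw [hinv]
  have hbd : ∀ x, ∃ M, ∀ n, N n x x ≤ M := by
    intro x
    obtain ⟨m, hm⟩ := hgen x
    induction m generalizing x with
    | zero =>
      rw [pow_zero, Set.mem_one] at hm
      subst hm
      exact ⟨0, fun n => by simp [hN, hc1]⟩
    | succ m ih =>
      rw [pow_succ] at hm
      obtain ⟨y, hy, _, ⟨i, rfl⟩, rfl⟩ := hm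
      obtain ⟨M, hM⟩ := ih y hy
      refine ⟨2 * M + 2 * (2 * K ^ 2), fun n => (hNmul n y _).trans ?_⟩
      linarith [hM n, hNτ n i]
  have habs : ∀ {r A A' : ℝ}, r ^ 2 ≤ A * A' → 0 ≤ A → 0 ≤ A' → |r| ≤ A + A' := by
    intro r A A' h hA hA'
    exact abs_le_of_sq_le_sq (by nlinarith [mul_nonneg hA hA']) (by linarith)
  have hlim : ∀ x y, Tendsto (fun n => N n x y) (hyperfilter ℕ)
      (𝓝 (ultraLim fun n => N n x y)) := by
    intro x y
    obtain ⟨M, hM⟩ := hbd x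
    obtain ⟨M', hM'⟩ := hbd y
    refine tendsto_ultraLim (M := M + M') fun n => ?_
    have := hCS n x y 1
    simp only [map_one, Module.End.one_apply] at this
    refine (habs this (hN0 _ _) (hN0 _ _)).trans (add_le_add (hM n) (hM' n))
  obtain ⟨p₀, hp₀⟩ : ∃ p : κ × κ, (ultraLim fun n => N n (τ p.1 * τ p.2) (τ p.1 * τ p.2)) ≠ 0 := by
    by_contra! h
    have h1 := tendsto_finsetSum Finset.univ fun (p : κ × κ) _ => hlim (τ p.1 * τ p.2) (τ p.1 * τ p.2)
    simp only [hsum, h, Finset.sum_const_zero] at h1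
    have := tendsto_nhds_unique h1 tendsto_const_nhds
    nlinarith
  set y := τ p₀.1 * τ p₀.2 with hy
  refine ⟨fun x => ultraLim fun n => N n x y, fun x => ?_, ⟨2 * K ^ 2 + 2 * K ^ 2, fun x i => ?_⟩,
    y, ?_⟩
  · have h1 := tendsto_finsetSum Finset.univ fun (p : κ × κ) _ => hlim (x * (τ p.1 * τ p.2)) y
    have h2 := (hlim x y).const_mul (Fintype.card (κ × κ) : ℝ)
    have h3 := h1.sub h2
    have h4 : ∀ n, (∑ p : κ × κ, N n (x * (τ p.1 * τ p.2)) y - Fintype.card (κ × κ) * N n x y) ^ 2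
        ≤ K ^ 4 * ((b n - b' n) / b n) * (2 * K ^ 2) := by
      intro n
      set F := P (P (f n)) - f n with hF
      have h5 : ∑ p : κ × κ, N n (x * (τ p.1 * τ p.2)) y - Fintype.card (κ × κ) * N n x y
          = K ^ 2 * (B (π x F) (c n y) / b n) := by
        have : ∑ p : κ × κ, N n (x * (τ p.1 * τ p.2)) y = ∑ p : κ × κ, (N n x y +
          B (π x (π (τ p.1 * τ p.2) (f n) - f n)) (c n y) / b n) := by
          refine Finset.sum_congr rfl fun p _ => ?_
          simp only [hN]
          rw [hcmul, map_add, LinearMap.add_apply, add_div]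
        rw [this, Finset.sum_add_distrib, Finset.sum_const, Finset.card_univ, nsmul_eq_mul,
          add_sub_cancel_left, ← Finset.sum_div, ← LinearMap.sum_apply, ← map_sum, ← map_sum,
          Finset.sum_sub_distrib, sum_two_step, Finset.sum_const, Finset.card_univ,
          ← Nat.cast_smul_eq_nsmul ℝ, Fintype.card_prod, Nat.cast_mul, ← hK, ← sq, ← smul_sub,
          map_smul, map_smul, LinearMap.smul_apply, smul_eq_mul, mul_div_assoc]
      have h6 := B.apply_sq_le_of_symm hpos ⟨fun v w => by simpa using hsym v w⟩ (π x F) (c n y)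
      rw [hinv] at h6
      have h7 : B F F = b n - b' n := by
        rw [hF, bilin_second_difference hsym hinv he, hb, hb']
      rw [h5, mul_pow, div_pow]
      have h8 : B (π x F) (c n y) ^ 2 / b n ^ 2 ≤ ((b n - b' n) / b n) * N n y y := by
        rw [← h7, hN, div_mul_div_comm, ← sq]
        exact div_le_div_of_nonneg_right h6 (sq_nonneg _)
      have h9 : 0 ≤ (b n - b' n) / b n := by
        rw [← h7]; exact div_nonneg (hpos _) (hb0 n).le
      calc (K ^ 2) ^ 2 * (B (π x F) (c n y) ^ 2 / b n ^ 2)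
          ≤ (K ^ 2) ^ 2 * (((b n - b' n) / b n) * (2 * K ^ 2)) := by
            gcongr
            exact h8.trans (mul_le_mul_of_nonneg_left (hNτ2 n p₀) h9)
        _ = _ := by ring
    have h5 : Tendsto (fun n => K ^ 4 * ((b n - b' n) / b n) * (2 * K ^ 2)) (hyperfilter ℕ)
        (𝓝 0) := by
      have := ((hbb.mono_left (Nat.hyperfilter_le_atTop)).const_mul (K ^ 4)).mul_const (2 * K ^ 2)
      simpa using this
    have h6 := squeeze_zero (fun n => sq_nonneg _) h4 h5
    have h7 := tendsto_nhds_unique h6 (h3.pow 2)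
    have h8 := pow_eq_zero_iff (two_ne_zero) |>.1 h7.symm
    exact sub_eq_zero.1 h8
  · have h1 := ((hlim (x * τ i) y).sub (hlim x y)).abs
    refine le_of_tendsto h1 (Filter.univ_mem' fun n => ?_)
    have h2 : N n (x * τ i) y - N n x y = B (π x (c n (τ i))) (c n y) / b n := by
      simp only [hN]
      rw [hcmul, map_add, LinearMap.add_apply, add_div]; ring
    simp only [Set.mem_ofPred_eq]
    rw [h2]
    exact (habs (hCS n _ _ x) (hN0 _ _) (hN0 _ _)).trans (add_le_add (hNτ n i) (hNτ2 n p₀))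
  · have : (fun n => N n 1 y) = fun _ => (0 : ℝ) := by
      funext n; simp [hN, hc1]
    have h0 : (ultraLim fun n => N n 1 y) = 0 :=
      tendsto_nhds_unique (hlim 1 y) (this ▸ tendsto_const_nhds)
    simp only [h0]
    exact hp₀

end HarmonicLimit

section HarmonicExistence

open scoped Topology Pointwise

variable {G κ : Type*} [Group G] [Fintype κ] {τ : κ → G}

/-- The standard inner product of finitely supported functions. -/
noncomputable def finsuppBilin (G : Type*) : LinearMap.BilinForm ℝ (G →₀ ℝ) :=
  (Finsupp.bilinearCombination ℝ ℝ).comp Finsupp.lcoeFun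

theorem finsuppBilin_eq (f h : G →₀ ℝ) : finsuppBilin G f h = ∑ x ∈ h.support, f x * h x := by
  simp only [finsuppBilin, LinearMap.comp_apply, Finsupp.bilinearCombination_apply, Finsupp.sum,
    Finsupp.linearCombination_apply, smul_eq_mul, Finsupp.lcoeFun_apply]
  exact Finset.sum_congr rfl fun _ _ => mul_comm _ _

theorem finsuppBilin_self (f : G →₀ ℝ) : finsuppBilin G f f = ∑ x ∈ f.support, f x ^ 2 := by
  rw [finsuppBilin_eq]; simp only [sq]

theorem finsuppBilin_nonneg (f : G →₀ ℝ) : 0 ≤ finsuppBilin G f f := by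
  rw [finsuppBilin_self]; positivity

theorem sq_apply_le_finsuppBilin (f : G →₀ ℝ) (x : G) : f x ^ 2 ≤ finsuppBilin G f f := by
  by_cases hx : x ∈ f.support
  · rw [finsuppBilin_self]
    exact Finset.single_le_sum (f := fun x => f x ^ 2) (fun _ _ => sq_nonneg _) hx
  · rw [Finsupp.notMem_support_iff.1 hx]; simpa using finsuppBilin_nonneg f

theorem finsuppBilin_symm (f h : G →₀ ℝ) : finsuppBilin G f h = finsuppBilin G h f := by
  classical
  have key : ∀ f h : G →₀ ℝ, finsuppBilin G f h = ∑ x ∈ h.support ∪ f.support, f x * h x := by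
    intro f h
    rw [finsuppBilin_eq]
    refine Finset.sum_subset Finset.subset_union_left fun x _ hx => ?_
    simp [Finsupp.notMem_support_iff.1 hx]
  rw [key, key, Finset.union_comm]
  exact Finset.sum_congr rfl fun _ _ => mul_comm _ _

/-- The left regular representation on finitely supported functions. -/
noncomputable def leftReg (G : Type*) [Group G] : G →* Module.End ℝ (G →₀ ℝ) where
  toFun g := Finsupp.lmapDomain ℝ ℝ (g * ·)
  map_one' := by ext; simp
  map_mul' g h := by ext; simp [mul_assoc]

theorem leftReg_apply (g : G) (f : G →₀ ℝ) (x : G) : leftReg G g f x = f (g⁻¹ * x) := by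
  have := Finsupp.mapDomain_apply (mul_right_injective g) f (g⁻¹ * x)
  simpa [leftReg] using this

theorem finsuppBilin_leftReg (g : G) (f h : G →₀ ℝ) :
    finsuppBilin G (leftReg G g f) (leftReg G g h) = finsuppBilin G f h := by
  rw [finsuppBilin_eq, finsuppBilin_eq]
  refine Finset.sum_bij' (fun x _ => g⁻¹ * x) (fun x _ => g * x) ?_ ?_ ?_ ?_ ?_ <;>
    simp [leftReg_apply]

theorem leftReg_total (g : G) (f : G →₀ ℝ) :
    Finsupp.linearCombination ℝ (fun _ : G => (1 : ℝ)) (leftReg G g f) =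
      Finsupp.linearCombination ℝ (fun _ : G => (1 : ℝ)) f := by
  simp only [leftReg, MonoidHom.coe_mk, OneHom.coe_mk, Finsupp.lmapDomain_apply,
    Finsupp.linearCombination_mapDomain]
  rfl

theorem total_eq_sum (f : G →₀ ℝ) :
    Finsupp.linearCombination ℝ (fun _ : G => (1 : ℝ)) f = ∑ x ∈ f.support, f x := by
  simp [Finsupp.linearCombination_apply, Finsupp.sum]

theorem avgOp_leftReg_apply (f : G →₀ ℝ) (x : G) :
    avgOp (leftReg G) τ f x = (Fintype.card κ : ℝ)⁻¹ * ∑ i, f ((τ i)⁻¹ * x) := by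
  simp only [avgOp, LinearMap.smul_apply, LinearMap.sum_apply, Finsupp.smul_apply, smul_eq_mul,
    Finsupp.finsetSum_apply, leftReg_apply]

/-- The law of the `n`-th step of the random walk with steps `τ i`. -/
noncomputable def walkLaw (τ : κ → G) : ℕ → G →₀ ℝ
  | 0 => Finsupp.single 1 1
  | n + 1 => avgOp (leftReg G) τ (walkLaw τ n)

theorem walkLaw_nonneg (n : ℕ) (x : G) : 0 ≤ walkLaw τ n x := by
  classical
  induction n generalizing x with
  | zero => rw [walkLaw, Finsupp.single_apply]; split_ifs <;> norm_num
  | succ n ih =>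
    rw [walkLaw, avgOp_leftReg_apply]
    exact mul_nonneg (by positivity) (Finset.sum_nonneg fun i _ => ih _)

theorem walkLaw_mem_pow {n : ℕ} {x : G} (h : walkLaw τ n x ≠ 0) : x ∈ Set.range τ ^ n := by
  classical
  induction n generalizing x with
  | zero =>
    rw [walkLaw, Finsupp.single_apply] at h
    simp only [pow_zero, Set.mem_one]
    by_contra hx
    exact h (if_neg (Ne.symm hx))
  | succ n ih =>
    rw [walkLaw, avgOp_leftReg_apply] at h
    obtain ⟨i, -, hi⟩ := Finset.exists_ne_zero_of_sum_ne_zero (right_ne_zero_of_mul h)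
    rw [pow_succ']
    exact ⟨τ i, ⟨i, rfl⟩, _, ih hi, by simp⟩

theorem sum_walkLaw [Nonempty κ] (n : ℕ) : ∑ x ∈ (walkLaw τ n).support, walkLaw τ n x = 1 := by
  rw [← total_eq_sum]
  induction n with
  | zero => simp [walkLaw]
  | succ n ih =>
    rw [walkLaw, avgOp, LinearMap.smul_apply, map_smul, LinearMap.sum_apply, map_sum]
    simp only [leftReg_total, ih]
    simp

theorem sum_walkLaw_le [Nonempty κ] (n : ℕ) (s : Finset G) : ∑ x ∈ s, walkLaw τ n x ≤ 1 := by
  classical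
  rw [← sum_walkLaw (τ := τ) n]
  refine (Finset.sum_le_sum_of_subset_of_nonneg
    (Finset.subset_union_left (s₂ := (walkLaw τ n).support))
    fun _ _ _ => walkLaw_nonneg _ _).trans_eq ?_
  symm
  refine Finset.sum_subset Finset.subset_union_right fun x _ hx => ?_
  exact Finsupp.notMem_support_iff.1 hx

/-- `ℓ²`-norms squared of the walk laws. -/
noncomputable def walkNorm (τ : κ → G) (n : ℕ) : ℝ := finsuppBilin G (walkLaw τ n) (walkLaw τ n)

theorem one_le_card_mul_walkNorm [Nonempty κ] (n : ℕ) :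
    1 ≤ ((Set.range τ ^ n).ncard : ℝ) * walkNorm τ n := by
  have h := Finset.sum_mul_sq_le_sq_mul_sq (walkLaw τ n).support (fun _ => (1 : ℝ)) (walkLaw τ n)
  simp only [one_mul, sum_walkLaw, one_pow, Finset.sum_const, nsmul_eq_mul, mul_one] at h
  refine h.trans ?_
  rw [walkNorm, finsuppBilin_self]
  gcongr
  rw [← Set.ncard_coe_finset]
  exact Set.ncard_le_ncard (fun x hx => walkLaw_mem_pow (Finsupp.mem_support_iff.1 hx))
    ((Set.finite_range τ).pow_nat n)

section

variable [Nonempty κ] {e : κ ≃ κ} (he : ∀ i, τ (e i) = (τ i)⁻¹)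

include he

theorem walkNorm_sum_energy (n : ℕ) :
    ∑ p : κ × κ, finsuppBilin G (leftReg G (τ p.1 * τ p.2) (walkLaw τ n) - walkLaw τ n)
        (leftReg G (τ p.1 * τ p.2) (walkLaw τ n) - walkLaw τ n) =
      2 * (Fintype.card κ : ℝ) ^ 2 * (walkNorm τ n - walkNorm τ (n + 1)) :=
  sum_energy finsuppBilin_symm finsuppBilin_leftReg he _

theorem walkNorm_antitone : Antitone (walkNorm τ) := by
  refine antitone_nat_of_succ_le fun n => ?_
  have h : (0 : ℝ) ≤ 2 * (Fintype.card κ : ℝ) ^ 2 * (walkNorm τ n - walkNorm τ (n + 1)) := by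
    rw [← walkNorm_sum_energy he]
    exact Finset.sum_nonneg fun _ _ => finsuppBilin_nonneg _
  have h0 : (0 : ℝ) < 2 * (Fintype.card κ : ℝ) ^ 2 := by
    have : (0 : ℝ) < Fintype.card κ := by exact_mod_cast Fintype.card_pos
    positivity
  linarith [nonneg_of_mul_nonneg_right h h0]

variable {i₀ : κ} (hi₀ : τ i₀ = 1) (hgen : ∀ g, ∃ n : ℕ, g ∈ Set.range τ ^ n)

include hi₀

theorem energy_le (n : ℕ) (i : κ) :
    finsuppBilin G (leftReg G (τ i) (walkLaw τ n) - walkLaw τ n)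
        (leftReg G (τ i) (walkLaw τ n) - walkLaw τ n) ≤
      2 * (Fintype.card κ : ℝ) ^ 2 * (walkNorm τ n - walkNorm τ (n + 1)) := by
  rw [← walkNorm_sum_energy he]
  have := Finset.single_le_sum (f := fun p : κ × κ =>
    finsuppBilin G (leftReg G (τ p.1 * τ p.2) (walkLaw τ n) - walkLaw τ n)
        (leftReg G (τ p.1 * τ p.2) (walkLaw τ n) - walkLaw τ n))
      (fun q _ => finsuppBilin_nonneg _) (Finset.mem_univ (i, i₀))
  simpa [hi₀] using this

include hgen

theorem walkNorm_succ_lt [Infinite G] (n : ℕ) : walkNorm τ (n + 1) < walkNorm τ n := by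
  refine lt_of_le_of_ne (walkNorm_antitone he (Nat.le_succ n)) fun h => ?_
  have h1 : ∀ g, leftReg G g (walkLaw τ n) = walkLaw τ n := by
    intro g
    obtain ⟨m, hm⟩ := hgen g
    induction m generalizing g with
    | zero =>
      rw [pow_zero, Set.mem_one] at hm
      simp [hm]
    | succ m ih =>
      rw [pow_succ] at hm
      obtain ⟨y, hy, _, ⟨i, rfl⟩, rfl⟩ := hm
      have h2 := energy_le he hi₀ n i
      rw [h, sub_self, mul_zero] at h2
      simp only [map_mul, Module.End.mul_apply]
      rw [show leftReg G (τ i) (walkLaw τ n) = walkLaw τ n from ?_, ih y hy]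
      ext x
      have := (sq_apply_le_finsuppBilin _ x).trans h2
      have := pow_eq_zero_iff two_ne_zero |>.1 (le_antisymm this (sq_nonneg _))
      exact sub_eq_zero.1 this
  have h2 : ∀ x, walkLaw τ n x = walkLaw τ n 1 := by
    intro x
    rw [← h1 x, leftReg_apply]; simp [h1]
  obtain ⟨y, hy⟩ := Infinite.exists_notMem_finset (walkLaw τ n).support
  have h3 : ∀ x, walkLaw τ n x = 0 := by
    intro x
    rw [h2 x, ← h2 y]
    exact Finsupp.notMem_support_iff.1 hy
  have := sum_walkLaw (τ := τ) n
  simp [h3] at this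

theorem tendsto_walkNorm [Infinite G] : Tendsto (walkNorm τ) atTop (𝓝 0) ∧
    Tendsto (fun n => walkNorm τ n - walkNorm τ (n + 1)) atTop (𝓝 0) := by
  have hlim : Tendsto (walkNorm τ) atTop (𝓝 (⨅ n, walkNorm τ n)) :=
    tendsto_atTop_ciInf (walkNorm_antitone he)
      ⟨0, by rintro _ ⟨n, rfl⟩; exact finsuppBilin_nonneg _⟩
  have hdiff : Tendsto (fun n => walkNorm τ n - walkNorm τ (n + 1)) atTop (𝓝 0) := by
    simpa using hlim.sub (hlim.comp (tendsto_add_atTop_nat 1))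
  refine ⟨?_, hdiff⟩
  have hen : ∀ g, Tendsto (fun n => finsuppBilin G (leftReg G g (walkLaw τ n) - walkLaw τ n)
      (leftReg G g (walkLaw τ n) - walkLaw τ n)) atTop (𝓝 0) := by
    intro g
    obtain ⟨m, hm⟩ := hgen g
    induction m generalizing g with
    | zero =>
      rw [pow_zero, Set.mem_one] at hm
      simp [hm]
    | succ m ih =>
      rw [pow_succ] at hm
      obtain ⟨y, hy, _, ⟨i, rfl⟩, rfl⟩ := hm
      have h1 := (hdiff.const_mul (2 * (Fintype.card κ : ℝ) ^ 2))
      have h2 := ((h1.const_mul 2).add ((ih y hy).const_mul 2))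
      simp only [mul_zero, add_zero] at h2
      refine squeeze_zero (fun n => finsuppBilin_nonneg _) (fun n => ?_) h2
      have h3 : leftReg G (y * τ i) (walkLaw τ n) - walkLaw τ n =
          leftReg G y (leftReg G (τ i) (walkLaw τ n) - walkLaw τ n) +
            (leftReg G y (walkLaw τ n) - walkLaw τ n) := by
        rw [map_mul, Module.End.mul_apply, map_sub]; abel
      rw [h3]
      refine (bilin_add_le finsuppBilin_nonneg finsuppBilin_symm _ _).trans ?_
      rw [finsuppBilin_leftReg]
      gcongr
      exact energy_le he hi₀ n i
  refine tendsto_order.2 ⟨fun a ha => Filter.univ_mem' fun n => ha.trans_le (finsuppBilin_nonneg _),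
    fun ε hε => ?_⟩
  obtain ⟨m, hm⟩ := exists_nat_gt (2 / ε)
  have hm0 : (0 : ℝ) < m := lt_trans (by positivity) hm
  obtain ⟨U, hU⟩ := Infinite.exists_subset_card_eq G m
  have hev : ∀ᶠ n in atTop, ∀ g ∈ U, finsuppBilin G (leftReg G g (walkLaw τ n) - walkLaw τ n)
      (leftReg G g (walkLaw τ n) - walkLaw τ n) < (ε / 2) ^ 2 := by
    rw [Filter.eventually_all_finset]
    exact fun g _ => (hen g).eventually_lt_const (by positivity)
  filter_upwards [hev] with n hn
  have h1 : ∀ x, walkLaw τ n x ≤ 1 / m + ε / 2 := by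
    intro x
    have h2 : ∑ g ∈ U, walkLaw τ n x ≤ ∑ g ∈ U, (walkLaw τ n (g⁻¹ * x) + ε / 2) := by
      refine Finset.sum_le_sum fun g hg => ?_
      have h3 := (sq_apply_le_finsuppBilin _ x).trans_lt (hn g hg)
      have h4 := abs_lt_of_sq_lt_sq h3 (by positivity)
      rw [Finsupp.sub_apply, leftReg_apply] at h4
      linarith [(abs_lt.1 h4).1]
    have h3 : ∑ g ∈ U, walkLaw τ n (g⁻¹ * x) ≤ 1 := by
      have := sum_walkLaw_le (τ := τ) n (U.map ⟨fun g => g⁻¹ * x, fun a b h => by simpa using h⟩)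
      rwa [Finset.sum_map] at this
    rw [Finset.sum_add_distrib, Finset.sum_const, Finset.sum_const, hU, nsmul_eq_mul,
      nsmul_eq_mul] at h2
    have h4 : (m : ℝ) * walkLaw τ n x ≤ m * (1 / m + ε / 2) := by
      rw [mul_add, mul_one_div_cancel hm0.ne']; linarith
    exact le_of_mul_le_mul_left h4 hm0
  have h5 : (1 : ℝ) / m < ε / 2 := by
    rw [div_lt_iff₀ hm0]
    rw [div_lt_iff₀ hε] at hm
    linarith
  calc walkNorm τ n ≤ ∑ x ∈ (walkLaw τ n).support, (1 / m + ε / 2) * walkLaw τ n x := by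
        rw [walkNorm, finsuppBilin_self]
        refine Finset.sum_le_sum fun x _ => ?_
        rw [sq]
        exact mul_le_mul_of_nonneg_right (h1 x) (walkLaw_nonneg _ _)
    _ = 1 / m + ε / 2 := by rw [← Finset.mul_sum, sum_walkLaw, mul_one]
    _ < ε := by linarith

/-- An infinite group of polynomial growth carries a nonconstant Lipschitz harmonic function. -/
theorem PolyGrowth.exists_harmonic [Infinite G] {d : ℕ} (hG : PolyGrowth d G) :
    ∃ u : G → ℝ, IsHarmonic (fun p : κ × κ => τ p.1 * τ p.2) u ∧
      (∃ L, ∀ x i, |u (x * τ i) - u x| ≤ L) ∧ ∃ x, u x ≠ u 1 := by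
  obtain ⟨h0, hd0⟩ := tendsto_walkNorm he hi₀ hgen
  set b : ℕ → ℝ := fun n => walkNorm τ n - walkNorm τ (n + 1) with hb
  have hbpos : ∀ n, 0 < b n := fun n => sub_pos.2 (walkNorm_succ_lt he hi₀ hgen n)
  have hbanti : ∀ n, 0 ≤ b n - b (n + 1) := by
    intro n
    have := bilin_second_difference finsuppBilin_symm finsuppBilin_leftReg he (walkLaw τ n)
    exact (finsuppBilin_nonneg _).trans_eq this
  have key : ∀ ε > (0 : ℝ), ∃ n, (b n - b (n + 1)) / b n < ε := by
    by_contra! hcon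
    obtain ⟨ε, hε, hcon⟩ := hcon
    have h1 : ∀ n, b (n + 1) ≤ (1 - ε) * b n := by
      intro n
      have := (le_div_iff₀ (hbpos n)).1 (hcon n)
      linarith
    have hε1 : 0 < 1 - ε := by
      have := (hbpos 1).trans_le (h1 0)
      exact pos_of_mul_pos_left this (hbpos 0).le
    have h2 : Monotone fun n => walkNorm τ n - b n / ε := by
      refine monotone_nat_of_le_succ fun n => ?_
      have h3 : b n ≤ (b n - b (n + 1)) / ε := by
        rw [le_div_iff₀ hε]; linarith [h1 n]
      have h4 : b n = walkNorm τ n - walkNorm τ (n + 1) := rfl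
      rw [sub_div] at h3
      linarith
    have h3 : Tendsto (fun n => walkNorm τ n - b n / ε) atTop (𝓝 0) := by
      simpa using h0.sub (hd0.div_const ε)
    have h4 : ∀ n, walkNorm τ n ≤ b n / ε := fun n => by linarith [h2.ge_of_tendsto h3 n]
    have h5 : ∀ n, b n ≤ (1 - ε) ^ n * b 0 := by
      intro n
      induction n with
      | zero => simp
      | succ n ih =>
        calc b (n + 1) ≤ (1 - ε) * b n := h1 n
          _ ≤ (1 - ε) * ((1 - ε) ^ n * b 0) := by gcongr
          _ = _ := by ring
    obtain ⟨C, hC⟩ := hG _ (Set.finite_range τ)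
    have h6 : ∀ n : ℕ, 1 ≤ n → 1 ≤ (C * b 0 / ε) * ((n : ℝ) ^ d * (1 - ε) ^ n) := by
      intro n hn
      have hwn : 0 ≤ walkNorm τ n := finsuppBilin_nonneg _
      calc (1 : ℝ) ≤ ((Set.range τ ^ n).ncard : ℝ) * walkNorm τ n := one_le_card_mul_walkNorm n
        _ ≤ (C * (n : ℝ) ^ d) * (((1 - ε) ^ n * b 0) / ε) := by
          gcongr
          · exact_mod_cast hC n hn
          · exact (h4 n).trans (by gcongr; exact h5 n)
        _ = _ := by ring
    have h7 := (tendsto_pow_const_mul_const_pow_of_abs_lt_one d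
      (abs_lt.2 ⟨by linarith, by linarith⟩ : |1 - ε| < 1)).const_mul (C * b 0 / ε)
    rw [mul_zero] at h7
    obtain ⟨n, hn1, hn2⟩ := ((h7.eventually_lt_const one_pos).and (eventually_ge_atTop 1)).exists
    exact absurd (h6 n hn2) (not_le.2 hn1)
  choose n hn using fun k : ℕ => key (1 / (k + 1)) (by positivity)
  refine exists_harmonic_of_seq (B := finsuppBilin G) (π := leftReg G) finsuppBilin_nonneg
    finsuppBilin_symm finsuppBilin_leftReg he hi₀ hgen (fun k => walkLaw τ (n k))
    (fun k => b (n k)) (fun k => b (n k + 1)) (fun k => rfl) (fun k => rfl)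
    (fun k => hbpos _) ?_
  exact squeeze_zero (fun k => div_nonneg (hbanti _) (hbpos _).le) (fun k => (hn k).le)
    tendsto_one_div_add_atTop_nhds_zero_nat

end

end HarmonicExistence

section Entropy

open scoped Topology Pointwise

variable {G ι : Type*} [Group G] [Fintype ι] {σ : ι → G}

/-- The expectation of `v` at the `n`-th step of the random walk with steps `σ i`. -/
noncomputable def walkExp (σ : ι → G) (n : ℕ) (v : G → ℝ) : ℝ :=
  Finsupp.linearCombination ℝ v (walkLaw σ n)

theorem walkExp_eq_sum (n : ℕ) (v : G → ℝ) :
    walkExp σ n v = ∑ x ∈ (walkLaw σ n).support, walkLaw σ n x * v x := by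
  simp [walkExp, Finsupp.linearCombination_apply, Finsupp.sum]

theorem walkExp_add (n : ℕ) (v w : G → ℝ) :
    walkExp σ n (fun x => v x + w x) = walkExp σ n v + walkExp σ n w := by
  simp only [walkExp_eq_sum, mul_add, Finset.sum_add_distrib]

theorem walkExp_const_mul (n : ℕ) (c : ℝ) (v : G → ℝ) :
    walkExp σ n (fun x => c * v x) = c * walkExp σ n v := by
  simp only [walkExp_eq_sum, Finset.mul_sum]
  exact Finset.sum_congr rfl fun _ _ => by ring

theorem walkExp_sum {κ : Type*} (n : ℕ) (s : Finset κ) (v : κ → G → ℝ) :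
    walkExp σ n (fun x => ∑ k ∈ s, v k x) = ∑ k ∈ s, walkExp σ n (v k) := by
  simp only [walkExp_eq_sum, Finset.mul_sum]
  exact Finset.sum_comm

theorem walkExp_mono (n : ℕ) {v w : G → ℝ} (h : ∀ x, v x ≤ w x) :
    walkExp σ n v ≤ walkExp σ n w := by
  simp only [walkExp_eq_sum]
  exact Finset.sum_le_sum fun x _ => mul_le_mul_of_nonneg_left (h x) (walkLaw_nonneg _ _)

theorem walkExp_nonneg (n : ℕ) {v : G → ℝ} (h : ∀ x, 0 ≤ v x) : 0 ≤ walkExp σ n v := by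
  rw [walkExp_eq_sum]
  exact Finset.sum_nonneg fun x _ => mul_nonneg (walkLaw_nonneg _ _) (h x)

theorem walkExp_zero (v : G → ℝ) : walkExp σ 0 v = v 1 := by
  simp [walkExp, walkLaw]

theorem walkExp_const [Nonempty ι] (n : ℕ) (c : ℝ) : walkExp σ n (fun _ => c) = c := by
  rw [walkExp_eq_sum, ← Finset.sum_mul, sum_walkLaw, one_mul]

theorem linearCombination_leftReg (g : G) (f : G →₀ ℝ) (v : G → ℝ) :
    Finsupp.linearCombination ℝ v (leftReg G g f) =
      Finsupp.linearCombination ℝ (fun x => v (g * x)) f := by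
  simp only [leftReg, MonoidHom.coe_mk, OneHom.coe_mk, Finsupp.lmapDomain_apply,
    Finsupp.linearCombination_mapDomain]
  rfl

theorem walkExp_succ_left (n : ℕ) (v : G → ℝ) :
    walkExp σ (n + 1) v =
      (Fintype.card ι : ℝ)⁻¹ * ∑ i, walkExp σ n (fun x => v (σ i * x)) := by
  simp only [walkExp]
  rw [walkLaw, avgOp, LinearMap.smul_apply, map_smul, LinearMap.sum_apply, map_sum]
  simp only [linearCombination_leftReg, smul_eq_mul]

theorem walkExp_succ_right (n : ℕ) (v : G → ℝ) :
    walkExp σ (n + 1) v =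
      (Fintype.card ι : ℝ)⁻¹ * ∑ i, walkExp σ n (fun x => v (x * σ i)) := by
  induction n generalizing v with
  | zero => simp [walkExp_succ_left, walkExp_zero]
  | succ n ih =>
    rw [walkExp_succ_left]
    have h1 : ∀ i, walkExp σ (n + 1) (fun x => v (σ i * x)) =
        (Fintype.card ι : ℝ)⁻¹ * ∑ j, walkExp σ n (fun x => v (σ i * (x * σ j))) := fun i => ih _
    have h2 : ∀ j, walkExp σ (n + 1) (fun x => v (x * σ j)) =
        (Fintype.card ι : ℝ)⁻¹ * ∑ i, walkExp σ n (fun x => v (σ i * x * σ j)) := fun j =>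
      walkExp_succ_left _ _
    rw [Finset.sum_congr rfl fun i _ => h1 i, Finset.sum_congr rfl fun j _ => h2 j,
      ← Finset.mul_sum, ← Finset.mul_sum, Finset.sum_comm]
    simp only [← mul_assoc]

theorem sum_leftReg (g : G) (f : G →₀ ℝ) {φ : ℝ → ℝ} (h0 : φ 0 = 0) {s : Finset G}
    (hs : (leftReg G g f).support ⊆ s) :
    ∑ x ∈ s, φ (leftReg G g f x) = ∑ y ∈ f.support, φ (f y) := by
  rw [← Finset.sum_subset hs fun x _ hx => by rw [Finsupp.notMem_support_iff.1 hx, h0]]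
  refine Finset.sum_bij' (fun x _ => g⁻¹ * x) (fun x _ => g * x) ?_ ?_ ?_ ?_ ?_ <;>
    simp [leftReg_apply]

theorem mul_log_sub_ge {p q : ℝ} (hp : 0 ≤ p) (hq : 0 < q) :
    (p - q) ^ 2 / (2 * (p + q)) ≤ p * Real.log p - p * Real.log q - p + q := by
  rcases hp.eq_or_lt with rfl | hp
  · rw [div_le_iff₀ (by positivity)]; nlinarith
  set a := Real.sqrt p with ha
  set b := Real.sqrt q with hb
  have ha0 : 0 < a := Real.sqrt_pos.2 hp
  have hb0 : 0 < b := Real.sqrt_pos.2 hq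
  have hpa : p = a ^ 2 := (Real.sq_sqrt hp.le).symm
  have hqb : q = b ^ 2 := (Real.sq_sqrt hq.le).symm
  rw [hpa, hqb]
  have h1 := Real.log_le_sub_one_of_pos (div_pos hb0 ha0)
  rw [Real.log_div hb0.ne' ha0.ne'] at h1
  have h2 : a ^ 2 * (Real.log b - Real.log a) ≤ a ^ 2 * (b / a - 1) :=
    mul_le_mul_of_nonneg_left h1 (sq_nonneg _)
  have h3 : a ^ 2 * (b / a - 1) = a * b - a ^ 2 := by field_simp
  rw [Real.log_pow, Real.log_pow]
  push_cast
  have h4 : (a ^ 2 - b ^ 2) ^ 2 / (2 * (a ^ 2 + b ^ 2)) ≤ (a - b) ^ 2 := by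
    rw [div_le_iff₀ (by positivity)]
    nlinarith [mul_nonneg (sq_nonneg (a - b)) (sq_nonneg (a - b))]
  nlinarith

/-- The Shannon entropy of the `n`-th step of the random walk. -/
noncomputable def walkEntropy (σ : ι → G) (n : ℕ) : ℝ :=
  ∑ x ∈ (walkLaw σ n).support, Real.negMulLog (walkLaw σ n x)

theorem walkEntropy_le [Nonempty ι] {n : ℕ} {N : ℝ} (hN : ((Set.range σ ^ n).ncard : ℝ) ≤ N) :
    walkEntropy σ n ≤ Real.log N := by
  set q := walkLaw σ n with hq
  have hcard : (q.support.card : ℝ) ≤ N := by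
    refine le_trans ?_ hN
    rw [← Set.ncard_coe_finset]
    exact_mod_cast Set.ncard_le_ncard (fun x hx => walkLaw_mem_pow (Finsupp.mem_support_iff.1 hx))
      ((Set.finite_range σ).pow_nat n)
  have hne : q.support.Nonempty := by
    by_contra h
    have := sum_walkLaw (τ := σ) n
    rw [← hq, Finset.not_nonempty_iff_eq_empty.1 h] at this
    simp at this
  have hN0 : 0 < N := lt_of_lt_of_le (by exact_mod_cast hne.card_pos) hcard
  have h1 : ∀ x ∈ q.support, Real.negMulLog (q x) - q x * Real.log N ≤ 1 / N - q x := by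
    intro x hx
    have hx0 : 0 < q x := lt_of_le_of_ne (walkLaw_nonneg _ _) (Finsupp.mem_support_iff.1 hx).symm
    have h2 := Real.log_le_sub_one_of_pos (show 0 < 1 / (N * q x) by positivity)
    rw [Real.log_div one_ne_zero (by positivity), Real.log_one,
      Real.log_mul hN0.ne' hx0.ne'] at h2
    have h3 := mul_le_mul_of_nonneg_left h2 hx0.le
    have h4 : q x * (1 / (N * q x) - 1) = 1 / N - q x := by field_simp
    rw [Real.negMulLog]
    nlinarith
  have h2 := Finset.sum_le_sum h1
  rw [Finset.sum_sub_distrib, Finset.sum_sub_distrib, ← Finset.sum_mul, sum_walkLaw,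
    Finset.sum_const, nsmul_eq_mul, one_mul] at h2
  have h3 : (q.support.card : ℝ) * (1 / N) ≤ 1 := by
    rw [mul_one_div, div_le_one hN0]; exact hcard
  have h4 : walkEntropy σ n = ∑ x ∈ q.support, Real.negMulLog (q x) := rfl
  linarith

theorem leftReg_walkLaw_le (n : ℕ) (i : ι) (x : G) :
    leftReg G (σ i) (walkLaw σ n) x ≤ Fintype.card ι * walkLaw σ (n + 1) x := by
  have hc : (Fintype.card ι : ℝ) ≠ 0 := by
    have : Nonempty ι := ⟨i⟩
    exact_mod_cast Fintype.card_ne_zero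
  rw [walkLaw, avgOp_leftReg_apply, mul_inv_cancel_left₀ hc, leftReg_apply]
  exact Finset.single_le_sum (f := fun i => walkLaw σ n ((σ i)⁻¹ * x))
    (fun _ _ => walkLaw_nonneg _ _) (Finset.mem_univ i)

theorem leftReg_walkLaw_nonneg (n : ℕ) (g : G) (x : G) : 0 ≤ leftReg G g (walkLaw σ n) x := by
  rw [leftReg_apply]; exact walkLaw_nonneg _ _

theorem support_leftReg_walkLaw (n : ℕ) (i : ι) :
    (leftReg G (σ i) (walkLaw σ n)).support ⊆ (walkLaw σ (n + 1)).support := by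
  intro x hx
  rw [Finsupp.mem_support_iff] at hx ⊢
  intro h
  have := leftReg_walkLaw_le (σ := σ) n i x
  rw [h, mul_zero] at this
  exact hx (le_antisymm this (leftReg_walkLaw_nonneg _ _ _))

/-- The entropy increment controls the distance between the law of the walk and its translates. -/
theorem sum_sq_div_le_entropy [Nonempty ι] (n : ℕ) :
    ∑ i, ∑ x ∈ (walkLaw σ (n + 1)).support,
      (leftReg G (σ i) (walkLaw σ n) x - walkLaw σ (n + 1) x) ^ 2 /
        (2 * (leftReg G (σ i) (walkLaw σ n) x + walkLaw σ (n + 1) x)) ≤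
      Fintype.card ι * (walkEntropy σ (n + 1) - walkEntropy σ n) := by
  set q := walkLaw σ (n + 1) with hq
  set p : ι → G →₀ ℝ := fun i => leftReg G (σ i) (walkLaw σ n) with hp
  have hc : (Fintype.card ι : ℝ) ≠ 0 := by exact_mod_cast Fintype.card_ne_zero
  have h1 : ∀ i, ∀ x ∈ q.support, (p i x - q x) ^ 2 / (2 * (p i x + q x)) ≤
      p i x * Real.log (p i x) - p i x * Real.log (q x) - p i x + q x := fun i x hx =>
    mul_log_sub_ge (leftReg_walkLaw_nonneg _ _ _)
      (lt_of_le_of_ne (walkLaw_nonneg _ _) (Finsupp.mem_support_iff.1 hx).symm)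
  refine (Finset.sum_le_sum fun i _ => Finset.sum_le_sum (h1 i)).trans_eq ?_
  simp only [Finset.sum_add_distrib, Finset.sum_sub_distrib]
  have h2 : ∀ i, ∑ x ∈ q.support, p i x * Real.log (p i x) = - walkEntropy σ n := by
    intro i
    rw [walkEntropy, ← sum_leftReg (σ i) (walkLaw σ n) Real.negMulLog_zero
      (support_leftReg_walkLaw n i), ← Finset.sum_neg_distrib]
    exact Finset.sum_congr rfl fun x _ => by simp [Real.negMulLog, hp]
  have h3 : ∀ i, ∑ x ∈ q.support, p i x = 1 := by
    intro i
    rw [← sum_walkLaw (τ := σ) n]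
    exact sum_leftReg (σ i) (walkLaw σ n) (φ := fun t => t) rfl (support_leftReg_walkLaw n i)
  have h4 : ∑ i, ∑ x ∈ q.support, p i x * Real.log (q x) =
      - (Fintype.card ι * walkEntropy σ (n + 1)) := by
    rw [Finset.sum_comm, walkEntropy, Finset.mul_sum, ← Finset.sum_neg_distrib]
    refine Finset.sum_congr rfl fun x _ => ?_
    rw [← Finset.sum_mul, Real.negMulLog]
    have : ∑ i, p i x = Fintype.card ι * q x := by
      rw [hq, walkLaw, avgOp_leftReg_apply, mul_inv_cancel_left₀ hc]
      simp only [hp, leftReg_apply]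
    rw [this]; ring
  have h5 : ∑ x ∈ q.support, q x = 1 := sum_walkLaw (τ := σ) (n + 1)
  rw [h4, Finset.sum_congr rfl fun i _ => h2 i, Finset.sum_congr rfl fun i _ => h3 i, h5]
  simp only [Finset.sum_const, Finset.card_univ, nsmul_eq_mul]
  ring

/-- Along the times when the entropy grows slowly, the laws of `X_{n+1}` and `s X_n` are close. -/
theorem PolyGrowth.exists_good_times [Nonempty ι] {d : ℕ} (hG : PolyGrowth d G) (σ : ι → G) :
    ∃ C : ℝ, 0 < C ∧ ∀ m : ℕ, ∃ n, m ≤ n ∧ 1 ≤ n ∧ ∀ i, ∀ v : G → ℝ,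
      (walkExp σ n (fun x => v (σ i * x)) - walkExp σ (n + 1) v) ^ 2 ≤
        C / n * (walkExp σ n (fun x => v (σ i * x) ^ 2) + walkExp σ (n + 1) (fun x => v x ^ 2)) := by
  have hc : (0 : ℝ) < Fintype.card ι := by exact_mod_cast Fintype.card_pos
  obtain ⟨C, hC⟩ := hG _ (Set.finite_range σ)
  refine ⟨2 * (Fintype.card ι * (d + 1)), by positivity, fun m => ?_⟩
  obtain ⟨n, hmn, hn1, hn⟩ : ∃ n, m ≤ n ∧ 1 ≤ n ∧
      walkEntropy σ (n + 1) - walkEntropy σ n ≤ (d + 1) / n := by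
    by_contra! hcon
    set m' := m + 1 with hm'
    have h1 : ∀ k, walkEntropy σ m' + (d + 1) * (Real.log (m' + k : ℕ) - Real.log m') ≤
        walkEntropy σ (m' + k) := by
      intro k
      induction k with
      | zero => simp
      | succ k ih =>
        have h2 := hcon (m' + k) (by omega) (by omega)
        have hpos : (0 : ℝ) < ((m' + k : ℕ) : ℝ) := by exact_mod_cast (by omega : 0 < m' + k)
        have h3 : Real.log ((m' + (k + 1) : ℕ) : ℝ) - Real.log ((m' + k : ℕ) : ℝ) ≤
            1 / ((m' + k : ℕ) : ℝ) := by
          rw [← Real.log_div (by positivity) hpos.ne']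
          refine (Real.log_le_sub_one_of_pos (by positivity)).trans_eq ?_
          have : ((m' + (k + 1) : ℕ) : ℝ) = ((m' + k : ℕ) : ℝ) + 1 := by push_cast; ring
          rw [this]; field_simp; ring
        have h4 := mul_le_mul_of_nonneg_left h3 (by positivity : (0 : ℝ) ≤ d + 1)
        rw [mul_one_div] at h4
        rw [show m' + (k + 1) = m' + k + 1 from rfl] at h4 ⊢
        linarith
    have hC1 : (1 : ℝ) ≤ (C + 1 : ℝ) := by linarith [(Nat.cast_nonneg C : (0 : ℝ) ≤ C)]
    have h2 : ∀ k, walkEntropy σ (m' + k) ≤ Real.log (C + 1) + d * Real.log (m' + k : ℕ) := by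
      intro k
      have hpos : (0 : ℝ) < ((m' + k : ℕ) : ℝ) := by exact_mod_cast (by omega : 0 < m' + k)
      rw [← Real.log_pow, ← Real.log_mul (by positivity) (by positivity)]
      refine walkEntropy_le ?_
      refine (Nat.cast_le (α := ℝ).2 (hC (m' + k) (by omega))).trans ?_
      push_cast
      gcongr
      linarith
    have h3 : ∀ k : ℕ, Real.log (m' + k : ℕ) ≤
        Real.log (C + 1) + (d + 1) * Real.log m' - walkEntropy σ m' := by
      intro k; nlinarith [h1 k, h2 k]
    have h4 : Tendsto (fun k : ℕ => Real.log (m' + k : ℕ)) atTop atTop := by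
      refine Real.tendsto_log_atTop.comp (tendsto_natCast_atTop_atTop.comp ?_)
      exact tendsto_atTop_mono (fun k => Nat.le_add_left k m') tendsto_id
    obtain ⟨k, hk⟩ := (h4.eventually_gt_atTop
      (Real.log (C + 1) + (d + 1) * Real.log m' - walkEntropy σ m')).exists
    exact absurd (h3 k) (not_le.2 hk)
  refine ⟨n, hmn, hn1, fun i v => ?_⟩
  set q := walkLaw σ (n + 1) with hq
  set p := leftReg G (σ i) (walkLaw σ n) with hp
  have hqpos : ∀ x ∈ q.support, 0 < q x := fun x hx =>
    lt_of_le_of_ne (walkLaw_nonneg _ _) (Finsupp.mem_support_iff.1 hx).symm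
  have hp0 : ∀ x, 0 ≤ p x := leftReg_walkLaw_nonneg _ _
  have hE : ∀ w : G → ℝ, walkExp σ n (fun x => w (σ i * x)) = ∑ x ∈ q.support, p x * w x := by
    intro w
    rw [walkExp, ← linearCombination_leftReg, Finsupp.linearCombination_apply, Finsupp.sum]
    refine Finset.sum_subset (support_leftReg_walkLaw n i) fun x _ hx => ?_
    rw [Finsupp.notMem_support_iff.1 hx, zero_smul]
  have hent : ∑ x ∈ q.support, (p x - q x) ^ 2 / (p x + q x) ≤
      2 * (Fintype.card ι * (d + 1)) / n := by
    have h1 := (Finset.single_le_sum (f := fun i => ∑ x ∈ (walkLaw σ (n + 1)).support,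
      (leftReg G (σ i) (walkLaw σ n) x - walkLaw σ (n + 1) x) ^ 2 /
        (2 * (leftReg G (σ i) (walkLaw σ n) x + walkLaw σ (n + 1) x)))
      (fun i _ => Finset.sum_nonneg fun x _ => div_nonneg (sq_nonneg _) (mul_nonneg two_pos.le
        (add_nonneg (leftReg_walkLaw_nonneg _ _ _) (walkLaw_nonneg _ _))))
        (Finset.mem_univ i)).trans (sum_sq_div_le_entropy n)
    have h2 := h1.trans (mul_le_mul_of_nonneg_left hn hc.le)
    have h3 : ∀ x, (p x - q x) ^ 2 / (p x + q x) = 2 * ((p x - q x) ^ 2 / (2 * (p x + q x))) := by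
      intro x; rw [mul_comm 2 (p x + q x), ← div_div]; ring
    simp only [h3]
    rw [← Finset.mul_sum]
    calc _ ≤ 2 * ((Fintype.card ι : ℝ) * (((d : ℝ) + 1) / n)) :=
          mul_le_mul_of_nonneg_left h2 two_pos.le
      _ = _ := by ring
  rw [hE, hE (fun x => v x ^ 2), walkExp_eq_sum, walkExp_eq_sum, ← hq, ← Finset.sum_sub_distrib,
    ← Finset.sum_add_distrib]
  have hnn : ∀ x ∈ q.support, 0 < p x + q x := fun x hx => by linarith [hp0 x, hqpos x hx]
  have hCS := Finset.sum_sq_le_sum_mul_sum_of_sq_eq_mul q.support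
    (r := fun x => p x * v x - q x * v x)
    (f := fun x => (p x - q x) ^ 2 / (p x + q x)) (g := fun x => p x * v x ^ 2 + q x * v x ^ 2)
    (fun x hx => div_nonneg (sq_nonneg _) (hnn x hx).le)
    (fun x hx => by have := hp0 x; have := hqpos x hx; positivity)
    (fun x hx => by have := (hnn x hx).ne'; field_simp)
  refine hCS.trans (mul_le_mul_of_nonneg_right hent (Finset.sum_nonneg fun x hx => ?_))
  have := hp0 x; have := hqpos x hx; positivity

end Entropy

section LipschitzHarmonic

open scoped Topology Pointwise

variable {G ι : Type*} [Group G] [Fintype ι] {σ : ι → G}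

/-- Harmonic functions with bounded increments. -/
structure LipHarmonic (σ : ι → G) (u : G → ℝ) : Prop where
  harmonic : IsHarmonic σ u
  lipschitz : ∃ L, ∀ x i, |u (x * σ i) - u x| ≤ L

theorem LipHarmonic.add {u v : G → ℝ} (hu : LipHarmonic σ u) (hv : LipHarmonic σ v) :
    LipHarmonic σ (fun x => u x + v x) := by
  obtain ⟨L, hL⟩ := hu.lipschitz
  obtain ⟨M, hM⟩ := hv.lipschitz
  refine ⟨fun x => ?_, L + M, fun x i => ?_⟩
  · rw [Finset.sum_add_distrib, hu.harmonic, hv.harmonic, mul_add]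
  · rw [add_sub_add_comm]
    exact (abs_add_le _ _).trans (add_le_add (hL x i) (hM x i))

theorem LipHarmonic.const_mul {u : G → ℝ} (hu : LipHarmonic σ u) (c : ℝ) :
    LipHarmonic σ (fun x => c * u x) := by
  obtain ⟨L, hL⟩ := hu.lipschitz
  refine ⟨fun x => ?_, |c| * L, fun x i => ?_⟩
  · rw [← Finset.mul_sum, hu.harmonic]; ring
  · rw [← mul_sub, abs_mul]
    exact mul_le_mul_of_nonneg_left (hL x i) (abs_nonneg _)

theorem LipHarmonic.const (c : ℝ) : LipHarmonic σ (fun _ => c) :=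
  ⟨fun x => by simp, 0, fun x i => by simp⟩

theorem LipHarmonic.translate {u : G → ℝ} (hu : LipHarmonic σ u) (g : G) :
    LipHarmonic σ (fun x => u (g * x)) := by
  obtain ⟨L, hL⟩ := hu.lipschitz
  refine ⟨fun x => ?_, L, fun x i => ?_⟩
  · simpa only [mul_assoc] using hu.harmonic (g * x)
  · simpa only [mul_assoc] using hL (g * x) i

variable [Nonempty ι]

theorem IsHarmonic.walkExp_eq {u : G → ℝ} (hu : IsHarmonic σ u) (n : ℕ) :
    walkExp σ n u = u 1 := by
  have hc : (Fintype.card ι : ℝ) ≠ 0 := by exact_mod_cast Fintype.card_ne_zero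
  induction n with
  | zero => exact walkExp_zero u
  | succ n ih =>
    rw [walkExp_succ_right, ← walkExp_sum]
    have : (fun x => ∑ i, u (x * σ i)) = fun x => (Fintype.card ι : ℝ) * u x := funext hu
    rw [this, walkExp_const_mul, ih, inv_mul_cancel_left₀ hc]

/-- The average over the steps of a function. -/
noncomputable def stepAvg (ι : Type*) [Fintype ι] (f : ι → ℝ) : ℝ :=
  (Fintype.card ι : ℝ)⁻¹ * ∑ i, f i

theorem walkExp_succ (n : ℕ) (v : G → ℝ) :
    walkExp σ (n + 1) v = walkExp σ n (fun x => stepAvg ι fun i => v (x * σ i)) := by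
  rw [walkExp_succ_right, ← walkExp_sum, ← walkExp_const_mul]
  rfl

omit [Nonempty ι] in
theorem stepAvg_mono {f g : ι → ℝ} (h : ∀ i, f i ≤ g i) : stepAvg ι f ≤ stepAvg ι g :=
  mul_le_mul_of_nonneg_left (Finset.sum_le_sum fun i _ => h i) (by positivity)

theorem stepAvg_const (c : ℝ) : stepAvg ι (fun _ => c) = c := by
  have hc : (Fintype.card ι : ℝ) ≠ 0 := by exact_mod_cast Fintype.card_ne_zero
  simp [stepAvg, hc]

omit [Nonempty ι] in
theorem stepAvg_add (f g : ι → ℝ) : stepAvg ι (fun i => f i + g i) = stepAvg ι f + stepAvg ι g := by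
  simp only [stepAvg, Finset.sum_add_distrib, mul_add]

omit [Nonempty ι] in
theorem stepAvg_const_mul (c : ℝ) (f : ι → ℝ) :
    stepAvg ι (fun i => c * f i) = c * stepAvg ι f := by
  simp only [stepAvg, ← Finset.mul_sum]; ring

theorem IsHarmonic.stepAvg_sub {u : G → ℝ} (hu : IsHarmonic σ u) (x : G) :
    stepAvg ι (fun i => u (x * σ i) - u x) = 0 := by
  simp [stepAvg, hu x]

theorem IsHarmonic.walkExp_succ_sq {u : G → ℝ} (hu : IsHarmonic σ u) (n : ℕ) :
    walkExp σ (n + 1) (fun x => u x ^ 2) = walkExp σ n (fun x => u x ^ 2) +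
      walkExp σ n (fun x => stepAvg ι fun i => (u (x * σ i) - u x) ^ 2) := by
  rw [walkExp_succ, ← walkExp_add]
  congr 1
  funext x
  have : ∀ i, u (x * σ i) ^ 2 = u x ^ 2 + (2 * u x * (u (x * σ i) - u x) +
    (u (x * σ i) - u x) ^ 2) := fun i => by ring
  simp only [this]
  rw [stepAvg_add, stepAvg_const, stepAvg_add, stepAvg_const_mul, hu.stepAvg_sub]
  ring

theorem IsHarmonic.walkExp_sq_mono {u : G → ℝ} (hu : IsHarmonic σ u) (n : ℕ) :
    walkExp σ n (fun x => u x ^ 2) ≤ walkExp σ (n + 1) (fun x => u x ^ 2) := by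
  rw [hu.walkExp_succ_sq]
  have := walkExp_nonneg (σ := σ) n (v := fun x => stepAvg ι fun i => (u (x * σ i) - u x) ^ 2)
    fun x => mul_nonneg (by positivity) (by positivity)
  linarith

theorem IsHarmonic.walkExp_succ_sq_le {u : G → ℝ} (hu : IsHarmonic σ u) {L : ℝ}
    (hL : ∀ x i, |u (x * σ i) - u x| ≤ L) (n : ℕ) :
    walkExp σ (n + 1) (fun x => u x ^ 2) ≤ walkExp σ n (fun x => u x ^ 2) + L ^ 2 := by
  rw [hu.walkExp_succ_sq]
  refine add_le_add le_rfl ?_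
  rw [← walkExp_const (σ := σ) n (L ^ 2)]
  refine walkExp_mono n fun x => ?_
  rw [← stepAvg_const (ι := ι) (L ^ 2)]
  refine stepAvg_mono fun i => ?_
  rw [← sq_abs]
  exact pow_le_pow_left₀ (abs_nonneg _) (hL x i) 2

theorem IsHarmonic.walkExp_sq_le {u : G → ℝ} (hu : IsHarmonic σ u) {L : ℝ}
    (hL : ∀ x i, |u (x * σ i) - u x| ≤ L) (n : ℕ) :
    walkExp σ n (fun x => u x ^ 2) ≤ u 1 ^ 2 + n * L ^ 2 := by
  induction n with
  | zero => simp [walkExp_zero]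
  | succ n ih =>
    have := hu.walkExp_succ_sq_le hL n
    push_cast
    linarith

theorem IsHarmonic.walkExp_pow_four_le {u : G → ℝ} (hu : IsHarmonic σ u) {L : ℝ}
    (hL : ∀ x i, |u (x * σ i) - u x| ≤ L) (n : ℕ) :
    walkExp σ n (fun x => u x ^ 4) ≤
      u 1 ^ 4 + n * (8 * L ^ 2 * (u 1 ^ 2 + n * L ^ 2) + 3 * L ^ 4) := by
  have hL0 : 0 ≤ L := (abs_nonneg _).trans (hL 1 (Classical.arbitrary ι))
  have key : ∀ m, walkExp σ (m + 1) (fun x => u x ^ 4) ≤ walkExp σ m (fun x => u x ^ 4) +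
      (8 * L ^ 2 * walkExp σ m (fun x => u x ^ 2) + 3 * L ^ 4) := by
    intro m
    rw [walkExp_succ, ← walkExp_const (σ := σ) m (3 * L ^ 4), ← walkExp_const_mul, ← walkExp_add,
      ← walkExp_add]
    refine walkExp_mono m fun x => ?_
    have h1 : ∀ i, u (x * σ i) ^ 4 ≤ (u x ^ 4 + (8 * L ^ 2 * u x ^ 2 + 3 * L ^ 4)) +
        (4 * u x ^ 3) * (u (x * σ i) - u x) := by
      intro i
      have h2 := hL x i
      set a := u x
      set t := u (x * σ i) - a with ht
      have h3 : u (x * σ i) = a + t := by rw [ht]; ring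
      rw [h3]
      have h4 : t ^ 2 ≤ L ^ 2 := by
        rw [← sq_abs t]; exact pow_le_pow_left₀ (abs_nonneg _) h2 2
      have h5 : 4 * a * t ^ 3 ≤ 2 * a ^ 2 * t ^ 2 + 2 * (t ^ 2 * t ^ 2) := by
        nlinarith [mul_nonneg (sq_nonneg t) (sq_nonneg (a - t))]
      have h6 : t ^ 2 * t ^ 2 ≤ L ^ 2 * L ^ 2 :=
        mul_le_mul h4 h4 (sq_nonneg _) (sq_nonneg _)
      have h7 : a ^ 2 * t ^ 2 ≤ a ^ 2 * L ^ 2 := mul_le_mul_of_nonneg_left h4 (sq_nonneg _)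
      nlinarith
    refine (stepAvg_mono h1).trans_eq ?_
    rw [stepAvg_add, stepAvg_const, stepAvg_const_mul, hu.stepAvg_sub]
    ring
  have h2 : ∀ m ≤ n, walkExp σ m (fun x => u x ^ 4) ≤
      u 1 ^ 4 + m * (8 * L ^ 2 * (u 1 ^ 2 + n * L ^ 2) + 3 * L ^ 4) := by
    intro m
    induction m with
    | zero => intro _; simp [walkExp_zero]
    | succ m ih =>
      intro hm
      have h3 := key m
      have h4 := ih (by omega)
      have h5 := hu.walkExp_sq_le hL m
      have h6 : u 1 ^ 2 + m * L ^ 2 ≤ u 1 ^ 2 + n * L ^ 2 := by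
        have : (m : ℝ) ≤ n := by exact_mod_cast (by omega : m ≤ n)
        gcongr
      have h7 := mul_le_mul_of_nonneg_left (h5.trans h6) (by positivity : 0 ≤ 8 * L ^ 2)
      push_cast
      linarith
  exact h2 n le_rfl

theorem LipHarmonic.exists_sq_bound {u : G → ℝ} (hu : LipHarmonic σ u) :
    ∃ M, 0 ≤ M ∧ ∀ n : ℕ, 1 ≤ n → walkExp σ n (fun x => u x ^ 2) ≤ M * n := by
  obtain ⟨L, hL⟩ := hu.lipschitz
  refine ⟨u 1 ^ 2 + L ^ 2, by positivity, fun n hn => (hu.harmonic.walkExp_sq_le hL n).trans ?_⟩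
  have : (1 : ℝ) ≤ n := by exact_mod_cast hn
  nlinarith [sq_nonneg (u 1), sq_nonneg L]

theorem LipHarmonic.exists_pow_four_bound {u : G → ℝ} (hu : LipHarmonic σ u) :
    ∃ M, 0 ≤ M ∧ ∀ n : ℕ, 1 ≤ n → walkExp σ n (fun x => (u x ^ 2) ^ 2) ≤ M * n ^ 2 := by
  obtain ⟨L, hL⟩ := hu.lipschitz
  refine ⟨u 1 ^ 4 + (8 * L ^ 2 * (u 1 ^ 2 + L ^ 2) + 3 * L ^ 4), by positivity, fun n hn => ?_⟩
  have h := hu.harmonic.walkExp_pow_four_le hL n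
  have h1 : (1 : ℝ) ≤ n := by exact_mod_cast hn
  have h2 : ∀ x, (u x ^ 2) ^ 2 = u x ^ 4 := fun x => by ring
  simp only [h2]
  refine h.trans ?_
  have h3 : (1 : ℝ) ≤ n ^ 2 := one_le_pow₀ h1
  have h4 : (n : ℝ) ≤ n ^ 2 := by nlinarith
  have e1 : u 1 ^ 4 ≤ u 1 ^ 4 * n ^ 2 := le_mul_of_one_le_right (by positivity) h3
  have e2 : n * (8 * L ^ 2 * u 1 ^ 2 + 3 * L ^ 4) ≤ n ^ 2 * (8 * L ^ 2 * u 1 ^ 2 + 3 * L ^ 4) :=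
    mul_le_mul_of_nonneg_right h4 (by positivity)
  nlinarith

/-- A sequence of times along which the laws of the walk are asymptotically invariant. -/
structure GoodTimes (σ : ι → G) (C : ℝ) (t : ℕ → ℕ) : Prop where
  pos : 0 < C
  one_le : ∀ k, 1 ≤ t k
  le_self : ∀ k, k ≤ t k
  approx : ∀ k i, ∀ v : G → ℝ,
    (walkExp σ (t k) (fun x => v (σ i * x)) - walkExp σ (t k + 1) v) ^ 2 ≤
      C / t k * (walkExp σ (t k) (fun x => v (σ i * x) ^ 2) +
        walkExp σ (t k + 1) (fun x => v x ^ 2))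

theorem PolyGrowth.exists_goodTimes {d : ℕ} (hG : PolyGrowth d G) (σ : ι → G) :
    ∃ C t, GoodTimes σ C t := by
  obtain ⟨C, hC, h⟩ := hG.exists_good_times σ
  choose t ht using h
  exact ⟨C, t, hC, fun k => (ht k).2.1, fun k => (ht k).1, fun k => (ht k).2.2⟩

/-- The asymptotic covariance of two functions along a sequence of times. -/
noncomputable def asympCov (σ : ι → G) (t : ℕ → ℕ) (u v : G → ℝ) : ℝ :=
  ultraLim fun k => walkExp σ (t k) (fun x => u x * v x) / t k

variable {C : ℝ} {t : ℕ → ℕ} {u v w : G → ℝ}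

theorem GoodTimes.tendsto_asympCov (ht : GoodTimes σ C t) (hu : LipHarmonic σ u)
    (hv : LipHarmonic σ v) :
    Tendsto (fun k => walkExp σ (t k) (fun x => u x * v x) / t k) (hyperfilter ℕ)
      (𝓝 (asympCov σ t u v)) := by
  obtain ⟨M, hM0, hM⟩ := hu.exists_sq_bound
  obtain ⟨N, hN0, hN⟩ := hv.exists_sq_bound
  refine tendsto_ultraLim (M := M + N) fun k => ?_
  have hk : (0 : ℝ) < t k := by exact_mod_cast ht.one_le k
  have h1 := hM _ (ht.one_le k)
  have h2 := hN _ (ht.one_le k)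
  have h0 : 0 ≤ walkExp σ (t k) (fun x => u x ^ 2) := walkExp_nonneg _ fun x => sq_nonneg _
  have h0' : 0 ≤ walkExp σ (t k) (fun x => v x ^ 2) := walkExp_nonneg _ fun x => sq_nonneg _
  have h3 : walkExp σ (t k) (fun x => u x * v x) ≤
      walkExp σ (t k) (fun x => u x ^ 2) + walkExp σ (t k) (fun x => v x ^ 2) := by
    rw [← walkExp_add]
    exact walkExp_mono _ fun x => by nlinarith [sq_nonneg (u x - v x), sq_nonneg (u x + v x)]
  have h4 : -1 * walkExp σ (t k) (fun x => u x * v x) ≤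
      walkExp σ (t k) (fun x => u x ^ 2) + walkExp σ (t k) (fun x => v x ^ 2) := by
    rw [← walkExp_add, ← walkExp_const_mul]
    exact walkExp_mono _ fun x => by nlinarith [sq_nonneg (u x - v x), sq_nonneg (u x + v x)]
  rw [abs_div, abs_of_pos hk, div_le_iff₀ hk, abs_le]
  constructor <;> linarith

theorem asympCov_comm (u v : G → ℝ) : asympCov σ t u v = asympCov σ t v u := by
  simp only [asympCov, mul_comm]

theorem GoodTimes.asympCov_self_nonneg (ht : GoodTimes σ C t) (hu : LipHarmonic σ u) :
    0 ≤ asympCov σ t u u :=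
  ge_of_tendsto' (ht.tendsto_asympCov hu hu) fun k =>
    div_nonneg (walkExp_nonneg _ fun x => mul_self_nonneg _) (Nat.cast_nonneg _)

theorem GoodTimes.asympCov_add_left (ht : GoodTimes σ C t) (hu : LipHarmonic σ u)
    (hv : LipHarmonic σ v) (hw : LipHarmonic σ w) :
    asympCov σ t (fun x => u x + v x) w = asympCov σ t u w + asympCov σ t v w := by
  refine tendsto_nhds_unique (ht.tendsto_asympCov (hu.add hv) hw)
    (((ht.tendsto_asympCov hu hw).add (ht.tendsto_asympCov hv hw)).congr fun k => ?_)
  rw [← add_div, ← walkExp_add]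
  simp only [add_mul]

theorem GoodTimes.asympCov_const_mul_left (ht : GoodTimes σ C t) (hu : LipHarmonic σ u)
    (hv : LipHarmonic σ v) (c : ℝ) :
    asympCov σ t (fun x => c * u x) v = c * asympCov σ t u v := by
  refine tendsto_nhds_unique (ht.tendsto_asympCov (hu.const_mul c) hv)
    (((ht.tendsto_asympCov hu hv).const_mul c).congr fun k => ?_)
  rw [← mul_div_assoc, ← walkExp_const_mul]
  simp only [mul_assoc]

theorem GoodTimes.tendsto_inv (ht : GoodTimes σ C t) (c : ℝ) :
    Tendsto (fun k => c / (t k : ℝ)) (hyperfilter ℕ) (𝓝 0) := by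
  have h1 : Tendsto (fun k => (t k : ℝ)) atTop atTop :=
    tendsto_natCast_atTop_atTop.comp (tendsto_atTop_mono ht.le_self tendsto_id)
  have h2 := h1.const_div_atTop c
  exact h2.mono_left (Nat.cofinite_eq_atTop ▸ hyperfilter_le_cofinite)

theorem GoodTimes.asympCov_const (ht : GoodTimes σ C t) (hu : LipHarmonic σ u) (c : ℝ) :
    asympCov σ t (fun _ => c) u = 0 := by
  refine tendsto_nhds_unique (ht.tendsto_asympCov (LipHarmonic.const c) hu)
    ((ht.tendsto_inv (c * u 1)).congr fun k => ?_)
  rw [walkExp_const_mul, hu.harmonic.walkExp_eq]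

theorem GoodTimes.tendsto_asympCov_succ (ht : GoodTimes σ C t) (hu : LipHarmonic σ u) :
    Tendsto (fun k => walkExp σ (t k + 1) (fun x => u x ^ 2) / t k) (hyperfilter ℕ)
      (𝓝 (asympCov σ t u u)) := by
  obtain ⟨L, hL⟩ := hu.lipschitz
  have h := ht.tendsto_asympCov hu hu
  simp only [← sq] at h
  have h' := h.add (ht.tendsto_inv (L ^ 2))
  rw [add_zero] at h'
  refine tendsto_of_tendsto_of_tendsto_of_le_of_le h h' (fun k => ?_) (fun k => ?_)
  · exact div_le_div_of_nonneg_right (hu.harmonic.walkExp_sq_mono _) (Nat.cast_nonneg _)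
  · simp only [← add_div]
    exact div_le_div_of_nonneg_right (hu.harmonic.walkExp_succ_sq_le hL _) (Nat.cast_nonneg _)

theorem GoodTimes.asympCov_translate_step (ht : GoodTimes σ C t) (hu : LipHarmonic σ u) (i : ι) :
    asympCov σ t (fun x => u (σ i * x)) (fun x => u (σ i * x)) = asympCov σ t u u := by
  have hu' := hu.translate (σ i)
  obtain ⟨M, hM0, hM⟩ := hu.exists_pow_four_bound
  obtain ⟨N, hN0, hN⟩ := hu'.exists_pow_four_bound
  have h1 := ht.tendsto_asympCov hu' hu'
  simp only [← sq] at h1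
  have h2 := (h1.sub (ht.tendsto_asympCov_succ hu)).pow 2
  have h3 : ∀ k, (walkExp σ (t k) (fun x => u (σ i * x) ^ 2) / t k -
      walkExp σ (t k + 1) (fun x => u x ^ 2) / t k) ^ 2 ≤ C * (N + 4 * M) / t k := by
    intro k
    have hk : (0 : ℝ) < t k := by exact_mod_cast ht.one_le k
    have hk1 : (1 : ℝ) ≤ t k := by exact_mod_cast ht.one_le k
    have h4 := ht.approx k i fun x => u x ^ 2
    have h5 := hN _ (ht.one_le k)
    have h6 := hM (t k + 1) (by omega)
    have h7 : M * ((t k + 1 : ℕ) : ℝ) ^ 2 ≤ 4 * M * (t k : ℝ) ^ 2 := by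
      push_cast
      have : ((t k : ℝ) + 1) ^ 2 ≤ 4 * (t k : ℝ) ^ 2 := by nlinarith
      nlinarith
    rw [← sub_div, div_pow, div_le_div_iff₀ (by positivity) hk]
    have h8 : C / t k * (walkExp σ (t k) (fun x => (u (σ i * x) ^ 2) ^ 2) +
        walkExp σ (t k + 1) (fun x => (u x ^ 2) ^ 2)) ≤ C / t k * ((N + 4 * M) * (t k : ℝ) ^ 2) :=
      mul_le_mul_of_nonneg_left (by linarith) (div_nonneg ht.pos.le hk.le)
    have h9 : C / t k * ((N + 4 * M) * (t k : ℝ) ^ 2) = C * (N + 4 * M) * t k := by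
      field_simp
    calc _ ≤ (C * (N + 4 * M) * t k) * t k :=
          mul_le_mul_of_nonneg_right ((h4.trans h8).trans_eq h9) hk.le
      _ = _ := by ring
  have h4 := le_of_tendsto_of_tendsto' h2 (ht.tendsto_inv (C * (N + 4 * M))) h3
  have h5 := pow_eq_zero_iff (two_ne_zero) |>.1 (le_antisymm h4 (sq_nonneg _))
  linarith

theorem GoodTimes.asympCov_translate (ht : GoodTimes σ C t)
    (hgen : ∀ g, ∃ n, g ∈ Set.range σ ^ n) (hu : LipHarmonic σ u) (g : G) :
    asympCov σ t (fun x => u (g * x)) (fun x => u (g * x)) = asympCov σ t u u := by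
  obtain ⟨n, hn⟩ := hgen g
  induction n generalizing g with
  | zero =>
    rw [pow_zero, Set.mem_one] at hn
    simp [hn]
  | succ n ih =>
    rw [pow_succ, Set.mem_mul] at hn
    obtain ⟨a, ha, b, ⟨i, rfl⟩, rfl⟩ := hn
    rw [← ih a ha, ← ht.asympCov_translate_step (hu.translate a) i]
    simp only [mul_assoc]

theorem GoodTimes.sq_sub_le (ht : GoodTimes σ C t)
    (hgen : ∀ g, ∃ n, g ∈ Set.range σ ^ n) (hu : LipHarmonic σ u) (g : G) (i : ι) :
    (u (g * σ i) - u g) ^ 2 ≤ 2 * C * asympCov σ t u u := by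
  have hv := hu.translate g
  have hv' := hv.translate (σ i)
  have h1 := ht.tendsto_asympCov hv' hv'
  simp only [← sq] at h1
  have h2 := (h1.add (ht.tendsto_asympCov_succ hv)).const_mul C
  rw [ht.asympCov_translate_step hv, ht.asympCov_translate hgen hu] at h2
  have h3 : ∀ k, (u (g * σ i) - u g) ^ 2 ≤ C * (walkExp σ (t k) (fun x => u (g * (σ i * x)) ^ 2) /
      t k + walkExp σ (t k + 1) (fun x => u (g * x) ^ 2) / t k) := by
    intro k
    have h4 := ht.approx k i fun x => u (g * x)
    rw [hv.harmonic.walkExp_eq, hv'.harmonic.walkExp_eq, mul_one, mul_one] at h4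
    refine h4.trans_eq ?_
    ring
  have h4 := ge_of_tendsto' h2 h3
  linarith

end LipschitzHarmonic

section HarmonicRepresentation

open scoped Topology Pointwise ComplexConjugate

theorem finiteDimensional_of_orthonormal_card_le {E : Type*} [NormedAddCommGroup E]
    [InnerProductSpace ℂ E] (N : ℕ)
    (h : ∀ n : ℕ, ∀ e : Fin n → E, Orthonormal ℂ e → n ≤ N) : FiniteDimensional ℂ E := by
  have h1 : Module.rank ℂ E ≤ N := by
    refine rank_le fun s hs => ?_
    have hfin : FiniteDimensional ℂ (Submodule.span ℂ (s : Set E)) :=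
      FiniteDimensional.span_finset ℂ s
    have h2 : Module.finrank ℂ (Submodule.span ℂ (s : Set E)) = s.card :=
      finrank_span_finset_eq_card hs
    have b := stdOrthonormalBasis ℂ (Submodule.span ℂ (s : Set E))
    have h3 := h _ _ (b.orthonormal.comp_linearIsometry (Submodule.span ℂ (s : Set E)).subtypeₗᵢ)
    omega
  exact Module.rank_lt_aleph0_iff.1 (h1.trans_lt (Cardinal.natCast_lt_aleph0))

theorem Orthonormal.sum_norm_sq_le {E κ : Type*} [NormedAddCommGroup E] [InnerProductSpace ℂ E]
    [Fintype κ] {e : κ → E} (he : Orthonormal ℂ e) (φ : E →ₗ[ℂ] ℂ) {K : ℝ} (hK : 0 ≤ K)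
    (hφ : ∀ v, ‖φ v‖ ^ 2 ≤ K * ‖v‖ ^ 2) : ∑ j, ‖φ (e j)‖ ^ 2 ≤ K := by
  set s := ∑ j, ‖φ (e j)‖ ^ 2 with hs
  have hs0 : 0 ≤ s := Finset.sum_nonneg fun _ _ => sq_nonneg _
  set v := ∑ j, conj (φ (e j)) • e j with hv
  have h1 : φ v = (s : ℂ) := by
    rw [hv, map_sum, hs]
    push_cast
    refine Finset.sum_congr rfl fun j _ => ?_
    rw [map_smul, smul_eq_mul, Complex.conj_mul']
  have h2 : ‖v‖ ^ 2 = s := by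
    have h3 : inner ℂ v v = (s : ℂ) := by
      rw [hv, he.inner_sum, hs]
      push_cast
      refine Finset.sum_congr rfl fun j _ => ?_
      rw [Complex.conj_conj, Complex.mul_conj']
    rw [← inner_self_eq_norm_sq (𝕜 := ℂ), h3]
    exact Complex.ofReal_re s
  have h3 := hφ v
  rw [h1, h2, Complex.norm_real, Real.norm_eq_abs, sq_abs] at h3
  by_contra hlt
  push Not at hlt
  have hs1 : 0 < s := hK.trans_lt hlt
  nlinarith

variable {G ι : Type*} [Group G] [Fintype ι] [Nonempty ι] {σ : ι → G} {C : ℝ} {t : ℕ → ℕ}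

theorem GoodTimes.sum_asympCov_le {κ : Type*} [Fintype κ] (ht : GoodTimes σ C t)
    {u : κ → G → ℝ} (hu : ∀ j, LipHarmonic σ (u j)) {K : ℝ}
    (hK : ∀ x i, ∑ j, (u j (x * σ i) - u j x) ^ 2 ≤ K) : ∑ j, asympCov σ t (u j) (u j) ≤ K := by
  have h1 : ∀ n : ℕ, ∑ j, walkExp σ n (fun x => u j x ^ 2) ≤ ∑ j, u j 1 ^ 2 + n * K := by
    intro n
    induction n with
    | zero => simp [walkExp_zero]
    | succ n ih =>
      simp only [fun j => (hu j).harmonic.walkExp_succ_sq n]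
      rw [Finset.sum_add_distrib,
        ← walkExp_sum n Finset.univ fun j x => stepAvg ι fun i => (u j (x * σ i) - u j x) ^ 2]
      have h2 : walkExp σ n (fun x => ∑ j, stepAvg ι fun i => (u j (x * σ i) - u j x) ^ 2) ≤ K := by
        rw [← walkExp_const (σ := σ) n K]
        refine walkExp_mono n fun x => ?_
        rw [← stepAvg_const (ι := ι) K]
        simp only [stepAvg]
        rw [← Finset.mul_sum, Finset.sum_comm]
        exact stepAvg_mono fun i => hK x i
      push_cast
      linarith
  have h2 := tendsto_finsetSum Finset.univ fun j _ => ht.tendsto_asympCov (hu j) (hu j)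
  have h3 := (ht.tendsto_inv (∑ j, u j 1 ^ 2)).add_const K
  rw [zero_add] at h3
  refine le_of_tendsto_of_tendsto' h2 h3 fun k => ?_
  have hk : (0 : ℝ) < t k := by exact_mod_cast ht.one_le k
  rw [← Finset.sum_div, div_add' _ _ _ hk.ne']
  refine div_le_div_of_nonneg_right ?_ hk.le
  simp only [← sq]
  linarith [h1 (t k)]

/-- Complex-valued harmonic functions with bounded increments vanishing at `1`. -/
def harmonicSpace (σ : ι → G) : Submodule ℂ (G → ℂ) where
  carrier := {u | u 1 = 0 ∧ LipHarmonic σ (fun x => (u x).re) ∧ LipHarmonic σ (fun x => (u x).im)}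
  zero_mem' := ⟨rfl, LipHarmonic.const 0, LipHarmonic.const 0⟩
  add_mem' := by
    rintro u v ⟨h1, h2, h3⟩ ⟨h4, h5, h6⟩
    exact ⟨by simp [h1, h4], h2.add h5, h3.add h6⟩
  smul_mem' := by
    rintro c u ⟨h1, h2, h3⟩
    refine ⟨by simp [h1], ?_, ?_⟩
    · simpa [sub_eq_add_neg] using (h2.const_mul c.re).add (h3.const_mul (-c.im))
    · simpa using (h3.const_mul c.re).add (h2.const_mul c.im)

theorem GoodTimes.asympCov_lin_left (ht : GoodTimes σ C t) {u v w : G → ℝ} (hu : LipHarmonic σ u)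
    (hv : LipHarmonic σ v) (hw : LipHarmonic σ w) (r s : ℝ) :
    asympCov σ t (fun x => r * u x + s * v x) w = r * asympCov σ t u w + s * asympCov σ t v w := by
  rw [ht.asympCov_add_left (hu.const_mul r) (hv.const_mul s) hw, ht.asympCov_const_mul_left hu hw,
    ht.asympCov_const_mul_left hv hw]

theorem GoodTimes.eq_const_of_asympCov_eq_zero (ht : GoodTimes σ C t)
    (hgen : ∀ g, ∃ n, g ∈ Set.range σ ^ n) {u : G → ℝ} (hu : LipHarmonic σ u)
    (h : asympCov σ t u u = 0) (g : G) : u g = u 1 := by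
  obtain ⟨n, hn⟩ := hgen g
  induction n generalizing g with
  | zero =>
    rw [pow_zero, Set.mem_one] at hn
    rw [hn]
  | succ n ih =>
    rw [pow_succ, Set.mem_mul] at hn
    obtain ⟨a, ha, b, ⟨i, rfl⟩, rfl⟩ := hn
    have h1 := ht.sq_sub_le hgen hu a i
    rw [h, mul_zero] at h1
    have h2 := pow_eq_zero_iff (two_ne_zero) |>.1 (le_antisymm h1 (sq_nonneg _))
    rw [← ih a ha]
    linarith

/-- The inner product on the space of harmonic functions given by the asymptotic covariance. -/
@[reducible] noncomputable def GoodTimes.core (ht : GoodTimes σ C t)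
    (hgen : ∀ g, ∃ n, g ∈ Set.range σ ^ n) : InnerProductSpace.Core ℂ (harmonicSpace σ) where
  inner u v := ⟨asympCov σ t (fun x => (u.1 x).re) (fun x => (v.1 x).re) +
      asympCov σ t (fun x => (u.1 x).im) (fun x => (v.1 x).im),
    asympCov σ t (fun x => (u.1 x).re) (fun x => (v.1 x).im) -
      asympCov σ t (fun x => (u.1 x).im) (fun x => (v.1 x).re)⟩
  conj_inner_symm u v := by
    apply Complex.ext
    · simp [asympCov_comm (fun x => (v.1 x).re), asympCov_comm (fun x => (v.1 x).im)]
    · simp [asympCov_comm (fun x => (v.1 x).re), asympCov_comm (fun x => (v.1 x).im)]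
  re_inner_nonneg u :=
    add_nonneg (ht.asympCov_self_nonneg u.2.2.1) (ht.asympCov_self_nonneg u.2.2.2)
  add_left u v w := by
    have h1 := fun z hz => ht.asympCov_add_left (w := z) u.2.2.1 v.2.2.1 hz
    have h2 := fun z hz => ht.asympCov_add_left (w := z) u.2.2.2 v.2.2.2 hz
    apply Complex.ext
    · simp only [Submodule.coe_add, Pi.add_apply, Complex.add_re, Complex.add_im]
      rw [h1 _ w.2.2.1, h2 _ w.2.2.2]; ring
    · simp only [Submodule.coe_add, Pi.add_apply, Complex.add_re, Complex.add_im]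
      rw [h1 _ w.2.2.2, h2 _ w.2.2.1]; ring
  smul_left u w r := by
    have h1 := fun z hz => ht.asympCov_lin_left (w := z) u.2.2.1 u.2.2.2 hz r.re (-r.im)
    have h2 := fun z hz => ht.asympCov_lin_left (w := z) u.2.2.2 u.2.2.1 hz r.re r.im
    apply Complex.ext
    · simp only [Submodule.coe_smul, Pi.smul_apply, smul_eq_mul, Complex.mul_re, Complex.mul_im,
        Complex.conj_re, Complex.conj_im, sub_eq_add_neg, ← neg_mul]
      rw [h1 _ w.2.2.1, h2 _ w.2.2.2]; ring
    · simp only [Submodule.coe_smul, Pi.smul_apply, smul_eq_mul, Complex.mul_re, Complex.mul_im,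
        Complex.conj_re, Complex.conj_im, sub_eq_add_neg, ← neg_mul]
      rw [h1 _ w.2.2.2, h2 _ w.2.2.1]; ring
  definite u hu := by
    have h1 := congrArg Complex.re hu
    have h2 := ht.asympCov_self_nonneg u.2.2.1
    have h3 := ht.asympCov_self_nonneg u.2.2.2
    simp only [Complex.zero_re] at h1
    ext g
    have h4 := ht.eq_const_of_asympCov_eq_zero hgen u.2.2.1 (by linarith) g
    have h5 := ht.eq_const_of_asympCov_eq_zero hgen u.2.2.2 (by linarith) g
    rw [u.2.1] at h4 h5
    exact Complex.ext h4 h5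

/-- The action of the group on harmonic functions normalised at `1`. -/
def harmonicAction (σ : ι → G) (g : G) : harmonicSpace σ →ₗ[ℂ] harmonicSpace σ where
  toFun u := ⟨fun x => u.1 (g⁻¹ * x) - u.1 g⁻¹, by simp,
    by simpa [sub_eq_add_neg] using (u.2.2.1.translate g⁻¹).add (LipHarmonic.const (-(u.1 g⁻¹).re)),
    by simpa [sub_eq_add_neg] using
      (u.2.2.2.translate g⁻¹).add (LipHarmonic.const (-(u.1 g⁻¹).im))⟩
  map_add' u v := by ext x; simp; ring
  map_smul' c u := by ext x; simp; ring

theorem harmonicAction_apply (g : G) (u : harmonicSpace σ) (x : G) :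
    (harmonicAction σ g u).1 x = u.1 (g⁻¹ * x) - u.1 g⁻¹ := rfl

theorem harmonicAction_mul (g h : G) (u : harmonicSpace σ) :
    harmonicAction σ (g * h) u = harmonicAction σ g (harmonicAction σ h u) := by
  ext x; simp [harmonicAction_apply, mul_assoc]

theorem harmonicAction_one (u : harmonicSpace σ) : harmonicAction σ 1 u = u := by
  ext x; simp [harmonicAction_apply, u.2.1]

theorem GoodTimes.asympCov_translate_add_const (ht : GoodTimes σ C t)
    (hgen : ∀ g, ∃ n, g ∈ Set.range σ ^ n) {u : G → ℝ} (hu : LipHarmonic σ u) (g : G) (c : ℝ) :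
    asympCov σ t (fun x => u (g * x) - c) (fun x => u (g * x) - c) = asympCov σ t u u := by
  have h1 := hu.translate g
  have h2 := LipHarmonic.const (σ := σ) (-c)
  have h3 := h1.add h2
  simp only [sub_eq_add_neg]
  rw [ht.asympCov_add_left h1 h2 h3, ht.asympCov_const h3, asympCov_comm,
    ht.asympCov_add_left h1 h2 h1, ht.asympCov_const h1, ht.asympCov_translate hgen hu]
  ring

theorem PolyGrowth.exists_unitary_rep.{u} {G : Type u} [Group G] {d : ℕ} (hG : PolyGrowth d G) (σ : ι → G)
    (hgen : ∀ g, ∃ n, g ∈ Set.range σ ^ n) :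
    ∃ (E : Type u) (_ : NormedAddCommGroup E) (_ : InnerProductSpace ℂ E)
      (_ : FiniteDimensional ℂ E) (ρ : G →* (E ≃ₗᵢ[ℂ] E)),
      ∀ u : G → ℝ, LipHarmonic σ u → ∀ g, ρ g = 1 → ∀ x, u (g⁻¹ * x) - u g⁻¹ = u x - u 1 := by
  obtain ⟨C, t, ht⟩ := hG.exists_goodTimes σ
  letI core := ht.core hgen
  letI : NormedAddCommGroup (harmonicSpace σ) := core.toNormedAddCommGroup
  letI : InnerProductSpace ℂ (harmonicSpace σ) := InnerProductSpace.ofCore core.toCore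
  have hnorm : ∀ u : harmonicSpace σ, ‖u‖ ^ 2 =
      asympCov σ t (fun x => (u.1 x).re) (fun x => (u.1 x).re) +
      asympCov σ t (fun x => (u.1 x).im) (fun x => (u.1 x).im) := by
    intro u
    rw [← inner_self_eq_norm_sq (𝕜 := ℂ)]
    rfl
  have hisom : ∀ g (u : harmonicSpace σ), ‖harmonicAction σ g u‖ = ‖u‖ := by
    intro g u
    rw [← sq_eq_sq₀ (norm_nonneg _) (norm_nonneg _), hnorm, hnorm]
    simp only [harmonicAction_apply, Complex.sub_re, Complex.sub_im]
    rw [ht.asympCov_translate_add_const hgen u.2.2.1 g⁻¹,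
      ht.asympCov_translate_add_const hgen u.2.2.2 g⁻¹]
  have hfd : FiniteDimensional ℂ (harmonicSpace σ) := by
    refine finiteDimensional_of_orthonormal_card_le ⌈2 * C⌉₊ fun n e he => ?_
    have hev : ∀ x i, ∑ j, ((((e j).1 (x * σ i)).re - ((e j).1 x).re) ^ 2 +
        (((e j).1 (x * σ i)).im - ((e j).1 x).im) ^ 2) ≤ 2 * C := by
      intro x i
      let φ : harmonicSpace σ →ₗ[ℂ] ℂ := (LinearMap.proj (R := ℂ) (φ := fun _ : G => ℂ) (x * σ i) -
        LinearMap.proj (R := ℂ) (φ := fun _ : G => ℂ) x).comp (harmonicSpace σ).subtype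
      have hφ : ∀ u : harmonicSpace σ, ‖φ u‖ ^ 2 =
          ((u.1 (x * σ i)).re - (u.1 x).re) ^ 2 + ((u.1 (x * σ i)).im - (u.1 x).im) ^ 2 := by
        intro u
        have : φ u = u.1 (x * σ i) - u.1 x := rfl
        rw [this, ← Complex.normSq_eq_norm_sq, Complex.normSq_apply]
        simp only [Complex.sub_re, Complex.sub_im]; ring
      have h1 := he.sum_norm_sq_le φ (K := 2 * C) (by have := ht.pos; positivity) fun u => by
        rw [hφ, hnorm, mul_add]
        exact add_le_add (ht.sq_sub_le hgen u.2.2.1 x i) (ht.sq_sub_le hgen u.2.2.2 x i)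
      simpa only [hφ] using h1
    have h1 := ht.sum_asympCov_le (κ := Fin n ⊕ Fin n)
      (u := Sum.elim (fun j x => ((e j).1 x).re) (fun j x => ((e j).1 x).im))
      (by rintro (j | j); exacts [(e j).2.2.1, (e j).2.2.2]) (K := 2 * C)
      (fun x i => by
        rw [Fintype.sum_sum_type, ← Finset.sum_add_distrib]
        exact hev x i)
    rw [Fintype.sum_sum_type, ← Finset.sum_add_distrib] at h1
    simp only [Sum.elim_inl, Sum.elim_inr, ← hnorm, he.1] at h1
    have h2 : (n : ℝ) ≤ 2 * C := by simpa using h1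
    exact Nat.cast_le.1 (h2.trans (Nat.le_ceil _))
  refine ⟨harmonicSpace σ, inferInstance, inferInstance, hfd,
    { toFun := fun g =>
        { toLinearEquiv := LinearEquiv.ofLinearMap (harmonicAction σ g) (harmonicAction σ g⁻¹)
            (by ext1 u; simp [← harmonicAction_mul, harmonicAction_one])
            (by ext1 u; simp [← harmonicAction_mul, harmonicAction_one])
          norm_map' := hisom g }
      map_one' := LinearIsometryEquiv.ext fun u => harmonicAction_one u
      map_mul' := fun g h => LinearIsometryEquiv.ext fun u => harmonicAction_mul g h u },
    fun u hu g hg x => ?_⟩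
  let u' : harmonicSpace σ := ⟨fun x => ((u x - u 1 : ℝ) : ℂ), by simp,
    by simpa [sub_eq_add_neg] using hu.add (LipHarmonic.const (-(u 1))),
    by simpa using LipHarmonic.const 0⟩
  have h1 : harmonicAction σ g u' = u' := congrArg (fun f => f u') hg
  have h2 : ((u (g⁻¹ * x) - u 1 : ℝ) : ℂ) - ((u g⁻¹ - u 1 : ℝ) : ℂ) = ((u x - u 1 : ℝ) : ℂ) :=
    congrFun (congrArg Subtype.val h1) x
  have h3 : (u (g⁻¹ * x) - u 1) - (u g⁻¹ - u 1) = u x - u 1 := by exact_mod_cast h2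
  linarith

end HarmonicRepresentation

section Jordan

open scoped Topology Pointwise

theorem Subgroup.exists_finite_subset_of_mem_closure {G : Type*} [Group G] {A : Set G} {g : G}
    (hg : g ∈ Subgroup.closure A) : ∃ T ⊆ A, T.Finite ∧ g ∈ Subgroup.closure T := by
  induction hg using Subgroup.closure_induction with
  | mem x hx =>
    exact ⟨{x}, Set.singleton_subset_iff.2 hx, Set.finite_singleton x,
      Subgroup.subset_closure rfl⟩
  | one => exact ⟨∅, Set.empty_subset _, Set.finite_empty, one_mem _⟩
  | mul x y _ _ hx hy =>
    obtain ⟨T, hTA, hT, hx⟩ := hx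
    obtain ⟨T', hTA', hT', hy⟩ := hy
    exact ⟨T ∪ T', Set.union_subset hTA hTA', hT.union hT',
      mul_mem (Subgroup.closure_mono Set.subset_union_left hx)
        (Subgroup.closure_mono Set.subset_union_right hy)⟩
  | inv x _ hx =>
    obtain ⟨T, hTA, hT, hx⟩ := hx
    exact ⟨T, hTA, hT, inv_mem hx⟩

theorem Subgroup.FG.exists_finite_subset_closure_eq {G : Type*} [Group G] {A : Set G}
    (h : (Subgroup.closure A).FG) :
    ∃ T ⊆ A, T.Finite ∧ Subgroup.closure T = Subgroup.closure A := by
  obtain ⟨S, hS⟩ := h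
  have h1 : ∀ s : S, ∃ T ⊆ A, T.Finite ∧ (s : G) ∈ Subgroup.closure T := fun s =>
    Subgroup.exists_finite_subset_of_mem_closure (hS ▸ Subgroup.subset_closure s.2)
  choose T hTA hT hs using h1
  refine ⟨⋃ s, T s, Set.iUnion_subset hTA, Set.finite_iUnion hT, le_antisymm
    (Subgroup.closure_mono (Set.iUnion_subset hTA)) ?_⟩
  rw [← hS, Subgroup.closure_le]
  exact fun s hs' => Subgroup.closure_mono (Set.subset_iUnion T ⟨s, hs'⟩) (hs ⟨s, hs'⟩)

variable {G : Type*} [Group G]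

theorem prod_ofFn_mem_pow {T : Set G} (h1 : 1 ∈ T) {γ : ℕ → G} (hγ : ∀ n, γ n ∈ T ^ 4 ^ n)
    {M : ℕ} (m : ℕ) (e : Fin m → Fin M) :
    (List.ofFn fun i : Fin m => γ i ^ (e i : ℕ)).prod ∈ T ^ (M * 4 ^ m) := by
  induction m with
  | zero => simpa using Set.pow_mono_of_one_mem h1 (Nat.zero_le M) (by simp : (1 : G) ∈ T ^ 0)
  | succ m ih =>
    rw [List.ofFn_succ', List.concat_eq_append, List.prod_append, List.prod_singleton]
    have h2 := ih fun i => e i.castSucc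
    have h3 : γ m ^ (e (Fin.last m) : ℕ) ∈ T ^ (M * 4 ^ m) := by
      have h4 := Set.pow_mem_pow (n := (e (Fin.last m) : ℕ)) (hγ m)
      rw [← pow_mul] at h4
      refine Set.pow_mono_of_one_mem h1 ?_ h4
      rw [mul_comm]
      exact Nat.mul_le_mul_right _ (e _).2.le
    have h5 := Set.mul_mem_mul h2 h3
    rw [← pow_add] at h5
    exact Set.pow_mono_of_one_mem h1 (by rw [pow_succ, ← mul_assoc]; omega) h5

/-- A group of polynomial growth has no sequence of short elements converging exponentially fast
to the identity with respect to an invariant norm. -/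
theorem PolyGrowth.not_exponentially_small {d : ℕ} (hG : PolyGrowth d G) {T : Set G}
    (hT : T.Finite) (h1 : 1 ∈ T) {δ : G → ℝ} (hδ1 : δ 1 = 0) (hmul : ∀ a b, δ (a * b) ≤ δ a + δ b)
    (hinv : ∀ a, δ a⁻¹ = δ a)
    (hpow : ∀ a, ∀ k : ℕ, 1 ≤ k → k * δ a ≤ 1 / 2 → δ a / 2 ≤ δ (a ^ k))
    {M : ℕ} (hM : M = 4 ^ d + 1) {η : ℝ} (hη : 16 * M * η < 1) (hη0 : 0 ≤ η)
    {γ : ℕ → G} (hγ : ∀ n, γ n ∈ T ^ 4 ^ n) (hpos : ∀ n, 0 < δ (γ n))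
    (hsmall : ∀ n, M * δ (γ n) ≤ 1 / 2)
    (hstep : ∀ n, δ (γ (n + 1)) ≤ η * δ (γ n)) : False := by
  have hM1 : (1 : ℝ) ≤ M := by rw [hM]; push_cast; linarith [pow_pos (four_pos (α := ℝ)) d]
  have hδ0 : ∀ a, 0 ≤ δ a := fun a => by
    have := hmul a a⁻¹
    rw [mul_inv_cancel, hδ1, hinv] at this
    linarith
  have hpow' : ∀ a, ∀ k : ℕ, δ (a ^ k) ≤ k * δ a := by
    intro a k
    induction k with
    | zero => simp [hδ1]
    | succ k ih =>
      rw [pow_succ]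
      push_cast
      linarith [hmul (a ^ k) a]
  have hη2 : η ≤ 1 / 16 := by nlinarith
  have hbound : ∀ m, ∀ a : ℕ, ∀ e : Fin m → Fin M,
      δ (List.ofFn fun i : Fin m => γ (i + a) ^ (e i : ℕ)).prod ≤ 2 * M * δ (γ a) := by
    intro m
    induction m with
    | zero => intro a e; simp only [List.ofFn_zero, List.prod_nil, hδ1]; have := hpos a; positivity
    | succ m ih =>
      intro a e
      rw [List.ofFn_succ, List.prod_cons]
      have h2 := ih (a + 1) fun i => e i.succ
      have h3 : δ (γ a ^ (e 0 : ℕ)) ≤ M * δ (γ a) := (hpow' _ _).trans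
        (mul_le_mul_of_nonneg_right (by exact_mod_cast (e 0).2.le) (hδ0 _))
      have h4 : ∀ i : Fin m, ((i.succ : Fin (m + 1)) : ℕ) + a = i + (a + 1) := fun i => by
        simp; omega
      have h0 : ((0 : Fin (m + 1)) : ℕ) + a = a := by simp
      simp only [h4, h0]
      refine (hmul _ _).trans ?_
      have h5 := mul_le_mul_of_nonneg_left (hstep a) (by positivity : (0 : ℝ) ≤ 2 * M)
      nlinarith [hpos a, mul_pos (lt_of_lt_of_le one_pos hM1) (hpos a)]
  have hinj : ∀ m, ∀ a : ℕ, Function.Injective fun e : Fin m → Fin M =>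
      (List.ofFn fun i : Fin m => γ (i + a) ^ (e i : ℕ)).prod := by
    intro m
    induction m with
    | zero => intro a e e' _; exact Subsingleton.elim _ _
    | succ m ih =>
      have h4 : ∀ (a : ℕ) (i : Fin m), ((i.succ : Fin (m + 1)) : ℕ) + a = i + (a + 1) :=
        fun a i => by simp; omega
      have h0 : ∀ a : ℕ, ((0 : Fin (m + 1)) : ℕ) + a = a := fun a => by simp
      have key : ∀ (a : ℕ) (e e' : Fin (m + 1) → Fin M), (e 0 : ℕ) < e' 0 →
          γ a ^ (e 0 : ℕ) * (List.ofFn fun i : Fin m => γ (i + (a + 1)) ^ (e i.succ : ℕ)).prod =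
          γ a ^ (e' 0 : ℕ) * (List.ofFn fun i : Fin m => γ (i + (a + 1)) ^ (e' i.succ : ℕ)).prod →
          False := by
        intro a e e' hlt heq
        obtain ⟨k, hk⟩ := Nat.exists_eq_add_of_lt hlt
        have hkM : k + 1 ≤ M := by have := (e' 0).2; omega
        have h5 := hbound m (a + 1) fun i => e i.succ
        have h6 := hbound m (a + 1) fun i => e' i.succ
        set p := (List.ofFn fun i : Fin m => γ (i + (a + 1)) ^ (e i.succ : ℕ)).prod
        set p' := (List.ofFn fun i : Fin m => γ (i + (a + 1)) ^ (e' i.succ : ℕ)).prod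
        have h7 : γ a ^ (k + 1) = p * p'⁻¹ := by
          rw [hk, add_assoc, pow_add, mul_assoc] at heq
          rw [mul_left_cancel heq, mul_inv_cancel_right]
        have hkM' : ((k + 1 : ℕ) : ℝ) ≤ M := by exact_mod_cast hkM
        have h8 := hpow (γ a) (k + 1) (by omega)
          ((mul_le_mul_of_nonneg_right hkM' (hδ0 _)).trans (hsmall a))
        rw [h7] at h8
        have h9 := hmul p p'⁻¹
        rw [hinv] at h9
        have h10 := mul_le_mul_of_nonneg_left (hstep a) (by positivity : (0 : ℝ) ≤ 4 * M)
        nlinarith [hpos a]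
      intro a e e' h
      simp only [List.ofFn_succ, List.prod_cons, h4, h0] at h
      rcases lt_trichotomy (e 0 : ℕ) (e' 0) with hlt | heq | hlt
      · exact (key a e e' hlt h).elim
      · rw [heq] at h
        have h5 := ih (a + 1) (mul_left_cancel h)
        funext i
        refine Fin.cases (Fin.ext heq) (fun i => congrFun h5 i) i
      · exact (key a e' e hlt h.symm).elim
  obtain ⟨C, hC⟩ := hG T hT
  have hcard : ∀ m : ℕ, M ^ m ≤ C * (M * 4 ^ m) ^ d := by
    intro m
    have h2 : Set.range (fun e : Fin m → Fin M =>
        (List.ofFn fun i : Fin m => γ i ^ (e i : ℕ)).prod) ⊆ T ^ (M * 4 ^ m) := by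
      rintro _ ⟨e, rfl⟩; exact prod_ofFn_mem_pow h1 hγ m e
    have h3 := Set.ncard_le_ncard h2 (hT.pow_nat _)
    have h4 : Function.Injective (fun e : Fin m → Fin M =>
        (List.ofFn fun i : Fin m => γ i ^ (e i : ℕ)).prod) := hinj m 0
    rw [← Nat.card_coe_set_eq, Nat.card_range_of_injective h4, Nat.card_eq_fintype_card,
      Fintype.card_fun, Fintype.card_fin, Fintype.card_fin] at h3
    refine h3.trans (hC _ (Nat.mul_pos (hM ▸ Nat.succ_pos _) (by positivity)))
  have hlim : Tendsto (fun m : ℕ => (C : ℝ) * M ^ d * (((4 : ℝ) ^ d) / M) ^ m) atTop (𝓝 0) := by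
    have := (tendsto_pow_atTop_nhds_zero_of_lt_one (r := ((4 : ℝ) ^ d) / M) (by positivity) (by
      rw [div_lt_one (by linarith), hM]; push_cast; linarith)).const_mul ((C : ℝ) * M ^ d)
    simpa using this
  obtain ⟨m, hm⟩ := (hlim.eventually_lt_const one_pos).exists
  have h2 : (M : ℝ) ^ m ≤ C * (M * 4 ^ m) ^ d := by exact_mod_cast hcard m
  rw [div_pow, ← mul_div_assoc, div_lt_one (by positivity)] at hm
  have h3 : (C : ℝ) * (M * 4 ^ m) ^ d = C * M ^ d * (4 ^ d) ^ m := by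
    rw [mul_pow, ← pow_mul, ← pow_mul, mul_comm m d]; ring
  linarith

variable {R : Type*} [NormedRing R] [NormedSpace ℂ R] {c : G →* R}

omit [NormedSpace ℂ R] in
theorem norm_map_mul_sub_one_le (hc : ∀ g, ‖c g‖ ≤ 1) (a b : G) :
    ‖c (a * b) - 1‖ ≤ ‖c a - 1‖ + ‖c b - 1‖ := by
  have h : c (a * b) - 1 = (c a - 1) * c b + (c b - 1) := by rw [map_mul]; noncomm_ring
  rw [h]
  refine (norm_add_le _ _).trans (add_le_add ?_ le_rfl)
  exact (norm_mul_le _ _).trans (mul_le_of_le_one_right (norm_nonneg _) (hc b))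

omit [NormedSpace ℂ R] in
theorem norm_map_inv_sub_one (hc : ∀ g, ‖c g‖ ≤ 1) (a : G) : ‖c a⁻¹ - 1‖ = ‖c a - 1‖ := by
  have key : ∀ a : G, ‖c a⁻¹ - 1‖ ≤ ‖c a - 1‖ := by
    intro a
    have h : c a⁻¹ - 1 = -(c a⁻¹ * (c a - 1)) := by
      rw [mul_sub, ← map_mul, inv_mul_cancel, map_one]; noncomm_ring
    rw [h, norm_neg]
    exact (norm_mul_le _ _).trans (mul_le_of_le_one_left (norm_nonneg _) (hc _))
  refine le_antisymm (key a) ?_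
  simpa using key a⁻¹

omit [NormedSpace ℂ R] in
theorem norm_map_commutator_sub_one_le (hc : ∀ g, ‖c g‖ ≤ 1) (a b : G) :
    ‖c (a * b * a⁻¹ * b⁻¹) - 1‖ ≤ 2 * ‖c b - 1‖ * ‖c a - 1‖ := by
  have h0 : c a * c b * c (a⁻¹ * b⁻¹) = c (a * b * a⁻¹ * b⁻¹) := by
    rw [← map_mul, ← map_mul]; congr 1; group
  have h1 : c b * c a * c (a⁻¹ * b⁻¹) = 1 := by
    rw [← map_mul, ← map_mul, ← map_one c]; congr 1; group
  have h : c (a * b * a⁻¹ * b⁻¹) - 1 =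
      ((c a - 1) * (c b - 1) - (c b - 1) * (c a - 1)) * c (a⁻¹ * b⁻¹) := by
    
    rw [show (c a - 1) * (c b - 1) - (c b - 1) * (c a - 1) = c a * c b - c b * c a by
      noncomm_ring, sub_mul, h0, h1]
  rw [h]
  refine (norm_mul_le _ _).trans ((mul_le_of_le_one_right (norm_nonneg _) (hc _)).trans ?_)
  refine (norm_sub_le _ _).trans ((add_le_add (norm_mul_le _ _) (norm_mul_le _ _)).trans_eq ?_)
  ring

theorem norm_map_pow_sub_one_ge (hc : ∀ g, ‖c g‖ ≤ 1) (a : G) (k : ℕ) (hk : 1 ≤ k)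
    (hka : k * ‖c a - 1‖ ≤ 1 / 2) : ‖c a - 1‖ / 2 ≤ ‖c (a ^ k) - 1‖ := by
  have h1 : ∀ j : ℕ, ‖c (a ^ j) - 1‖ ≤ j * ‖c a - 1‖ := by
    intro j
    induction j with
    | zero => simp
    | succ j ih =>
      rw [pow_succ]
      push_cast
      linarith [norm_map_mul_sub_one_le hc (a ^ j) a]
  have h2 : ∀ j : ℕ, ‖(c (a ^ j) - 1) - j * (c a - 1)‖ ≤ j ^ 2 * ‖c a - 1‖ ^ 2 := by
    intro j
    induction j with
    | zero => simp
    | succ j ih =>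
      have h3 : (c (a ^ (j + 1)) - 1) - ((j + 1 : ℕ) : R) * (c a - 1) =
          (c (a ^ j) - 1) * (c a - 1) + ((c (a ^ j) - 1) - j * (c a - 1)) := by
        rw [pow_succ, map_mul]; push_cast; noncomm_ring
      rw [h3]
      refine (norm_add_le _ _).trans ?_
      have h4 := (norm_mul_le (c (a ^ j) - 1) (c a - 1)).trans
        (mul_le_mul_of_nonneg_right (h1 j) (norm_nonneg _))
      push_cast
      nlinarith [norm_nonneg (c a - 1), sq_nonneg ‖c a - 1‖,
        mul_nonneg (Nat.cast_nonneg (α := ℝ) j) (sq_nonneg ‖c a - 1‖)]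
  have h3 : (k : ℝ) * ‖c a - 1‖ ≤ ‖c (a ^ k) - 1‖ + k ^ 2 * ‖c a - 1‖ ^ 2 := by
    have h4 : ‖(k : R) * (c a - 1)‖ = k * ‖c a - 1‖ := by
      rw [← nsmul_eq_mul, RCLike.norm_nsmul ℂ, nsmul_eq_mul]
    rw [← h4]
    have h5 : (k : R) * (c a - 1) =
        (c (a ^ k) - 1) - ((c (a ^ k) - 1) - k * (c a - 1)) := by abel
    rw [h5]
    exact (norm_sub_le _ _).trans (add_le_add le_rfl (h2 k))
  have hk' : (1 : ℝ) ≤ k := by exact_mod_cast hk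
  have h5 : (k : ℝ) ^ 2 * ‖c a - 1‖ ^ 2 ≤ 1 / 2 * (k * ‖c a - 1‖) := by
    have := mul_le_mul_of_nonneg_right hka (by positivity : 0 ≤ k * ‖c a - 1‖)
    nlinarith
  nlinarith [norm_nonneg (c a - 1)]

end Jordan

section UnitaryJordan

open scoped Topology Pointwise

theorem finiteIndex_closure_norm_sub_one_lt {G R : Type*} [Group G] [NormedRing R]
    [ProperSpace R] {c : G →* R} (hc : ∀ g, ‖c g‖ ≤ 1) {ε : ℝ} (hε : 0 < ε) :
    (Subgroup.closure {g | ‖c g - 1‖ < ε}).FiniteIndex := by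
  set H := Subgroup.closure {g | ‖c g - 1‖ < ε} with hH
  have hb : TotallyBounded (Metric.closedBall (0 : R) 1) :=
    (isCompact_closedBall _ _).totallyBounded
  obtain ⟨t, ht, hcov⟩ := Metric.totallyBounded_iff.1 hb (ε / 2) (half_pos hε)
  have h1 : ∀ g, ∃ y : t, dist (c g) y < ε / 2 := by
    intro g
    have h2 := hcov (show c g ∈ Metric.closedBall (0 : R) 1 by simpa using hc g)
    simp only [Set.mem_iUnion, Metric.mem_ball, exists_prop] at h2
    obtain ⟨y, hy, hd⟩ := h2
    exact ⟨⟨y, hy⟩, hd⟩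
  choose f hf using h1
  have hinj : Function.Injective fun q : G ⧸ H => f q.out := by
    intro q q' h
    simp only at h
    have h2 : dist (c q.out) (c q'.out) < ε := by
      have h3 := hf q'.out
      rw [← h] at h3
      linarith [dist_triangle_right (c q.out) (c q'.out) (f q.out : R), hf q.out]
    rw [← q.out_eq', ← q'.out_eq']
    refine QuotientGroup.eq.2 (Subgroup.subset_closure ?_)
    have h3 : c (q.out⁻¹ * q'.out) - 1 = c q.out⁻¹ * (c q'.out - c q.out) := by
      rw [mul_sub, ← map_mul, ← map_mul, inv_mul_cancel, map_one]
    rw [Set.mem_ofPred_eq, h3]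
    refine lt_of_le_of_lt ((norm_mul_le _ _).trans
      (mul_le_of_le_one_left (norm_nonneg _) (hc _))) ?_
    rwa [← dist_eq_norm, dist_comm]
  have : Finite t := ht
  have : Finite (G ⧸ H) := Finite.of_injective _ hinj
  exact Subgroup.finiteIndex_of_finite_quotient

theorem one_le_mul_norm_sub_one {z : ℂ} {N : ℕ} (hN : 1 ≤ N) (hz : z ^ N = 1) (hz1 : z ≠ 1) :
    1 ≤ N * ‖z - 1‖ := by
  have hn : ‖z‖ = 1 := Complex.norm_eq_one_of_pow_eq_one hz (by omega)
  have h1 : ∀ k : ℕ, ‖z ^ k - 1‖ ≤ k * ‖z - 1‖ := by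
    intro k
    induction k with
    | zero => simp
    | succ k ih =>
      have h2 : z ^ (k + 1) - 1 = z ^ k * (z - 1) + (z ^ k - 1) := by ring
      rw [h2]
      refine (norm_add_le _ _).trans ?_
      rw [norm_mul, norm_pow, hn, one_pow]
      push_cast
      linarith
  have h2 : ∑ k ∈ Finset.range N, z ^ k = 0 := by
    have h3 := mul_geom_sum z N
    rw [hz, sub_self] at h3
    exact (mul_eq_zero.1 h3).resolve_left (sub_ne_zero.2 hz1)
  have h3 : ∑ k ∈ Finset.range N, (z ^ k - 1) = -N := by
    rw [Finset.sum_sub_distrib, h2]; simp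
  have h4 : (N : ℝ) ≤ N * (N * ‖z - 1‖) := by
    calc (N : ℝ) = ‖∑ k ∈ Finset.range N, (z ^ k - 1)‖ := by rw [h3, norm_neg]; simp
      _ ≤ ∑ k ∈ Finset.range N, N * ‖z - 1‖ := by
          refine (norm_sum_le _ _).trans (Finset.sum_le_sum fun k hk => (h1 k).trans ?_)
          have : (k : ℝ) ≤ N := by exact_mod_cast (Finset.mem_range.1 hk).le
          gcongr
      _ = _ := by simp
  have hN' : (0 : ℝ) < N := by exact_mod_cast hN
  nlinarith

variable {E : Type*} [NormedAddCommGroup E] [InnerProductSpace ℂ E]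

/-- Linear isometries as continuous linear operators. -/
def LinearIsometryEquiv.toCLMHom (E : Type*) [NormedAddCommGroup E] [InnerProductSpace ℂ E] :
    (E ≃ₗᵢ[ℂ] E) →* (E →L[ℂ] E) where
  toFun f := f.toLinearIsometry.toContinuousLinearMap
  map_one' := rfl
  map_mul' _ _ := rfl

/-- Linear isometries as linear operators. -/
def LinearIsometryEquiv.toEndHom (E : Type*) [NormedAddCommGroup E] [InnerProductSpace ℂ E] :
    (E ≃ₗᵢ[ℂ] E) →* Module.End ℂ E where
  toFun f := f.toLinearEquiv.toLinearMap
  map_one' := rfl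
  map_mul' _ _ := rfl

theorem exists_restrict_rep {G : Type*} [Group G] (ρ : G →* (E ≃ₗᵢ[ℂ] E)) (W : Submodule ℂ E)
    (hW : ∀ g, ∀ w ∈ W, ρ g w ∈ W) :
    ∃ ρ' : G →* (W ≃ₗᵢ[ℂ] W), ∀ g w, (ρ' g w : E) = ρ g w := by
  let r : G → W →ₗ[ℂ] W := fun g => (LinearIsometryEquiv.toEndHom E (ρ g)).restrict (hW g)
  have hr : ∀ g w, (r g w : E) = ρ g w := fun g w => rfl
  have hmul : ∀ g h w, r (g * h) w = r g (r h w) := fun g h w => by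
    ext; simp [hr]
  have hone : ∀ w, r 1 w = w := fun w => by ext; simp [hr]
  refine ⟨{ toFun := fun g =>
              { toLinearEquiv := LinearEquiv.ofLinearMap (r g) (r g⁻¹)
                  (by ext1 u; simp [← hmul, hone])
                  (by ext1 u; simp [← hmul, hone])
                norm_map' := fun w => (ρ g).norm_map w }
            map_one' := LinearIsometryEquiv.ext fun u => hone u
            map_mul' := fun g h => LinearIsometryEquiv.ext fun u => hmul g h u }, hr⟩

/-- The operator is a scalar multiple of the identity. -/
def IsScalarOp (f : E ≃ₗᵢ[ℂ] E) : Prop := ∃ z : ℂ, ∀ v, f v = z • v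

theorem IsScalarOp.eq_one_of_commutator [FiniteDimensional ℂ E] [Nontrivial E]
    {a b : E ≃ₗᵢ[ℂ] E} (h : IsScalarOp (a * b * a⁻¹ * b⁻¹))
    (hd : Module.finrank ℂ E * ‖LinearIsometryEquiv.toCLMHom E (a * b * a⁻¹ * b⁻¹) - 1‖ < 1) :
    a * b * a⁻¹ * b⁻¹ = 1 := by
  obtain ⟨z, hz⟩ := h
  set x := a * b * a⁻¹ * b⁻¹ with hx
  set D : (E ≃ₗᵢ[ℂ] E) →* ℂ := (LinearMap.det (M := E)).comp (LinearIsometryEquiv.toEndHom E)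
  have hD1 : D x = 1 := by
    rw [hx, map_mul, map_mul, map_mul]
    have h1 : D a * D a⁻¹ = 1 := by rw [← map_mul, mul_inv_cancel, map_one]
    have h2 : D b * D b⁻¹ = 1 := by rw [← map_mul, mul_inv_cancel, map_one]
    linear_combination D b * D b⁻¹ * h1 + h2
  have hDz : D x = z ^ Module.finrank ℂ E := by
    have h1 : LinearIsometryEquiv.toEndHom E x = z • LinearMap.id := LinearMap.ext hz
    have h2 : D x = LinearMap.det (LinearIsometryEquiv.toEndHom E x) := rfl
    rw [h2, h1, LinearMap.det_smul, LinearMap.det_id, mul_one]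
  have hn : ‖LinearIsometryEquiv.toCLMHom E x - 1‖ = ‖z - 1‖ := by
    have h1 : LinearIsometryEquiv.toCLMHom E x - 1 = (z - 1) • (1 : E →L[ℂ] E) := by
      ext v
      have : LinearIsometryEquiv.toCLMHom E x v = z • v := hz v
      simp [this, sub_smul]
    rw [h1, norm_smul, norm_one, mul_one]
  rw [hn] at hd
  by_cases hz1 : z = 1
  · refine LinearIsometryEquiv.ext fun v => ?_
    rw [hz, hz1, one_smul]; rfl
  · exact absurd (one_le_mul_norm_sub_one Module.finrank_pos (hDz.symm.trans hD1) hz1)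
      (not_le.2 hd)

end UnitaryJordan

section UnitaryJordan

open scoped Topology Pointwise

theorem commute_of_commute_restrict {E : Type*} [NormedAddCommGroup E] [InnerProductSpace ℂ E]
    [FiniteDimensional ℂ E] (W : Submodule ℂ E) {f g : E ≃ₗᵢ[ℂ] E}
    (h1 : ∀ w ∈ W, f (g w) = g (f w)) (h2 : ∀ w ∈ Wᗮ, f (g w) = g (f w)) : f * g = g * f := by
  refine LinearIsometryEquiv.ext fun v => ?_
  obtain ⟨y, hy, z, hz, rfl⟩ := W.exists_add_mem_mem_orthogonal v
  change f (g (y + z)) = g (f (y + z))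
  rw [map_add, map_add, map_add, map_add, h1 y hy, h2 z hz]

theorem PolyGrowth.exists_finiteIndex_commuting_of_finrank_lt.{u} {d : ℕ} (N : ℕ) :
    ∀ {G : Type u} [Group G], PolyGrowth d G → Group.FG G → ∀ {E : Type u}
      [NormedAddCommGroup E] [InnerProductSpace ℂ E] [FiniteDimensional ℂ E]
      (ρ : G →* (E ≃ₗᵢ[ℂ] E)), Module.finrank ℂ E < N →
      ∃ H : Subgroup G, H.FiniteIndex ∧ ∀ a ∈ H, ∀ b ∈ H, ρ a * ρ b = ρ b * ρ a := by
  induction N with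
  | zero => intro G _ _ _ E _ _ _ ρ h; omega
  | succ N ih =>
  intro G _ hG hfg E _ _ _ ρ hN
  rcases subsingleton_or_nontrivial E with hE | hE
  · exact ⟨⊤, inferInstance, fun a _ b _ => LinearIsometryEquiv.ext fun v => Subsingleton.elim _ _⟩
  obtain ⟨M, hM⟩ : ∃ M, M = 4 ^ d + 1 := ⟨_, rfl⟩
  have hM1 : (1 : ℝ) ≤ M := by rw [hM]; push_cast; linarith [pow_pos (four_pos (α := ℝ)) d]
  have hN0 : (0 : ℝ) ≤ Module.finrank ℂ E := Nat.cast_nonneg _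
  obtain ⟨ε, hε⟩ : ∃ ε : ℝ, ε = 1 / (64 * M * (Module.finrank ℂ E + 1)) := ⟨_, rfl⟩
  have hε0 : 0 < ε := by rw [hε]; positivity
  have hεM : 64 * M * ε ≤ 1 := by
    rw [hε, mul_one_div, div_le_one (by positivity)]
    nlinarith
  have hεN : Module.finrank ℂ E * ε < 1 := by
    rw [hε, mul_one_div, div_lt_one (by positivity)]
    nlinarith
  set c : G →* (E →L[ℂ] E) := (LinearIsometryEquiv.toCLMHom E).comp ρ with hcdef
  have hc : ∀ g, ‖c g‖ ≤ 1 := fun g => (ρ g).toLinearIsometry.norm_toContinuousLinearMap_le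
  have : ProperSpace (E →L[ℂ] E) := FiniteDimensional.proper ℂ _
  have hfi := finiteIndex_closure_norm_sub_one_lt hc hε0
  set A := {g | ‖c g - 1‖ < ε} with hA
  obtain ⟨T, hTA, hT, hTH⟩ := ((Group.fg_iff_subgroup_fg _).1
    (Subgroup.fg_of_index_ne_zero (Subgroup.closure A))).exists_finite_subset_closure_eq
  set H := Subgroup.closure A with hH
  by_cases hsc : ∀ t ∈ T, IsScalarOp (ρ t)
  · have hsc' : ∀ h ∈ H, IsScalarOp (ρ h) := by
      intro h hh
      rw [← hTH] at hh
      induction hh using Subgroup.closure_induction with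
      | mem x hx => exact hsc x hx
      | one => exact ⟨1, fun v => by simp⟩
      | mul x y _ _ hx hy =>
        obtain ⟨z, hz⟩ := hx
        obtain ⟨w, hw⟩ := hy
        exact ⟨z * w, fun v => by
          rw [map_mul]; change ρ x (ρ y v) = _; rw [hw, hz, smul_smul]⟩
      | inv x _ hx =>
        obtain ⟨z, hz⟩ := hx
        refine ⟨z⁻¹, fun v => ?_⟩
        have hz0 : z ≠ 0 := by
          rintro rfl
          obtain ⟨v, hv⟩ := exists_ne (0 : E)
          have h1 := (ρ x).norm_map v
          rw [hz, zero_smul, norm_zero] at h1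
          exact hv (norm_eq_zero.1 h1.symm)
        have h1 : ρ x (ρ x⁻¹ v) = v := by
          change (ρ x * ρ x⁻¹) v = v
          rw [← map_mul, mul_inv_cancel, map_one]; rfl
        rw [hz] at h1
        rw [← h1, smul_smul, inv_mul_cancel₀ hz0, one_smul, h1]
    refine ⟨H, hfi, fun a ha b hb => LinearIsometryEquiv.ext fun v => ?_⟩
    obtain ⟨z, hz⟩ := hsc' a ha
    obtain ⟨w, hw⟩ := hsc' b hb
    change ρ a (ρ b v) = ρ b (ρ a v)
    rw [hw, hz, hz, hw, smul_comm]
  push Not at hsc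
  obtain ⟨t₀, ht₀, hns⟩ := hsc
  by_cases hB : ∃ g ∈ H, ¬ IsScalarOp (ρ g) ∧ ∀ t ∈ T, Commute (ρ g) (ρ t)
  · obtain ⟨g, hg, hgns, hgc⟩ := hB
    have hgH : ∀ h ∈ H, Commute (ρ g) (ρ h) := by
      intro h hh
      rw [← hTH] at hh
      induction hh using Subgroup.closure_induction with
      | mem x hx => exact hgc x hx
      | one => rw [map_one]; exact Commute.one_right _
      | mul x y _ _ hx hy => rw [map_mul]; exact hx.mul_right hy
      | inv x _ hx => rw [map_inv]; exact hx.inv_right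
    obtain ⟨μ, hμ⟩ := Module.End.exists_eigenvalue (LinearIsometryEquiv.toEndHom E (ρ g))
    set W := Module.End.eigenspace (LinearIsometryEquiv.toEndHom E (ρ g)) μ with hWdef
    have hWmem : ∀ v, v ∈ W ↔ ρ g v = μ • v := fun v => Module.End.mem_eigenspace_iff
    have hWbot : W ≠ ⊥ := hμ
    have hWtop : W ≠ ⊤ := by
      intro h
      exact hgns ⟨μ, fun v => (hWmem v).1 (h ▸ Submodule.mem_top)⟩
    have hWinv : ∀ h : H, ∀ w ∈ W, ρ h w ∈ W := by
      intro h w hw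
      rw [hWmem] at hw ⊢
      have h1 : ρ g (ρ h w) = ρ h (ρ g w) := congrArg (fun f => f w) (hgH h h.2).eq
      rw [h1, hw, map_smul]
    have hWinv' : ∀ h : H, ∀ w ∈ Wᗮ, ρ h w ∈ Wᗮ := by
      intro h w hw
      rw [Submodule.mem_orthogonal] at hw ⊢
      intro u hu
      have h1 := hw _ (hWinv h⁻¹ u hu)
      rw [← (ρ (h : G)).inner_map_map] at h1
      have h2 : ρ h (ρ (h⁻¹ : H) u) = u := by
        change (ρ h * ρ (h⁻¹ : H)) u = u
        rw [← map_mul, Subgroup.coe_inv, mul_inv_cancel, map_one]; rfl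
      rwa [h2] at h1
    obtain ⟨ρ₁, hρ₁⟩ := exists_restrict_rep (ρ.comp H.subtype) W hWinv
    obtain ⟨ρ₂, hρ₂⟩ := exists_restrict_rep (ρ.comp H.subtype) Wᗮ hWinv'
    have hHfg : Group.FG H := Subgroup.fg_of_index_ne_zero H
    have hlt : Module.finrank ℂ W < N := by have := Submodule.finrank_lt hWtop; omega
    have hlt' : Module.finrank ℂ Wᗮ < N := by
      have : Wᗮ ≠ ⊤ := by rwa [Ne, Submodule.orthogonal_eq_top_iff]
      have := Submodule.finrank_lt this; omega
    obtain ⟨H₁, hH₁, hc₁⟩ := ih (hG.subgroup H) hHfg ρ₁ hlt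
    obtain ⟨H₂, hH₂, hc₂⟩ := ih (hG.subgroup H) hHfg ρ₂ hlt'
    refine ⟨(H₁ ⊓ H₂).map H.subtype, ⟨?_⟩, ?_⟩
    · rw [Subgroup.index_map_subtype]
      exact mul_ne_zero Subgroup.FiniteIndex.index_ne_zero hfi.index_ne_zero
    · rintro _ ⟨a, ha, rfl⟩ _ ⟨b, hb, rfl⟩
      refine commute_of_commute_restrict W (fun w hw => ?_) fun w hw => ?_
      · have h1 := congrArg (fun f => (f ⟨w, hw⟩ : E)) (hc₁ a ha.1 b hb.1)
        change (ρ₁ a (ρ₁ b ⟨w, hw⟩) : E) = ρ₁ b (ρ₁ a ⟨w, hw⟩) at h1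
        rw [hρ₁, hρ₁, hρ₁, hρ₁] at h1
        exact h1
      · have h1 := congrArg (fun f => (f ⟨w, hw⟩ : E)) (hc₂ a ha.2 b hb.2)
        change (ρ₂ a (ρ₂ b ⟨w, hw⟩) : E) = ρ₂ b (ρ₂ a ⟨w, hw⟩) at h1
        rw [hρ₂, hρ₂, hρ₂, hρ₂] at h1
        exact h1
  exfalso
  push Not at hB
  have hTH' : ∀ t ∈ T, t ∈ H := fun t ht => Subgroup.subset_closure (hTA ht)
  let good : G → Prop := fun g => g ∈ H ∧ ¬ IsScalarOp (ρ g) ∧ ‖c g - 1‖ < ε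
  have hstep : ∀ g : {g // good g}, ∃ t ∈ T, good (g * t * g.1⁻¹ * t⁻¹) ∧
      ‖c (g * t * g.1⁻¹ * t⁻¹) - 1‖ ≤ 2 * ε * ‖c g - 1‖ := by
    rintro ⟨g, hgH, hgns, hgε⟩
    obtain ⟨t, ht, hnc⟩ := hB g hgH hgns
    have h1 : ‖c (g * t * g⁻¹ * t⁻¹) - 1‖ ≤ 2 * ε * ‖c g - 1‖ := by
      refine (norm_map_commutator_sub_one_le hc g t).trans ?_
      have : ‖c t - 1‖ ≤ ε := (hTA ht).le
      gcongr
    have h2 : ‖c (g * t * g⁻¹ * t⁻¹) - 1‖ < ε := by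
      have : 2 * ε ≤ 1 := by nlinarith
      have h3 := norm_nonneg (c g - 1)
      nlinarith
    refine ⟨t, ht, ⟨mul_mem (mul_mem (mul_mem hgH (hTH' t ht)) (inv_mem hgH))
      (inv_mem (hTH' t ht)), fun hs => hnc ?_, h2⟩, h1⟩
    have h3 : ρ g * ρ t * (ρ g)⁻¹ * (ρ t)⁻¹ = 1 := by
      refine IsScalarOp.eq_one_of_commutator (by simpa using hs) ?_
      have h4 : LinearIsometryEquiv.toCLMHom E (ρ g * ρ t * (ρ g)⁻¹ * (ρ t)⁻¹) =
          c (g * t * g⁻¹ * t⁻¹) := by simp [hcdef]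
      rw [h4]
      nlinarith
    rw [mul_inv_eq_one, mul_inv_eq_iff_eq_mul] at h3
    exact h3
  choose nxt hnxtT hnxtg hnxt using hstep
  let s : ℕ → {g // good g} := fun n =>
    Nat.rec ⟨t₀, hTH' t₀ ht₀, hns, hTA ht₀⟩ (fun _ g => ⟨_, hnxtg g⟩) n
  have hs : ∀ n, (s (n + 1)).1 = (s n).1 * nxt (s n) * (s n).1⁻¹ * (nxt (s n))⁻¹ := fun n => rfl
  set T' : Set G := insert 1 (T ∪ T⁻¹) with hT'
  have hT'1 : (1 : G) ∈ T' := Set.mem_insert _ _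
  have hT'inv : ∀ n : ℕ, ∀ x ∈ T' ^ n, x⁻¹ ∈ T' ^ n := by
    have h1 : T'⁻¹ = T' := by
      rw [hT', Set.inv_insert, Set.union_inv, inv_inv, inv_one, Set.union_comm]
    intro n x hx
    rw [← h1, inv_pow]
    simpa using hx
  refine hG.not_exponentially_small (T := T') ((hT.union hT.inv).insert 1) hT'1
    (δ := fun g => ‖c g - 1‖) (by simp) (norm_map_mul_sub_one_le hc) (norm_map_inv_sub_one hc)
    (norm_map_pow_sub_one_ge hc) hM (η := 2 * ε) (by nlinarith) (by positivity)
    (γ := fun n => (s n).1) ?_ ?_ ?_ ?_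
  · intro n
    induction n with
    | zero =>
      rw [pow_zero, pow_one]
      exact Or.inr (Or.inl ht₀)
    | succ n ihn =>
      have h1 : nxt (s n) ∈ T' ^ 1 := by rw [pow_one]; exact Or.inr (Or.inl (hnxtT (s n)))
      have h2 := Set.mul_mem_mul (Set.mul_mem_mul (Set.mul_mem_mul ihn h1) (hT'inv _ _ ihn))
        (hT'inv _ _ h1)
      rw [← pow_add, ← pow_add, ← pow_add] at h2
      change (s (n + 1)).1 ∈ _
      rw [hs]
      refine Set.pow_mono_of_one_mem hT'1 ?_ h2
      have := Nat.one_le_pow n 4 (by norm_num)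
      rw [pow_succ]; omega
  · intro n
    refine norm_pos_iff.2 fun h => (s n).2.2.1 ⟨1, fun v => ?_⟩
    have h1 : c (s n).1 v = (1 : E →L[ℂ] E) v := by rw [sub_eq_zero.1 h]
    rw [one_smul]; exact h1
  · intro n
    have := (s n).2.2.2
    nlinarith
  · exact fun n => hnxt (s n)

theorem PolyGrowth.exists_finiteIndex_commuting.{u} {d : ℕ} {G : Type u} [Group G]
    (hG : PolyGrowth d G) (hfg : Group.FG G) {E : Type u} [NormedAddCommGroup E]
    [InnerProductSpace ℂ E] [FiniteDimensional ℂ E] (ρ : G →* (E ≃ₗᵢ[ℂ] E)) :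
    ∃ H : Subgroup G, H.FiniteIndex ∧ ∀ a ∈ H, ∀ b ∈ H, ρ a * ρ b = ρ b * ρ a :=
  hG.exists_finiteIndex_commuting_of_finrank_lt _ hfg ρ (Nat.lt_succ_self _)

end UnitaryJordan

section VirtualSurjection

open scoped Pointwise

theorem IsHarmonic.eq_of_finite_range {G ι : Type*} [Group G] [Fintype ι] [Nonempty ι] {σ : ι → G}
    {u : G → ℝ} (hu : IsHarmonic σ u) (hgen : ∀ g, ∃ n, g ∈ Set.range σ ^ n)
    (hfin : (Set.range u).Finite) (x : G) : u x = u 1 := by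
  obtain ⟨_, ⟨x₀, rfl⟩, hmax⟩ := Set.exists_max_image _ id hfin ⟨u 1, 1, rfl⟩
  have hstep : ∀ y, u y = u x₀ → ∀ i, u (y * σ i) = u x₀ := by
    intro y hy i
    have h1 : ∑ i, (u x₀ - u (y * σ i)) = 0 := by
      rw [Finset.sum_sub_distrib, hu y, hy]; simp
    have h2 := (Finset.sum_eq_zero_iff_of_nonneg fun j _ =>
      sub_nonneg.2 (hmax _ ⟨y * σ j, rfl⟩)).1 h1 i (Finset.mem_univ i)
    exact (sub_eq_zero.1 h2).symm
  have hall : ∀ n, ∀ g ∈ Set.range σ ^ n, u (x₀ * g) = u x₀ := by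
    intro n
    induction n with
    | zero => intro g hg; rw [pow_zero, Set.mem_one] at hg; rw [hg, mul_one]
    | succ n ih =>
      intro g hg
      rw [pow_succ] at hg
      obtain ⟨a, ha, _, ⟨i, rfl⟩, rfl⟩ := hg
      rw [← mul_assoc]
      exact hstep _ (ih a ha) i
  have h : ∀ g, u g = u x₀ := by
    intro g
    obtain ⟨n, hn⟩ := hgen (x₀⁻¹ * g)
    simpa using hall n _ hn
  rw [h, h 1]

theorem CommGroup.exists_surjective_int {A : Type*} [CommGroup A] [Infinite A] (hA : Group.FG A) :
    ∃ f : A →* Multiplicative ℤ, Function.Surjective f := by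
  have : AddGroup.FG (Additive A) := inferInstance
  obtain ⟨n, ι, _, p, hp, e, ⟨φ⟩⟩ := AddCommGroup.equiv_free_prod_directSum_zmod (Additive A)
  rcases n.eq_zero_or_pos with rfl | hn
  · exfalso
    have h1 : ∀ i, NeZero (p i ^ e i) := fun i => ⟨pow_ne_zero _ (hp i).ne_zero⟩
    have h2 : Finite (DirectSum ι fun i => ZMod (p i ^ e i)) := by
      classical
      exact Finite.of_equiv _ (DirectSum.addEquivProd fun i => ZMod (p i ^ e i)).toEquiv.symm
    have : Finite (Additive A) := Finite.of_equiv _ φ.toEquiv.symm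
    have : Finite A := Finite.of_equiv _ Additive.toMul
    exact not_finite A
  · let ψ : Additive A →+ ℤ :=
      (Finsupp.applyAddHom (⟨0, hn⟩ : Fin n)).comp ((AddMonoidHom.fst _ _).comp φ.toAddMonoidHom)
    refine ⟨AddMonoidHom.toMultiplicativeRight ψ, fun z => ?_⟩
    refine ⟨(φ.symm (Finsupp.single ⟨0, hn⟩ z.toAdd, 0)).toMul, ?_⟩
    change Multiplicative.ofAdd (ψ (φ.symm (Finsupp.single ⟨0, hn⟩ z.toAdd, 0))) = z
    simp [ψ]

theorem exists_surjective_int_of_infinite_range {H M : Type*} [Group H] [Group M]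
    (hH : Group.FG H) (f : H →* M) (hcomm : ∀ a b, f a * f b = f b * f a)
    (hinf : (Set.range f).Infinite) : ∃ φ : H →* Multiplicative ℤ, Function.Surjective φ := by
  letI : CommGroup f.range :=
    { (inferInstance : Group f.range) with
      mul_comm := by
        rintro ⟨_, a, rfl⟩ ⟨_, b, rfl⟩
        exact Subtype.ext (hcomm a b) }
  have : Infinite f.range := hinf.to_subtype
  obtain ⟨φ, hφ⟩ := CommGroup.exists_surjective_int (A := f.range)
    (Group.fg_of_surjective f.rangeRestrict_surjective)
  exact ⟨φ.comp f.rangeRestrict, hφ.comp f.rangeRestrict_surjective⟩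

/-- An infinite finitely generated group of polynomial growth virtually maps onto `ℤ`. -/
theorem PolyGrowth.exists_surjective_int.{u} {d : ℕ} {G : Type u} [Group G] [Infinite G]
    (hG : PolyGrowth d G) (hfg : Group.FG G) :
    ∃ H : Subgroup G, H.FiniteIndex ∧ ∃ φ : H →* Multiplicative ℤ, Function.Surjective φ := by
  classical
  obtain ⟨T, hT, hT1, hTinv, hgen⟩ := exists_symmetric_generators hfg
  have := hT.fintype
  have : Nonempty T := ⟨⟨1, hT1⟩⟩
  let τ : T → G := Subtype.val
  have hτ : Set.range τ = T := Subtype.range_coe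
  obtain ⟨u, hu, ⟨L, hL⟩, y, hy⟩ := hG.exists_harmonic (τ := τ)
    (e := Function.Involutive.toPerm (fun x : T => ⟨x.1⁻¹, hTinv x x.2⟩)
      fun x => Subtype.ext (inv_inv _)) (fun i => rfl) (i₀ := ⟨1, hT1⟩) rfl
    (by rwa [hτ])
  have hgen' : ∀ g, ∃ n, g ∈ Set.range (fun p : T × T => τ p.1 * τ p.2) ^ n := by
    intro g
    obtain ⟨n, hn⟩ := hgen g
    refine ⟨n, Set.pow_subset_pow_left ?_ hn⟩
    intro t ht
    exact ⟨(⟨t, ht⟩, ⟨1, hT1⟩), mul_one t⟩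
  have hLip : LipHarmonic (fun p : T × T => τ p.1 * τ p.2) u := by
    refine ⟨hu, L + L, fun x p => ?_⟩
    have h1 := hL (x * τ p.1) p.2
    have h2 := hL x p.1
    rw [← mul_assoc]
    calc _ ≤ |u (x * τ p.1 * τ p.2) - u (x * τ p.1)| + |u (x * τ p.1) - u x| :=
          abs_sub_le _ _ _
      _ ≤ _ := add_le_add h1 h2
  obtain ⟨E, _, _, _, ρ, hρ⟩ := hG.exists_unitary_rep _ hgen'
  obtain ⟨H, hH, hcomm⟩ := hG.exists_finiteIndex_commuting hfg ρ
  by_cases hinf : (Set.range (ρ.comp H.subtype)).Infinite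
  · exact ⟨H, hH, exists_surjective_int_of_infinite_range (Subgroup.fg_of_index_ne_zero H)
      (ρ.comp H.subtype) (fun a b => hcomm a a.2 b b.2) hinf⟩
  rw [Set.not_infinite] at hinf
  have : Finite (ρ.comp H.subtype).range := hinf
  obtain ⟨K, hK⟩ : ∃ K, K = ((ρ.comp H.subtype).ker.map H.subtype).normalCore := ⟨_, rfl⟩
  have hKfi : K.FiniteIndex := by
    have : ((ρ.comp H.subtype).ker.map H.subtype).FiniteIndex := by
      constructor
      rw [Subgroup.index_map_subtype]
      exact mul_ne_zero Subgroup.FiniteIndex.index_ne_zero hH.index_ne_zero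
    rw [hK]; infer_instance
  have hKn : K.Normal := by rw [hK]; infer_instance
  have hKρ : ∀ g ∈ K, ρ g = 1 := by
    intro g hg
    rw [hK] at hg
    obtain ⟨a, ha, rfl⟩ := Subgroup.normalCore_le _ hg
    exact ha
  have hadd : ∀ g ∈ K, ∀ x, u (g * x) = (u g - u 1) + u x := by
    intro g hg x
    have := hρ u hLip g⁻¹ (hKρ _ (inv_mem hg)) x
    rw [inv_inv] at this
    linarith
  let χ : K →* Multiplicative ℝ :=
    { toFun := fun g => Multiplicative.ofAdd (u g - u 1)
      map_one' := by simp
      map_mul' := fun g h => by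
        rw [← ofAdd_add]
        congr 1
        rw [Subgroup.coe_mul, hadd g g.2]
        ring }
  refine ⟨K, hKfi, exists_surjective_int_of_infinite_range (Subgroup.fg_of_index_ne_zero K) χ
    (fun a b => mul_comm _ _) fun hfin => hy (hu.eq_of_finite_range hgen' ?_ y)⟩
  have h1 : (Set.range fun q : G ⧸ K => u q.out).Finite := Set.finite_range _
  refine (Set.Finite.image2 (fun a b => Multiplicative.toAdd a + b) hfin h1).subset ?_
  rintro _ ⟨x, rfl⟩
  have hx : x * (x : G ⧸ K).out⁻¹ ∈ K := by
    have h2 : ((x : G ⧸ K).out : G ⧸ K) = x := QuotientGroup.out_eq' _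
    have := (QuotientGroup.eq (s := K)).1 h2
    exact (hKn.mem_comm_iff).1 this
  refine ⟨χ ⟨_, hx⟩, ⟨_, rfl⟩, u (x : G ⧸ K).out, ⟨_, rfl⟩, ?_⟩
  change u (x * (x : G ⧸ K).out⁻¹) - u 1 + u (x : G ⧸ K).out = u x
  rw [← hadd _ hx, inv_mul_cancel_right]

end VirtualSurjection

section ConjugateProducts

open scoped Pointwise

variable {G : Type*} [Group G]

/-- The product of the conjugates `t ^ i * k * t⁻¹ ^ i` over the elements `i` of `s` below `n`. -/
def conjProd (t k : G) (s : Finset ℕ) : ℕ → G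
  | 0 => 1
  | n + 1 => conjProd t k s n * if n ∈ s then t ^ n * k * (t ^ n)⁻¹ else 1

theorem conjProd_congr {t k : G} {s s' : Finset ℕ} {n : ℕ} (h : ∀ i < n, i ∈ s ↔ i ∈ s') :
    conjProd t k s n = conjProd t k s' n := by
  induction n with
  | zero => rfl
  | succ n ih =>
    rw [conjProd, conjProd, ih fun i hi => h i (hi.trans n.lt_succ_self)]
    simp only [h n n.lt_succ_self]

theorem conjProd_mul_pow_mem (t k : G) (s : Finset ℕ) (n : ℕ) :
    conjProd t k s n * t ^ n ∈ ({t, k * t} : Set G) ^ n := by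
  induction n with
  | zero => simp [conjProd]
  | succ n ih =>
    rw [pow_succ _ n]
    refine ⟨_, ih, if n ∈ s then k * t else t, ?_, ?_⟩
    · split_ifs <;> simp
    · change _ * _ = _
      rw [conjProd]
      split_ifs <;> group

/-- In a group of polynomial growth, there are coincidences between products of conjugates. -/
theorem PolyGrowth.exists_conjProd_eq {d : ℕ} (hG : PolyGrowth d G) (t k : G) :
    ∃ n, ∃ s ⊆ Finset.range n, ∃ s' ⊆ Finset.range n, s ≠ s' ∧
      conjProd t k s n = conjProd t k s' n := by
  obtain ⟨C, hC⟩ := hG.card_le (T := {t, k * t}) (by simp)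
  have h1 := (tendsto_pow_const_div_const_pow_of_one_lt d (one_lt_two (α := ℝ))).const_mul (C : ℝ)
  rw [mul_zero] at h1
  obtain ⟨n, hn, hn1⟩ := ((h1.eventually_lt_const one_pos).and (eventually_ge_atTop 1)).exists
  by_contra! hcon
  have h2 := hC n hn1 (Finset.range n).powerset (fun s => conjProd t k s n * t ^ n)
    (fun s hs s' hs' h => by
      by_contra hne
      exact hcon n s (Finset.mem_powerset.1 hs) s' (Finset.mem_powerset.1 hs') hne
        (mul_right_cancel h)) fun s _ => conjProd_mul_pow_mem t k s n
  rw [Finset.card_powerset, Finset.card_range] at h2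
  have h3 : (2 : ℝ) ^ n ≤ C * n ^ d := by exact_mod_cast h2
  rw [← mul_div_assoc, div_lt_one (by positivity)] at hn
  linarith

theorem conjProd_mem {t k : G} {s : Finset ℕ} {n : ℕ} {L : Subgroup G}
    (h : ∀ i < n, t ^ i * k * (t ^ i)⁻¹ ∈ L) : conjProd t k s n ∈ L := by
  induction n with
  | zero => exact one_mem _
  | succ n ih =>
    rw [conjProd]
    refine mul_mem (ih fun i hi => h i (hi.trans n.lt_succ_self)) ?_
    split_ifs
    · exact h n n.lt_succ_self
    · exact one_mem _

theorem PolyGrowth.exists_conj_mem_closure {d : ℕ} (hG : PolyGrowth d G) (t k : G) :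
    ∃ m : ℕ, ∀ n : ℕ, t ^ n * k * (t ^ n)⁻¹ ∈
      Subgroup.closure ((fun i : ℕ => t ^ i * k * (t ^ i)⁻¹) '' Set.Iio m) := by
  classical
  have hex := hG.exists_conjProd_eq t k
  obtain ⟨s, hs, s', hs', hne, heq⟩ := Nat.find_spec hex
  have hmin := fun m => Nat.find_min (H := hex) (m := m)
  obtain ⟨m, hm⟩ : ∃ m, Nat.find hex = m + 1 := by
    refine Nat.exists_eq_succ_of_ne_zero fun h => hne ?_
    rw [h, Finset.range_zero, Finset.subset_empty] at hs hs'
    rw [hs, hs']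
  rw [hm] at hs hs' heq hmin
  set L := Subgroup.closure ((fun i : ℕ => t ^ i * k * (t ^ i)⁻¹) '' Set.Iio m) with hL
  have hLi : ∀ i < m, t ^ i * k * (t ^ i)⁻¹ ∈ L := fun i hi => Subgroup.subset_closure ⟨i, hi, rfl⟩
  have hsucc : ∀ r ⊆ Finset.range (m + 1), ∀ i, i ∈ r → i < m ∨ i = m := by
    intro r hr i hi
    have := Finset.mem_range.1 (hr hi)
    omega
  have hm' : t ^ m * k * (t ^ m)⁻¹ ∈ L := by
    by_cases hiff : m ∈ s ↔ m ∈ s'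
    · exfalso
      refine hmin m m.lt_succ_self ⟨s ∩ Finset.range m, Finset.inter_subset_right,
        s' ∩ Finset.range m, Finset.inter_subset_right, fun h => hne ?_, ?_⟩
      · ext i
        constructor <;> intro hi
        · rcases hsucc s hs i hi with h1 | rfl
          · have : i ∈ s ∩ Finset.range m := Finset.mem_inter.2 ⟨hi, Finset.mem_range.2 h1⟩
            rw [h] at this
            exact Finset.mem_of_mem_inter_left this
          · exact hiff.1 hi
        · rcases hsucc s' hs' i hi with h1 | rfl
          · have : i ∈ s' ∩ Finset.range m := Finset.mem_inter.2 ⟨hi, Finset.mem_range.2 h1⟩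
            rw [← h] at this
            exact Finset.mem_of_mem_inter_left this
          · exact hiff.2 hi
      · have h1 : ∀ r : Finset ℕ, conjProd t k (r ∩ Finset.range m) m = conjProd t k r m :=
          fun r => conjProd_congr fun i hi => by simp [hi]
        rw [h1, h1]
        rw [conjProd, conjProd] at heq
        simp only [hiff] at heq
        exact mul_right_cancel heq
    · have h1 := conjProd_mem (s := s) hLi
      have h2 := conjProd_mem (s := s') hLi
      rw [conjProd, conjProd] at heq
      by_cases h3 : m ∈ s <;> by_cases h4 : m ∈ s' <;> simp only [h3, h4, if_true, if_false,
        mul_one, not_true, iff_true, iff_false, not_false_iff] at heq hiff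
      · rw [← heq] at h2
        exact (L.mul_mem_cancel_left h1).1 h2
      · rw [heq] at h1
        exact (L.mul_mem_cancel_left h2).1 h1
  have hconj : ∀ g ∈ L, t * g * t⁻¹ ∈ L := by
    intro g hg
    rw [hL] at hg
    induction hg using Subgroup.closure_induction with
    | mem x hx =>
      obtain ⟨i, hi, rfl⟩ := hx
      have h1 : t * (t ^ i * k * (t ^ i)⁻¹) * t⁻¹ = t ^ (i + 1) * k * (t ^ (i + 1))⁻¹ := by
        rw [pow_succ']; group
      change t * (t ^ i * k * (t ^ i)⁻¹) * t⁻¹ ∈ L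
      rw [h1]
      obtain h | h : i + 1 < m ∨ i + 1 = m := (Nat.succ_le_of_lt hi).lt_or_eq
      · exact hLi _ h
      · rw [h]; exact hm'
    | one => rw [mul_one, mul_inv_cancel]; exact one_mem _
    | mul x y _ _ hx hy => rw [← conj_mul]; exact mul_mem hx hy
    | inv x _ hx => rw [← conj_inv]; exact inv_mem hx
  refine ⟨m, fun n => ?_⟩
  induction n with
  | zero =>
    rcases m.eq_zero_or_pos with h | h
    · rw [h] at hm'; exact hm'
    · exact hLi 0 h
  | succ n ih =>
    have h1 : t ^ (n + 1) * k * (t ^ (n + 1))⁻¹ = t * (t ^ n * k * (t ^ n)⁻¹) * t⁻¹ := by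
      rw [pow_succ']; group
    rw [h1]
    exact hconj _ ih

/-- The subgroup generated by the conjugates of `k` by powers of `t`. -/
def conjClosure (t k : G) : Subgroup G :=
  Subgroup.closure (Set.range fun i : ℤ => t ^ i * k * (t ^ i)⁻¹)

theorem zpow_conj_mem_conjClosure (t k : G) (i : ℤ) : t ^ i * k * (t ^ i)⁻¹ ∈ conjClosure t k :=
  Subgroup.subset_closure ⟨i, rfl⟩

theorem mem_conjClosure (t k : G) : k ∈ conjClosure t k := by
  simpa using zpow_conj_mem_conjClosure t k 0

theorem conj_mem_conjClosure {t k : G} (i : ℤ) {g : G} (hg : g ∈ conjClosure t k) :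
    t ^ i * g * (t ^ i)⁻¹ ∈ conjClosure t k := by
  rw [conjClosure] at hg
  induction hg using Subgroup.closure_induction with
  | mem x hx =>
    obtain ⟨j, rfl⟩ := hx
    have h1 : t ^ i * (t ^ j * k * (t ^ j)⁻¹) * (t ^ i)⁻¹ = t ^ (i + j) * k * (t ^ (i + j))⁻¹ := by
      rw [zpow_add]; group
    change t ^ i * (t ^ j * k * (t ^ j)⁻¹) * (t ^ i)⁻¹ ∈ _
    rw [h1]
    exact zpow_conj_mem_conjClosure t k _
  | one => rw [mul_one, mul_inv_cancel]; exact one_mem _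
  | mul x y _ _ hx hy => rw [← conj_mul]; exact mul_mem hx hy
  | inv x _ hx => rw [← conj_inv]; exact inv_mem hx

theorem PolyGrowth.conjClosure_fg {d : ℕ} (hG : PolyGrowth d G) (t k : G) :
    (conjClosure t k).FG := by
  obtain ⟨m, hm⟩ := hG.exists_conj_mem_closure t k
  obtain ⟨m', hmneg⟩ := hG.exists_conj_mem_closure t⁻¹ k
  rw [Subgroup.fg_iff]
  refine ⟨(fun i : ℕ => t ^ i * k * (t ^ i)⁻¹) '' Set.Iio m ∪
    (fun i : ℕ => t⁻¹ ^ i * k * (t⁻¹ ^ i)⁻¹) '' Set.Iio m', le_antisymm ?_ ?_,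
    ((Set.finite_Iio m).image _).union ((Set.finite_Iio m').image _)⟩
  · rw [Subgroup.closure_le]
    rintro _ (⟨i, -, rfl⟩ | ⟨i, -, rfl⟩)
    · simpa using zpow_conj_mem_conjClosure t k i
    · simpa using zpow_conj_mem_conjClosure t k (-i)
  · rw [conjClosure, Subgroup.closure_le]
    rintro _ ⟨i, rfl⟩
    rcases Int.eq_nat_or_neg i with ⟨n, rfl | rfl⟩
    · refine Subgroup.closure_mono Set.subset_union_left ?_
      simpa using hm n
    · refine Subgroup.closure_mono Set.subset_union_right ?_
      simpa using hmneg n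

/-- The kernel of a map onto `ℤ` from a finitely generated group of polynomial growth is finitely
generated. -/
theorem PolyGrowth.ker_fg {d : ℕ} (hG : PolyGrowth d G) (hfg : Group.FG G)
    {φ : G →* Multiplicative ℤ} {t : G} (ht : φ t = Multiplicative.ofAdd 1) : φ.ker.FG := by
  obtain ⟨T, hT, -, -, hgen⟩ := exists_symmetric_generators hfg
  let κ : G → G := fun g => g * (t ^ (φ g).toAdd)⁻¹
  have hφt : ∀ i : ℤ, φ (t ^ i) = Multiplicative.ofAdd i := by
    intro i; rw [map_zpow, ht, ← ofAdd_zsmul]; simp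
  have hκ : ∀ g, κ g ∈ φ.ker := by
    intro g
    rw [MonoidHom.mem_ker, map_mul, map_inv, hφt]
    exact mul_inv_cancel _
  set L : Subgroup G := ⨆ s ∈ T, conjClosure t (κ s) with hL
  have hLs : ∀ s ∈ T, ∀ i : ℤ, t ^ i * κ s * (t ^ i)⁻¹ ∈ L := by
    intro s hs i
    have : conjClosure t (κ s) ≤ L := le_biSup (fun s => conjClosure t (κ s)) hs
    exact this (zpow_conj_mem_conjClosure _ _ _)
  have hconj : ∀ i : ℤ, ∀ g ∈ L, t ^ i * g * (t ^ i)⁻¹ ∈ L := by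
    intro i
    suffices L ≤ L.comap (MulAut.conj (t ^ i)).toMonoidHom from fun g hg => this hg
    refine iSup₂_le fun s hs g hg => ?_
    have : conjClosure t (κ s) ≤ L := le_biSup (fun s => conjClosure t (κ s)) hs
    exact this (conj_mem_conjClosure i hg)
  have hfgL : L.FG := Subgroup.FG.biSup hT _ fun s _ => hG.conjClosure_fg t (κ s)
  have hall : ∀ n, ∀ g ∈ T ^ n, κ g ∈ L := by
    intro n
    induction n with
    | zero =>
      intro g hg
      rw [pow_zero, Set.mem_one] at hg
      simp [hg, κ]
    | succ n ih =>
      rw [pow_succ']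
      rintro _ ⟨s, hs, g, hg, rfl⟩
      have h1 : κ (s * g) = κ s * (t ^ (φ s).toAdd * κ g * (t ^ (φ s).toAdd)⁻¹) := by
        simp only [κ, map_mul, toAdd_mul, zpow_add]
        group
      change κ (s * g) ∈ L
      rw [h1]
      refine mul_mem ?_ (hconj _ _ (ih g hg))
      simpa using hLs s hs 0
  have : φ.ker = L := by
    refine le_antisymm (fun g hg => ?_) (iSup₂_le fun s _ => ?_)
    · obtain ⟨n, hn⟩ := hgen g
      have h1 := hall n g hn
      rw [MonoidHom.mem_ker] at hg
      simpa [κ, hg] using h1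
    · rw [conjClosure, Subgroup.closure_le]
      rintro _ ⟨i, rfl⟩
      exact φ.normal_ker.conj_mem _ (hκ s) _
  rwa [this]

end ConjugateProducts

section RootsOfUnity

open Polynomial

theorem Polynomial.norm_lt_two_of_isRoot {P : ℤ[X]} (hP : P ≠ 0) (hcoeff : ∀ i, |P.coeff i| ≤ 1)
    {z : ℂ} (hz : (P.map (Int.castRingHom ℂ)).IsRoot z) : ‖z‖ < 2 := by
  have hinj : Function.Injective (Int.castRingHom ℂ) := Int.cast_injective
  have h1 : P.map (Int.castRingHom ℂ) ≠ 0 := (Polynomial.map_ne_zero_iff hinj).2 hP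
  have h2 := hz.norm_lt_cauchyBound h1
  have h3 : cauchyBound (P.map (Int.castRingHom ℂ)) ≤ 2 := by
    rw [cauchyBound, ← one_add_one_eq_two]
    gcongr
    have h4 : ‖(P.map (Int.castRingHom ℂ)).leadingCoeff‖₊ = 1 := by
      rw [leadingCoeff_map_of_injective hinj, ← NNReal.coe_inj]
      have h5 := hcoeff P.natDegree
      have h6 : |P.leadingCoeff| = 1 :=
        le_antisymm h5 (Int.one_le_abs (leadingCoeff_ne_zero.2 hP))
      simp only [eq_intCast, coe_nnnorm, NNReal.coe_one, Complex.norm_intCast]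
      exact_mod_cast h6
    rw [h4, div_one]
    refine Finset.sup_le fun i _ => ?_
    rw [coeff_map, ← NNReal.coe_le_coe]
    simp only [eq_intCast, coe_nnnorm, NNReal.coe_one, Complex.norm_intCast]
    exact_mod_cast hcoeff i
  have h4 := h2.trans_le h3
  rw [← NNReal.coe_lt_coe] at h4
  simpa using h4

/-- If all powers of an integral matrix are annihilated by polynomials with coefficients in
`{-1, 0, 1}`, then some power of the matrix has a fixed vector. -/
theorem Matrix.exists_pow_mulVec_eq {n : Type*} [Fintype n] [DecidableEq n] [Nonempty n]
    (M : Matrix n n ℤ) (hM : M.det ≠ 0)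
    (h : ∀ k : ℕ, ∃ P : ℤ[X], P ≠ 0 ∧ (∀ i, |P.coeff i| ≤ 1) ∧ aeval (M ^ k) P = 0) :
    ∃ m > 0, ∃ v ≠ 0, (M ^ m).mulVec v = v := by
  set N : Matrix n n ℂ := (Int.castRingHom ℂ).mapMatrix M with hN
  have hchar : M.charpoly.map (Int.castRingHom ℂ) = N.charpoly := (Matrix.charpoly_map M _).symm
  have hbound : ∀ z ∈ spectrum ℂ N, ‖z‖ ≤ 1 := by
    intro z hz
    have h2 : ∀ k : ℕ, ‖z‖ ^ k < 2 := by
      intro k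
      obtain ⟨P, hP0, hPc, hP⟩ := h k
      have h3 := spectrum.pow_mem_pow N k hz
      have h4 : aeval (N ^ k) (P.map (Int.castRingHom ℂ)) = 0 := by
        have h5 := congrArg (Int.castRingHom ℂ).mapMatrix hP
        rw [map_zero] at h5
        rw [← h5, aeval_def, aeval_def, hom_eval₂, eval₂_map, map_pow]
        congr 1
        exact RingHom.ext_int _ _
      have h5 := spectrum.subset_polynomial_aeval (N ^ k) (P.map (Int.castRingHom ℂ)) ⟨_, h3, rfl⟩
      rw [h4, spectrum.zero_eq, Set.mem_singleton_iff] at h5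
      rw [← norm_pow]
      exact norm_lt_two_of_isRoot hP0 hPc h5
    by_contra hcon
    obtain ⟨k, hk⟩ := pow_unbounded_of_one_lt 2 (not_le.1 hcon)
    exact lt_asymm hk (h2 k)
  have hmahler : (M.charpoly.map (Int.castRingHom ℂ)).mahlerMeasure = 1 := by
    rw [mahlerMeasure_eq_leadingCoeff_mul_prod_roots, hchar, (Matrix.charpoly_monic N).leadingCoeff,
      norm_one, one_mul]
    refine Multiset.prod_eq_one fun x hx => ?_
    obtain ⟨z, hz, rfl⟩ := Multiset.mem_map.1 hx
    exact max_eq_left (hbound z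
      (Matrix.mem_spectrum_of_isRoot_charpoly (isRoot_of_mem_roots hz)))
  obtain ⟨z, hz⟩ := Complex.exists_root (f := N.charpoly) (by
    rw [Matrix.charpoly_degree_eq_dim]
    exact_mod_cast Fintype.card_pos)
  have hzs := Matrix.mem_spectrum_of_isRoot_charpoly hz
  have hdet : N.det = (M.det : ℂ) := ((Int.castRingHom ℂ).map_det M).symm
  have hz0 : z ≠ 0 := by
    rintro rfl
    rw [spectrum.zero_mem_iff] at hzs
    refine hzs ((Matrix.isUnit_iff_isUnit_det N).2 (isUnit_iff_ne_zero.2 ?_))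
    rw [hdet]
    exact_mod_cast hM
  obtain ⟨m, hm, hzm⟩ := pow_eq_one_of_mahlerMeasure_eq_one hmahler (z := z) hz0 (by
    rw [mem_aroots]
    refine ⟨(Matrix.charpoly_monic M).ne_zero, ?_⟩
    rw [← hchar, IsRoot.def, eval_map] at hz
    exact hz)
  have h1 := spectrum.pow_mem_pow N m hzs
  rw [hzm, spectrum.mem_iff, map_one, Matrix.isUnit_iff_isUnit_det, isUnit_iff_ne_zero,
    not_not] at h1
  have h2 : (1 - M ^ m).det = 0 := by
    have h3 : (((1 - M ^ m).det : ℤ) : ℂ) = 0 := by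
      rw [← h1, hN, ← map_pow, ← map_one (Int.castRingHom ℂ).mapMatrix, ← map_sub]
      exact (Int.castRingHom ℂ).map_det _
    exact_mod_cast h3
  obtain ⟨v, hv0, hv⟩ := Matrix.exists_mulVec_eq_zero_iff.2 h2
  refine ⟨m, hm, v, hv0, ?_⟩
  rw [Matrix.sub_mulVec, Matrix.one_mulVec, sub_eq_zero] at hv
  exact hv.symm

end RootsOfUnity

section RootsOfUnityModule

open Polynomial

theorem aeval_apply_of_intertwine {B L : Type*} [AddCommGroup B] [AddCommGroup L]
    {τ : Module.End ℤ B} {f : Module.End ℤ L} {π : B →ₗ[ℤ] L} (h : ∀ x, f (π x) = π (τ x))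
    (P : ℤ[X]) (x : B) : aeval f P (π x) = π (aeval τ P x) := by
  have hpow : ∀ n : ℕ, ∀ x, (f ^ n) (π x) = π ((τ ^ n) x) := by
    intro n
    induction n with
    | zero => intro x; rfl
    | succ n ih => intro x; rw [pow_succ, pow_succ, Module.End.mul_apply, h, ih]; rfl
  induction P using Polynomial.induction_on' with
  | add p q hp hq => simp [hp, hq]
  | monomial n a => simp [aeval_monomial, hpow]

/-- If an automorphism of a finitely generated abelian group satisfies sufficiently many relations
with coefficients in `{-1, 0, 1}`, then one of its powers fixes an element of infinite order. -/
theorem exists_pow_fixed_of_relations {B : Type*} [AddCommGroup B] [Module.Finite ℤ B]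
    (τ : Module.End ℤ B) (hτ : Function.Injective τ) {z : B} (hz : ∀ n : ℤ, n ≠ 0 → n • z ≠ 0)
    (h : ∀ k : ℕ, ∃ P : ℤ[X], P ≠ 0 ∧ (∀ i, |P.coeff i| ≤ 1) ∧ aeval (τ ^ k) P = 0) :
    ∃ m > 0, ∃ v : B, (∀ n : ℤ, n ≠ 0 → n • v ≠ 0) ∧ (τ ^ m) v = v := by
  classical
  set T := Submodule.torsion ℤ B with hT
  have hmemT : ∀ x : B, x ∈ T ↔ ∃ n : ℤ, n ≠ 0 ∧ n • x = 0 := by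
    intro x
    rw [hT, Submodule.mem_torsion_iff]
    constructor
    · rintro ⟨a, ha⟩
      exact ⟨a, nonZeroDivisors.coe_ne_zero a, ha⟩
    · rintro ⟨n, hn, hx⟩
      exact ⟨⟨n, mem_nonZeroDivisors_of_ne_zero hn⟩, hx⟩
  have hle : T ≤ T.comap τ := by
    intro x hx
    obtain ⟨n, hn, hx⟩ := (hmemT x).1 hx
    exact (hmemT _).2 ⟨n, hn, by rw [← map_smul, hx, map_zero]⟩
  set f : Module.End ℤ (B ⧸ T) := T.mapQ T τ hle with hf
  have hfπ : ∀ x, f (T.mkQ x) = T.mkQ (τ x) := fun x => rfl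
  have hfpow : ∀ k : ℕ, ∀ x, (f ^ k) (T.mkQ x) = T.mkQ ((τ ^ k) x) := by
    intro k x
    simpa using aeval_apply_of_intertwine hfπ (X ^ k) x
  have hfinj : Function.Injective f := by
    rw [injective_iff_map_eq_zero]
    intro y
    obtain ⟨x, rfl⟩ := T.mkQ_surjective y
    rw [hfπ, Submodule.mkQ_apply, Submodule.mkQ_apply, Submodule.Quotient.mk_eq_zero,
      Submodule.Quotient.mk_eq_zero]
    intro hx
    obtain ⟨n, hn, hx⟩ := (hmemT _).1 hx
    refine (hmemT _).2 ⟨n, hn, hτ ?_⟩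
    rw [map_smul, hx, map_zero]
  have hnt : Nontrivial (B ⧸ T) := by
    refine ⟨T.mkQ z, 0, fun h0 => ?_⟩
    rw [Submodule.mkQ_apply, Submodule.Quotient.mk_eq_zero] at h0
    obtain ⟨n, hn, hx⟩ := (hmemT _).1 h0
    exact hz n hn hx
  let b := Module.Free.chooseBasis ℤ (B ⧸ T)
  have : Nonempty (Module.Free.ChooseBasisIndex ℤ (B ⧸ T)) := b.index_nonempty
  have hmul : ∀ (g : Module.End ℤ (B ⧸ T)) v, (LinearMap.toMatrixAlgEquiv b g).mulVec v =
      b.equivFun (g (b.equivFun.symm v)) := by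
    intro g v
    have := LinearMap.toMatrix_mulVec_repr b b g (b.equivFun.symm v)
    rw [← b.equivFun_apply, LinearEquiv.apply_symm_apply] at this
    exact this
  have hdet : (LinearMap.toMatrixAlgEquiv b f).det ≠ 0 := by
    intro h0
    obtain ⟨v, hv0, hv⟩ := Matrix.exists_mulVec_eq_zero_iff.2 h0
    rw [hmul, LinearEquiv.map_eq_zero_iff] at hv
    exact hv0 (b.equivFun.symm.map_eq_zero_iff.1 ((injective_iff_map_eq_zero f).1 hfinj _ hv))
  obtain ⟨m, hm, v, hv0, hv⟩ := Matrix.exists_pow_mulVec_eq (LinearMap.toMatrixAlgEquiv b f) hdet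
    fun k => by
      obtain ⟨P, hP0, hPc, hP⟩ := h k
      refine ⟨P, hP0, hPc, ?_⟩
      rw [← map_pow, aeval_algEquiv, AlgHom.comp_apply]
      have : aeval (f ^ k) P = 0 := by
        refine LinearMap.ext fun y => ?_
        obtain ⟨x, rfl⟩ := T.mkQ_surjective y
        rw [aeval_apply_of_intertwine (hfpow k), hP]
        rfl
      rw [this]
      exact map_zero _
  rw [← map_pow, hmul] at hv
  obtain ⟨y, hy⟩ := T.mkQ_surjective (b.equivFun.symm v)
  have hy1 : T.mkQ ((τ ^ m) y) = T.mkQ y := by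
    rw [← hfpow, hy]
    exact b.equivFun.injective (by rw [hv, LinearEquiv.apply_symm_apply])
  have hy0 : T.mkQ y ≠ 0 := by
    rw [hy]
    exact fun h0 => hv0 (b.equivFun.symm.map_eq_zero_iff.1 h0)
  rw [← sub_eq_zero, ← map_sub, Submodule.mkQ_apply, Submodule.Quotient.mk_eq_zero] at hy1
  rw [Ne, Submodule.mkQ_apply, Submodule.Quotient.mk_eq_zero] at hy0
  obtain ⟨n, hn, hny⟩ := (hmemT _).1 hy1
  refine ⟨m, hm, n • y, fun l hl h0 => hy0 ((hmemT _).2 ⟨l * n, mul_ne_zero hl hn, ?_⟩), ?_⟩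
  · rwa [mul_smul]
  · rwa [map_smul, ← sub_eq_zero, ← smul_sub]

end RootsOfUnityModule

section VirtuallyCentralElement

open Polynomial

theorem Subgroup.finiteIndex_of_relIndex_ker_ne_zero {G : Type*} [Group G]
    {φ : G →* Multiplicative ℤ} {t : G} (ht : φ t = Multiplicative.ofAdd 1) {L : Subgroup G}
    (hL : L.relIndex φ.ker ≠ 0) {m : ℕ} (hm : 0 < m) (htm : t ^ m ∈ L) : L.FiniteIndex := by
  have hfin : Finite (φ.ker ⧸ L.subgroupOf φ.ker) := Nat.finite_of_card_ne_zero hL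
  have hφt : ∀ i : ℤ, φ (t ^ i) = Multiplicative.ofAdd i := by
    intro i; rw [map_zpow, ht, ← ofAdd_zsmul]; simp
  have hsurj : Function.Surjective fun p : Fin m × (φ.ker ⧸ L.subgroupOf φ.ker) =>
      ((t ^ (p.1 : ℕ) * (p.2.out : G) : G) : G ⧸ L) := by
    intro y
    obtain ⟨g, rfl⟩ := QuotientGroup.mk_surjective y
    obtain ⟨j, hj⟩ : ∃ j, j = (φ g).toAdd := ⟨_, rfl⟩
    have hm0 : (m : ℤ) ≠ 0 := by exact_mod_cast hm.ne'
    obtain ⟨i, hi⟩ : ∃ i : ℕ, (i : ℤ) = j % m := ⟨(j % m).toNat,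
      Int.toNat_of_nonneg (Int.emod_nonneg _ hm0)⟩
    have him : i < m := by
      have := Int.emod_lt_of_pos j (by exact_mod_cast hm : (0 : ℤ) < m)
      omega
    have hk : (t ^ i)⁻¹ * g * (t ^ (m * (j / m) : ℤ))⁻¹ ∈ φ.ker := by
      rw [MonoidHom.mem_ker, map_mul, map_mul, map_inv, map_inv, hφt, ← zpow_natCast, hφt]
      apply Multiplicative.toAdd.injective
      simp only [toAdd_mul, toAdd_inv, toAdd_ofAdd, toAdd_one, ← hj, hi]
      have := Int.emod_add_mul_ediv j m
      linarith
    refine ⟨(⟨i, him⟩, ((⟨_, hk⟩ : φ.ker) : φ.ker ⧸ L.subgroupOf φ.ker)), ?_⟩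
    have h1 := QuotientGroup.mk_out_eq_mul (L.subgroupOf φ.ker) ⟨_, hk⟩
    obtain ⟨l, hl⟩ := h1
    rw [QuotientGroup.eq]
    simp only [hl]
    have h2 : ((l : φ.ker) : G) ∈ L := l.2
    have h3 : t ^ (m * (j / m) : ℤ) ∈ L := by
      rw [zpow_mul, zpow_natCast]; exact zpow_mem htm _
    have h4 : (t ^ i * ((⟨(t ^ i)⁻¹ * g * (t ^ (m * (j / m) : ℤ))⁻¹, hk⟩ : φ.ker) * l : φ.ker))⁻¹ * g
        = ((l : φ.ker) : G)⁻¹ * t ^ (m * (j / m) : ℤ) := by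
      simp only [Subgroup.coe_mul]
      group
    rw [h4]
    exact mul_mem (inv_mem h2) h3
  have : Finite (G ⧸ L) := Finite.of_surjective _ hsurj
  exact Subgroup.finiteIndex_of_finite_quotient

theorem Subgroup.finiteIndex_centralizer_coe {G : Type*} [Group G] {H : Subgroup G}
    (hH : H.FiniteIndex) {z : H} (hz : (Subgroup.centralizer {z}).FiniteIndex) :
    (Subgroup.centralizer {(z : G)}).FiniteIndex := by
  have h1 : ((Subgroup.centralizer {z}).map H.subtype).FiniteIndex := by
    constructor
    rw [Subgroup.index_map_subtype]
    exact mul_ne_zero hz.index_ne_zero hH.index_ne_zero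
  refine Subgroup.finiteIndex_of_le (H := (Subgroup.centralizer {z}).map H.subtype) ?_
  rintro _ ⟨g, hg, rfl⟩
  have hg' : g ∈ Subgroup.centralizer {z} := hg
  rw [Subgroup.mem_centralizer_singleton_iff] at hg' ⊢
  exact congrArg Subtype.val hg'

theorem Subgroup.relIndex_centralizer_conj {G : Type*} [Group G] (K : Subgroup G) [K.Normal]
    {z : G} (hz : (Subgroup.centralizer {z}).relIndex K ≠ 0) (g : G) :
    (Subgroup.centralizer {g * z * g⁻¹}).relIndex K ≠ 0 := by
  have h1 : Subgroup.centralizer {g * z * g⁻¹} =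
      (Subgroup.centralizer {z}).comap (MulAut.conj g⁻¹).toMonoidHom := by
    ext x
    rw [Subgroup.mem_comap, Subgroup.mem_centralizer_singleton_iff,
      Subgroup.mem_centralizer_singleton_iff]
    change _ ↔ MulAut.conj g⁻¹ x * z = z * MulAut.conj g⁻¹ x
    simp only [MulAut.conj_apply, inv_inv]
    constructor <;> intro h
    · have := congrArg (fun y => g⁻¹ * y * g) h
      simpa [mul_assoc] using this
    · have := congrArg (fun y => g * y * g⁻¹) h
      simpa [mul_assoc] using this
  rw [h1, Subgroup.relIndex_comap]
  have h2 : K.map (MulAut.conj g⁻¹).toMonoidHom = K := by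
    ext x
    constructor
    · rintro ⟨y, hy, rfl⟩
      exact (‹K.Normal›).conj_mem y hy g⁻¹
    · intro hx
      exact ⟨g * x * g⁻¹, (‹K.Normal›).conj_mem x hx g, by simp [mul_assoc]⟩
  rwa [h2]

end VirtuallyCentralElement

section VirtuallyCentralElementExistence

open Polynomial

theorem PolyGrowth.exists_pow_commute {d : ℕ} {G : Type*} [Group G] (hG : PolyGrowth d G)
    {t w : G} (hcomm : ∀ a ∈ conjClosure t w, ∀ b ∈ conjClosure t w, a * b = b * a)
    (hw : Function.Injective fun n : ℕ => w ^ n) :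
    ∃ m > 0, ∃ v ∈ conjClosure t w, (Function.Injective fun n : ℕ => v ^ n) ∧
      t ^ m * v = v * t ^ m := by
  classical
  obtain ⟨A, hA⟩ : ∃ A, A = conjClosure t w := ⟨_, rfl⟩
  have hAw : w ∈ A := hA ▸ mem_conjClosure t w
  have hAconj : ∀ (i : ℤ), ∀ a ∈ A, t ^ i * a * (t ^ i)⁻¹ ∈ A := by
    intro i a ha
    rw [hA] at ha ⊢
    exact conj_mem_conjClosure i ha
  letI : CommGroup A :=
    { (inferInstance : Group A) with
      mul_comm := fun a b => Subtype.ext (hcomm a (hA ▸ a.2) b (hA ▸ b.2)) }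
  have hfg : Module.Finite ℤ (Additive A) := by
    rw [Module.Finite.iff_addGroup_fg, ← GroupFG.iff_add_fg, Group.fg_iff_subgroup_fg, hA]
    exact hG.conjClosure_fg t w
  let c : ℤ → (A →* A) := fun i =>
    { toFun := fun a => ⟨t ^ i * a * (t ^ i)⁻¹, hAconj i a a.2⟩
      map_one' := by ext; simp
      map_mul' := fun a b => by
        ext
        change t ^ i * (a * b) * (t ^ i)⁻¹ = (t ^ i * a * (t ^ i)⁻¹) * (t ^ i * b * (t ^ i)⁻¹)
        rw [conj_mul] }
  let γ : ℤ → Module.End ℤ (Additive A) := fun i => (MonoidHom.toAdditive (c i)).toIntLinearMap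
  have hγ : ∀ i x, ((Additive.toMul (γ i x) : A) : G) = t ^ i * (Additive.toMul x : A) * (t ^ i)⁻¹ :=
    fun i x => rfl
  have hinj : Function.Injective fun x : Additive A => ((Additive.toMul x : A) : G) :=
    Subtype.coe_injective.comp Additive.toMul.injective
  have hγadd : ∀ i j x, γ i (γ j x) = γ (i + j) x := by
    intro i j x
    apply hinj
    simp only [hγ, zpow_add]
    group
  have hγ0 : ∀ x, γ 0 x = x := by
    intro x
    apply hinj
    simp only [hγ]
    simp
  have hγpow : ∀ (i : ℤ) (k : ℕ), γ i ^ k = γ (i * k) := by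
    intro i k
    induction k with
    | zero => ext x; simp [hγ0]
    | succ k ih =>
      ext1 x
      rw [pow_succ', ih, Module.End.mul_apply, hγadd]
      congr 2
      push_cast
      ring
  obtain ⟨w', hw'⟩ : ∃ w' : Additive A, w' = Additive.ofMul ⟨w, hAw⟩ := ⟨_, rfl⟩
  have hww' : ((Additive.toMul w' : A) : G) = w := by rw [hw']; rfl
  have hprod : ∀ (k : ℕ) (s : Finset ℕ) (n : ℕ),
      ((Additive.toMul (∑ i ∈ Finset.range n, if i ∈ s then γ (k * i) w' else 0) : A) : G)
        = conjProd (t ^ k) w s n := by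
    intro k s n
    induction n with
    | zero => rfl
    | succ n ih =>
      rw [Finset.sum_range_succ, conjProd, toMul_add, Subgroup.coe_mul, ih]
      congr 1
      split_ifs
      · rw [hγ, hww', ← pow_mul, ← Nat.cast_mul, zpow_natCast]
      · rfl
  have hfix := exists_pow_fixed_of_relations (B := Additive A) (γ 1) (fun x y hxy => by
      have := congrArg (γ (-1)) hxy
      simpa [hγadd, hγ0] using this) (z := w') (fun n hn h0 => by
      have h1 : w ^ n = 1 := by
        have := congrArg (fun x : Additive A => ((Additive.toMul x : A) : G)) h0
        simpa [hww'] using this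
      exact (injective_zpow_iff_not_isOfFinOrder.2
        (injective_pow_iff_not_isOfFinOrder.1 hw)).ne hn (by simpa using h1)) (fun k => by
      obtain ⟨n, s, hs, s', hs', hne, heq⟩ := hG.exists_conjProd_eq (t ^ k) w
      obtain ⟨a, ha⟩ : ∃ a : ℕ → ℤ, a = fun i => (if i ∈ s then 1 else 0) - (if i ∈ s' then 1 else 0) :=
        ⟨_, rfl⟩
      obtain ⟨P, hP⟩ : ∃ P : ℤ[X], P = ∑ i ∈ Finset.range n, C (a i) * X ^ i := ⟨_, rfl⟩
      have hcoeff : ∀ j, P.coeff j = a j := by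
        intro j
        rw [hP, finsetSum_coeff]
        simp only [coeff_C_mul_X_pow, Finset.sum_ite_eq, Finset.mem_range]
        split_ifs with hj
        · rfl
        · have h1 : j ∉ s := fun h => hj (Finset.mem_range.1 (hs h))
          have h2 : j ∉ s' := fun h => hj (Finset.mem_range.1 (hs' h))
          simp [ha, h1, h2]
      refine ⟨P, ?_, ?_, ?_⟩
      · rintro h0
        apply hne
        ext j
        have := hcoeff j
        rw [h0, coeff_zero, ha] at this
        by_cases h1 : j ∈ s <;> by_cases h2 : j ∈ s' <;> simp [h1, h2] at this ⊢
      · intro i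
        rw [hcoeff, ha]
        dsimp only
        split_ifs <;> simp
      · have hker : aeval (γ 1 ^ k) P w' = 0 := by
          have h1 : aeval (γ 1 ^ k) P w' =
              (∑ i ∈ Finset.range n, if i ∈ s then γ (k * i) w' else 0) -
              ∑ i ∈ Finset.range n, if i ∈ s' then γ (k * i) w' else 0 := by
            rw [hP, map_sum, LinearMap.sum_apply, ← Finset.sum_sub_distrib]
            refine Finset.sum_congr rfl fun i _ => ?_
            rw [map_mul, aeval_C, map_pow, aeval_X, hγpow, hγpow, one_mul]
            simp only [algebraMap_int_eq, Module.End.mul_apply, ha]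
            split_ifs <;> simp
          rw [h1, sub_eq_zero]
          apply hinj
          simp only [hprod, heq]
        ext1 x
        have hall : ∀ g (hg : g ∈ conjClosure t w),
            aeval (γ 1 ^ k) P (Additive.ofMul (⟨g, hA ▸ hg⟩ : A)) = 0 := by
          intro g hg
          have hg' := hg
          rw [conjClosure] at hg'
          induction hg' using Subgroup.closure_induction with
          | mem x hx =>
            obtain ⟨j, rfl⟩ := hx
            have h1 := aeval_apply_of_intertwine (τ := γ 1 ^ k) (f := γ 1 ^ k) (π := γ j)
              (fun x => by rw [hγpow, hγadd, hγadd, add_comm]) P w'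
            rw [hker, map_zero] at h1
            rw [← h1]
            congr 1
            apply hinj
            simp only [hγ, hww']
            rfl
          | one => exact map_zero _
          | mul x y hx hy ihx ihy =>
            have := congrArg₂ (· + ·) (ihx hx) (ihy hy)
            simp only [← map_add, add_zero] at this
            exact this
          | inv x hx ih =>
            have := congrArg Neg.neg (ih hx)
            rw [← map_neg, neg_zero] at this
            exact this
        exact hall _ (hA ▸ (Additive.toMul x : A).2))
  obtain ⟨m, hm, v, hv, hmv⟩ := hfix
  refine ⟨m, hm, (Additive.toMul v : A), hA ▸ (Additive.toMul v : A).2, ?_, ?_⟩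
  · rw [injective_pow_iff_not_isOfFinOrder, isOfFinOrder_iff_pow_eq_one]
    rintro ⟨n, hn, h1⟩
    refine hv n (by exact_mod_cast hn.ne') (hinj ?_)
    simpa using h1
  · rw [hγpow, one_mul] at hmv
    have := congrArg (fun x : Additive A => ((Additive.toMul x : A) : G)) hmv
    simp only [hγ, zpow_natCast] at this
    rwa [mul_inv_eq_iff_eq_mul] at this

theorem PolyGrowth.exists_finiteIndex_centralizer.{u} (d : ℕ) : ∀ {G : Type u} [Group G]
    [Infinite G], PolyGrowth d G → Group.FG G →
    ∃ z : G, (Function.Injective fun n : ℕ => z ^ n) ∧ (Subgroup.centralizer {z}).FiniteIndex := by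
  induction d with
  | zero =>
    intro G _ _ hG hfg
    exact (not_finite_iff_infinite.2 ‹_› (hG.finite_of_zero hfg)).elim
  | succ d ih =>
    intro G _ _ hG hfg
    obtain ⟨H, hH, φ, hφ⟩ := hG.exists_surjective_int hfg
    suffices h : ∃ z : H, (Function.Injective fun n : ℕ => z ^ n) ∧
        (Subgroup.centralizer {z}).FiniteIndex by
      obtain ⟨z, hz, hzc⟩ := h
      refine ⟨z, fun a b hab => hz (Subtype.ext (by simpa using hab)),
        Subgroup.finiteIndex_centralizer_coe hH hzc⟩
    have hHG : PolyGrowth (d + 1) H := hG.subgroup H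
    have hHfg : Group.FG H := Subgroup.fg_of_index_ne_zero H
    obtain ⟨t, ht⟩ := hφ (Multiplicative.ofAdd 1)
    have htinj : Function.Injective fun n : ℕ => φ t ^ n := by
      intro a b hab
      simp only [ht, ← ofAdd_nsmul] at hab
      simpa using hab
    have hKfg := hHG.ker_fg hHfg ht
    have hKG : PolyGrowth d φ.ker := hHG.ker φ htinj
    by_cases hfin : Finite φ.ker
    · obtain ⟨m, hm, hmt⟩ := isOfFinOrder_iff_pow_eq_one.1
        (isOfFinOrder_of_finite (MulAut.conjNormal t : MulAut φ.ker))
      refine ⟨t ^ m, ?_, ?_⟩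
      · intro a b hab
        have := congrArg φ hab
        simp only [← pow_mul, map_pow] at this
        exact Nat.eq_of_mul_eq_mul_left hm (htinj this)
      · refine Subgroup.finiteIndex_of_relIndex_ker_ne_zero ht ?_ one_pos ?_
        · rw [Subgroup.relIndex_eq_one.2]
          · exact one_ne_zero
          · intro k hk
            rw [Subgroup.mem_centralizer_singleton_iff]
            have h1 : (MulAut.conjNormal (t ^ m) : MulAut φ.ker) ⟨k, hk⟩ = ⟨k, hk⟩ := by
              rw [map_pow, hmt]; rfl
            have h2 := congrArg Subtype.val h1
            rw [MulAut.conjNormal_apply, mul_inv_eq_iff_eq_mul] at h2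
            exact h2.symm
        · rw [Subgroup.mem_centralizer_singleton_iff, pow_one, ← pow_succ, ← pow_succ']
    · haveI : Infinite φ.ker := not_finite_iff_infinite.1 hfin
      obtain ⟨z, hz, hzc⟩ := ih hKG ((Group.fg_iff_subgroup_fg _).2 hKfg)
      have hzrel : (Subgroup.centralizer {(z : H)}).relIndex φ.ker ≠ 0 := by
        have h1 : (Subgroup.centralizer {(z : H)}).subgroupOf φ.ker = Subgroup.centralizer {z} := by
          ext x
          rw [Subgroup.mem_subgroupOf, Subgroup.mem_centralizer_singleton_iff,
            Subgroup.mem_centralizer_singleton_iff]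
          exact ⟨fun h => Subtype.ext h, fun h => congrArg Subtype.val h⟩
        rw [Subgroup.relIndex, h1]
        exact hzc.index_ne_zero
      obtain ⟨T, hTsub, hTfin, hT⟩ :=
        Subgroup.FG.exists_finite_subset_closure_eq (hHG.conjClosure_fg t (z : H))
      haveI : Finite T := hTfin
      obtain ⟨Z, hZ⟩ : ∃ Z, Z = conjClosure t (z : H) := ⟨_, rfl⟩
      obtain ⟨C, hC⟩ : ∃ C, C = Subgroup.centralizer (Z : Set H) := ⟨_, rfl⟩
      have hCrel : C.relIndex φ.ker ≠ 0 := by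
        have h1 : (⨅ y : T, Subgroup.centralizer {(y : H)}).relIndex φ.ker ≠ 0 := by
          refine Subgroup.relIndex_iInf_ne_zero fun y => ?_
          obtain ⟨i, hi⟩ := hTsub y.2
          rw [← hi]
          exact Subgroup.relIndex_centralizer_conj _ hzrel _
        refine fun h0 => h1 (Subgroup.relIndex_eq_zero_of_le_left ?_ h0)
        rw [hC, hZ, conjClosure, ← hT, Subgroup.centralizer_closure]
        intro x hx
        rw [Subgroup.mem_centralizer_iff]
        intro y hy
        have := (Subgroup.mem_iInf.1 hx) ⟨y, hy⟩
        rw [Subgroup.mem_centralizer_singleton_iff] at this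
        exact this.symm
      obtain ⟨n, hn, -, hnC⟩ := Subgroup.exists_pow_mem_of_relIndex_ne_zero hCrel z.2
      have hnC' : (z : H) ^ n ∈ C := hnC.1
      have hCconj : ∀ i : ℤ, ∀ x ∈ C, t ^ i * x * (t ^ i)⁻¹ ∈ C := by
        intro i x hx
        rw [hC, Subgroup.mem_centralizer_iff] at hx ⊢
        intro y hy
        rw [hZ] at hy
        have h1 := hx _ (hZ ▸ conj_mem_conjClosure (-i) hy)
        have h2 := congrArg (fun x => t ^ i * x * (t ^ i)⁻¹) h1
        simp only [zpow_neg, inv_inv] at h2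
        simpa [mul_assoc] using h2
      have hAC : conjClosure t ((z : H) ^ n) ≤ C := by
        rw [conjClosure, Subgroup.closure_le]
        rintro _ ⟨i, rfl⟩
        exact hCconj i _ hnC'
      have hAZ : conjClosure t ((z : H) ^ n) ≤ Z := by
        rw [conjClosure, Subgroup.closure_le]
        rintro _ ⟨i, rfl⟩
        rw [hZ]
        exact conj_mem_conjClosure i (pow_mem (mem_conjClosure _ _) _)
      obtain ⟨m, hm, v, hv, hvinj, hvt⟩ := hHG.exists_pow_commute (t := t) (w := (z : H) ^ n)
        (fun a ha b hb => by
          have h1 := hAC hb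
          rw [hC, Subgroup.mem_centralizer_iff] at h1
          exact h1 a (hAZ ha))
        (fun a b hab => by
          simp only [← pow_mul] at hab
          exact Nat.eq_of_mul_eq_mul_left hn (hz (Subtype.ext (by simpa using hab))))
      refine ⟨v, hvinj, Subgroup.finiteIndex_of_relIndex_ker_ne_zero ht
        (fun h0 => hCrel (Subgroup.relIndex_eq_zero_of_le_left ?_ h0)) hm ?_⟩
      · intro x hx
        rw [hC, Subgroup.mem_centralizer_iff] at hx
        rw [Subgroup.mem_centralizer_singleton_iff]
        exact (hx v (hAZ hv)).symm
      · rw [Subgroup.mem_centralizer_singleton_iff]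
        exact hvt

end VirtuallyCentralElementExistence

section Gromov

/-- **Gromov's theorem**: finitely generated groups of polynomial growth are virtually
nilpotent. -/
theorem PolyGrowth.isVirtuallyNilpotent.{u} (d : ℕ) : ∀ {G : Type u} [Group G],
    PolyGrowth d G → Group.FG G → ∃ N : Subgroup G, N.FiniteIndex ∧ Group.IsNilpotent N := by
  have hfinite : ∀ {G : Type u} [Group G], Finite G →
      ∃ N : Subgroup G, N.FiniteIndex ∧ Group.IsNilpotent N := fun _ =>
    ⟨⊥, inferInstance, inferInstance⟩
  induction d with
  | zero => intro G _ hG hfg; exact hfinite (hG.finite_of_zero hfg)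
  | succ d ih =>
    intro G _ hG hfg
    by_cases hfin : Finite G
    · exact hfinite hfin
    have : Infinite G := not_finite_iff_infinite.1 hfin
    obtain ⟨z, hz, hzc⟩ := PolyGrowth.exists_finiteIndex_centralizer _ hG hfg
    obtain ⟨L, hL⟩ : ∃ L, L = Subgroup.centralizer {z} := ⟨_, rfl⟩
    rw [← hL] at hzc
    have hzL : z ∈ L := by rw [hL, Subgroup.mem_centralizer_singleton_iff]
    have hcen : ∀ x : L, x * ⟨z, hzL⟩ = ⟨z, hzL⟩ * x := by
      intro x
      exact Subtype.ext (Subgroup.mem_centralizer_singleton_iff.1 (hL.le x.2))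
    obtain ⟨Z, hZ⟩ : ∃ Z : Subgroup L, Z = Subgroup.zpowers ⟨z, hzL⟩ := ⟨_, rfl⟩
    have hZc : Z ≤ Subgroup.center L := by
      rw [hZ, Subgroup.zpowers_le, Subgroup.mem_center_iff]
      exact hcen
    have hZn : Z.Normal := ⟨fun n hn g => by
      rwa [Subgroup.mem_center_iff.1 (hZc hn) g, mul_inv_cancel_right]⟩
    have hLG : PolyGrowth (d + 1) L := hG.subgroup L
    have hLfg : Group.FG L := Subgroup.fg_of_index_ne_zero L
    have hQ : PolyGrowth d (L ⧸ Z) := hLG.of_surjective_of_mem_ker (QuotientGroup.mk' Z)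
      (QuotientGroup.mk'_surjective Z) (z := ⟨z, hzL⟩)
      ((QuotientGroup.eq_one_iff _).2 (hZ ▸ Subgroup.mem_zpowers _))
      (fun a b hab => hz (by simpa using congrArg Subtype.val hab))
    obtain ⟨N, hN, hNnil⟩ := ih hQ inferInstance
    obtain ⟨M, hM⟩ : ∃ M, M = N.comap (QuotientGroup.mk' Z) := ⟨_, rfl⟩
    have hMfi : M.FiniteIndex := by
      constructor
      rw [hM, Subgroup.index_comap_of_surjective _ (QuotientGroup.mk'_surjective Z)]
      exact hN.index_ne_zero
    have hMnil : Group.IsNilpotent M := by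
      refine Subgroup.isNilpotent_of_ker_le_center
        (((QuotientGroup.mk' Z).comp M.subtype).codRestrict N fun x => hM.le x.2)
        fun x hx => ?_
      have h1 : (QuotientGroup.mk' Z) (x : L) = 1 := congrArg Subtype.val hx
      have h2 := hZc ((QuotientGroup.eq_one_iff _).1 h1)
      rw [Subgroup.mem_center_iff] at h2 ⊢
      exact fun g => Subtype.ext (h2 g)
    refine ⟨M.map L.subtype, ?_, ?_⟩
    · constructor
      rw [Subgroup.index_map_subtype]
      exact mul_ne_zero hMfi.index_ne_zero hzc.index_ne_zero
    · exact Group.nilpotent_of_mulEquiv (M.equivMapOfInjective _ L.subtype_injective)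

end Gromov

section LowerCentral

open scoped commutatorElement

variable (G : Type*) [Group G]

/-- The lower central series, indexed from `1`. -/
def lcs (i : ℕ) : Subgroup G := (⊤ : Subgroup G).lowerCentralSeries (i - 1)

instance lcs_normal (i : ℕ) : (lcs G i).Normal := by
  unfold lcs; infer_instance

theorem lcs_one : lcs G 1 = ⊤ := rfl

theorem lcs_succ {i : ℕ} (hi : 1 ≤ i) : lcs G (i + 1) = ⁅lcs G i, ⊤⁆ := by
  obtain ⟨j, rfl⟩ : ∃ j, i = j + 1 := ⟨i - 1, by omega⟩
  rfl

theorem lcs_antitone : Antitone (lcs G) := fun _ _ h =>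
  Subgroup.lowerCentralSeries_antitone _ (Nat.sub_le_sub_right h 1)

variable {G}

theorem Subgroup.commutator_commutator_le_of_rotate {H₁ H₂ H₃ N : Subgroup G} [N.Normal]
    (h1 : ⁅⁅H₂, H₃⁆, H₁⁆ ≤ N) (h2 : ⁅⁅H₃, H₁⁆, H₂⁆ ≤ N) : ⁅⁅H₁, H₂⁆, H₃⁆ ≤ N := by
  have key : ∀ L : Subgroup G, L ≤ N ↔ L.map (QuotientGroup.mk' N) = ⊥ := by
    intro L
    rw [Subgroup.map_eq_bot_iff, QuotientGroup.ker_mk']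
  rw [key, Subgroup.map_commutator, Subgroup.map_commutator] at h1 h2 ⊢
  exact Subgroup.commutator_commutator_eq_bot_of_rotate h1 h2

theorem commutator_lcs_le (i j : ℕ) : ⁅lcs G i, lcs G j⁆ ≤ lcs G (i + j) := by
  rcases Nat.eq_zero_or_pos i with rfl | hi
  · rw [zero_add]; exact Subgroup.commutator_le_right _ _
  rcases Nat.eq_zero_or_pos j with rfl | hj
  · exact Subgroup.commutator_le_left _ _
  induction j, hj using Nat.le_induction generalizing i with
  | base => rw [lcs_succ G hi]; rfl
  | succ j hj ih =>
    rw [lcs_succ G hj, Subgroup.commutator_comm]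
    have h1 := ih i hi
    have h2 := ih (i + 1) (by omega)
    refine Subgroup.commutator_commutator_le_of_rotate ?_ ?_
    · rw [Subgroup.commutator_comm ⊤, ← lcs_succ G hi]
      exact h2.trans (lcs_antitone G (by omega))
    · refine (Subgroup.commutator_mono h1 le_rfl).trans ?_
      rw [← lcs_succ G (by omega)]
      exact lcs_antitone G (by omega)

theorem commutatorElement_mem_lcs {i j : ℕ} {a b : G} (ha : a ∈ lcs G i) (hb : b ∈ lcs G j) :
    ⁅a, b⁆ ∈ lcs G (i + j) :=
  commutator_lcs_le i j (Subgroup.commutator_mem_commutator ha hb)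

theorem mk_lcs_commute {k : ℕ} {g : G} (hg : g ∈ lcs G k) (h : G) :
    Commute (g : G ⧸ lcs G (k + 1)) (h : G ⧸ lcs G (k + 1)) := by
  have h1 := commutatorElement_mem_lcs hg (lcs_one G ▸ Subgroup.mem_top h : h ∈ lcs G 1)
  have h2 := (QuotientGroup.eq_one_iff _).2 h1
  exact commutatorElement_eq_one_iff_commute.1 h2

theorem mk_commutator_mul_left {i j : ℕ} {x x' y : G} (hx' : x' ∈ lcs G i)
    (hy : y ∈ lcs G j) :
    ((⁅x * x', y⁆ : G) : G ⧸ lcs G (i + j + 1)) = (⁅x, y⁆ : G) * (⁅x', y⁆ : G) := by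
  have h1 : ⁅x * x', y⁆ = x * ⁅x', y⁆ * x⁻¹ * ⁅x, y⁆ := by
    simp only [commutatorElement_def]; group
  have h2 := mk_lcs_commute (commutatorElement_mem_lcs hx' hy)
  rw [h1]
  simp only [QuotientGroup.mk_mul, QuotientGroup.mk_inv]
  rw [← (h2 x).eq, mul_inv_cancel_right, (h2 _).eq]

theorem mk_commutator_mul_right {i j : ℕ} {x y y' : G} (hx : x ∈ lcs G i)
    (hy' : y' ∈ lcs G j) :
    ((⁅x, y * y'⁆ : G) : G ⧸ lcs G (i + j + 1)) = (⁅x, y⁆ : G) * (⁅x, y'⁆ : G) := by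
  have h1 : ⁅x, y * y'⁆ = ⁅x, y⁆ * (y * ⁅x, y'⁆ * y⁻¹) := by
    simp only [commutatorElement_def]; group
  have h2 := mk_lcs_commute (commutatorElement_mem_lcs hx hy')
  rw [h1]
  simp only [QuotientGroup.mk_mul, QuotientGroup.mk_inv]
  rw [← (h2 y).eq, mul_inv_cancel_right]

theorem mk_commutator_pow {i j : ℕ} {x y : G} (hx : x ∈ lcs G i) (hy : y ∈ lcs G j) (a b : ℕ) :
    ((⁅x ^ a, y ^ b⁆ : G) : G ⧸ lcs G (i + j + 1)) = ((⁅x, y⁆ : G) : G ⧸ lcs G (i + j + 1)) ^ (a * b) := by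
  have h1 : ∀ b : ℕ, ((⁅x, y ^ b⁆ : G) : G ⧸ lcs G (i + j + 1)) =
      ((⁅x, y⁆ : G) : G ⧸ lcs G (i + j + 1)) ^ b := by
    intro b
    induction b with
    | zero => simp
    | succ b ih => rw [pow_succ, mk_commutator_mul_right hx hy, ih, pow_succ]
  induction a with
  | zero => simp
  | succ a ih =>
    rw [pow_succ, mk_commutator_mul_left hx (pow_mem hy b), ih, h1, ← pow_add]
    congr 1; ring

theorem lcs_le_closure_sup {S : Set G} (hS : S.Finite) (hgen : Subgroup.closure S = ⊤) {j : ℕ}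
    (hj : 1 ≤ j) : ∃ T : Set G, T.Finite ∧ T ⊆ lcs G j ∧
      lcs G j ≤ Subgroup.closure T ⊔ lcs G (j + 1) := by
  induction j, hj using Nat.le_induction with
  | base => exact ⟨S, hS, fun _ _ => Subgroup.mem_top _, by rw [hgen, top_sup_eq]; exact le_top⟩
  | succ j hj ih =>
    obtain ⟨T, hT, hTj, hle⟩ := ih
    refine ⟨Set.image2 (fun x s => ⁅x, s⁆) T S, hT.image2 _ hS, ?_, ?_⟩
    · rintro _ ⟨x, hx, s, -, rfl⟩
      exact commutatorElement_mem_lcs (hTj hx) (j := 1) (Subgroup.mem_top s)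
    obtain ⟨M, hM⟩ : ∃ M, M = Subgroup.closure (Set.image2 (fun x s : G => ⁅x, s⁆) T S) ⊔
      lcs G (j + 1 + 1) := ⟨_, rfl⟩
    rw [← hM]
    have hNM : lcs G (j + 1 + 1) ≤ M := hM ▸ le_sup_right
    have hcong : ∀ {a b : G}, b ∈ M → (a : G ⧸ lcs G (j + 1 + 1)) = b → a ∈ M := by
      intro a b hb hab
      have h1 := hNM (QuotientGroup.eq.1 hab.symm)
      simpa using mul_mem hb h1
    have htop : ∀ g : G, g ∈ lcs G 1 := fun g => Subgroup.mem_top g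
    have hleft : ∀ s ∈ S, ∀ x ∈ lcs G j, ⁅x, s⁆ ∈ M := by
      intro s hs x hx
      have hcl : ∀ y ∈ Subgroup.closure T, y ∈ lcs G j ∧ ⁅y, s⁆ ∈ M := by
        intro y hy
        induction hy using Subgroup.closure_induction with
        | mem y hy => exact ⟨hTj hy, hM ▸ Subgroup.mem_sup_left
            (Subgroup.subset_closure ⟨y, hy, s, hs, rfl⟩)⟩
        | one => simp [one_mem]
        | mul a b _ _ ha hb =>
          exact ⟨mul_mem ha.1 hb.1, hcong (mul_mem ha.2 hb.2)
            (mk_commutator_mul_left hb.1 (htop s))⟩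
        | inv a _ ha =>
          refine ⟨inv_mem ha.1, hcong (inv_mem ha.2) ?_⟩
          have := mk_commutator_mul_left (x := a) (inv_mem ha.1) (htop s)
          rw [mul_inv_cancel, commutatorElement_one_left] at this
          rw [QuotientGroup.mk_inv]
          exact (eq_inv_of_mul_eq_one_right this.symm)
      obtain ⟨y, hy, z, hz, rfl⟩ := Subgroup.mem_sup_of_normal_right.1 (hle hx)
      refine hcong (mul_mem (hcl y hy).2 (hNM ?_)) (mk_commutator_mul_left
        (lcs_antitone G (Nat.le_succ j) hz) (htop s))
      exact commutatorElement_mem_lcs hz (htop s)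
    rw [lcs_succ G hj, Subgroup.commutator_le]
    intro x hx g _
    have hg : g ∈ Subgroup.closure S := hgen ▸ Subgroup.mem_top g
    induction hg using Subgroup.closure_induction with
    | mem s hs => exact hleft s hs x hx
    | one => simp [one_mem]
    | mul a b _ _ ha hb =>
      exact hcong (mul_mem (ha (Subgroup.mem_top _)) (hb (Subgroup.mem_top _)))
        (mk_commutator_mul_right hx (htop b))
    | inv a _ ha =>
      refine hcong (inv_mem (ha (Subgroup.mem_top _))) ?_
      have := mk_commutator_mul_right (y := a) hx (htop a⁻¹)
      rw [mul_inv_cancel, commutatorElement_one_right] at this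
      rw [QuotientGroup.mk_inv]
      exact (eq_inv_of_mul_eq_one_right this.symm)

theorem lcs_fg {S : Set G} (hS : S.Finite) (hgen : Subgroup.closure S = ⊤) {c : ℕ}
    (hc : lcs G (c + 1) = ⊥) {j : ℕ} (hj : 1 ≤ j) :
    ∃ T : Set G, T.Finite ∧ Subgroup.closure T = lcs G j := by
  rcases Nat.lt_or_ge c j with hcj | hcj
  · exact ⟨∅, Set.finite_empty, by
      rw [Subgroup.closure_empty, eq_comm, ← le_bot_iff, ← hc]; exact lcs_antitone G hcj⟩
  obtain ⟨m, rfl⟩ : ∃ m, c = j + m := ⟨c - j, by omega⟩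
  clear hcj
  induction m generalizing j with
  | zero =>
    obtain ⟨T, hT, hTj, hle⟩ := lcs_le_closure_sup hS hgen hj
    refine ⟨T, hT, le_antisymm ((Subgroup.closure_le _).2 hTj) ?_⟩
    rwa [show j + 1 = j + 0 + 1 from rfl, hc, sup_bot_eq] at hle
  | succ m ih =>
    obtain ⟨T, hT, hTj, hle⟩ := lcs_le_closure_sup hS hgen hj
    obtain ⟨T', hT', hcl⟩ := ih (j := j + 1) (by omega)
      (by rw [show j + 1 + m + 1 = j + (m + 1) + 1 by ring]; exact hc)
    refine ⟨T ∪ T', hT.union hT', ?_⟩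
    rw [Subgroup.closure_union, hcl]
    exact le_antisymm (sup_le ((Subgroup.closure_le _).2 hTj) (lcs_antitone G (Nat.le_succ j))) hle

end LowerCentral

section Collection

open scoped commutatorElement

variable {G : Type*} [Group G]

/-- Finite symmetric generating sets for the terms of the lower central series of a group of
nilpotency class at most `c`. -/
structure LetterSystem (T : ℕ → Set G) (c : ℕ) : Prop where
  finite : ∀ j, (T j).Finite
  inv_mem : ∀ j, ∀ x ∈ T j, x⁻¹ ∈ T j
  closure_eq : ∀ j, 1 ≤ j → Subgroup.closure (T j) = lcs G j
  eq_empty : ∀ j, c < j → T j = ∅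

theorem exists_letterSystem {S : Set G} (hS : S.Finite) (hinv : ∀ x ∈ S, x⁻¹ ∈ S)
    (hgen : Subgroup.closure S = ⊤) {c : ℕ} (hc1 : 1 ≤ c) (hc : lcs G (c + 1) = ⊥) :
    ∃ T : ℕ → Set G, LetterSystem T c ∧ T 1 = S := by
  choose! R hRfin hR using fun (j : ℕ) (hj : 1 ≤ j) => lcs_fg hS hgen hc hj
  refine ⟨fun j => if j = 1 then S else if 1 ≤ j ∧ j ≤ c then R j ∪ (R j)⁻¹ else ∅,
    ⟨fun j => ?_, fun j x hx => ?_, fun j hj => ?_, fun j hj => ?_⟩, by simp⟩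
  · split_ifs with h1 h2
    · exact hS
    · exact (hRfin j h2.1).union (hRfin j h2.1).inv
    · exact Set.finite_empty
  · split_ifs at hx ⊢ with h1 h2
    · exact hinv x hx
    · rcases hx with hx | hx
      · exact Or.inr (by simpa using hx)
      · exact Or.inl hx
    · exact hx.elim
  · split_ifs with h1 h2
    · rw [hgen, h1, lcs_one]
    · rw [← hR j hj, Subgroup.closure_union, Subgroup.closure_inv, sup_idem]
    · rw [Subgroup.closure_empty, eq_comm, ← le_bot_iff, ← hc]
      exact lcs_antitone G (by omega)
  · rw [if_neg (by omega), if_neg (by omega)]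

theorem LetterSystem.subset {T : ℕ → Set G} {c : ℕ} (hT : LetterSystem T c) {j : ℕ} (hj : 1 ≤ j)
    {x : G} (hx : x ∈ T j) : x ∈ lcs G j :=
  hT.closure_eq j hj ▸ Subgroup.subset_closure hx

theorem LetterSystem.exists_word {T : ℕ → Set G} {c : ℕ} (hT : LetterSystem T c) {j : ℕ}
    (hj : 1 ≤ j) {x : G} (hx : x ∈ lcs G j) : ∃ w : List G, (∀ y ∈ w, y ∈ T j) ∧ w.prod = x := by
  rw [← hT.closure_eq j hj, ← Subgroup.mem_toSubmonoid, Subgroup.closure_toSubmonoid] at hx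
  obtain ⟨w, hw, rfl⟩ := Submonoid.exists_list_of_mem_closure hx
  refine ⟨w, fun y hy => ?_, rfl⟩
  rcases hw y hy with h | h
  · exact h
  · simpa using hT.inv_mem j _ h

theorem LetterSystem.exists_commutator_bound {T : ℕ → Set G} {c : ℕ} (hT : LetterSystem T c) :
    ∃ L : ℕ, ∀ i j, 1 ≤ i → 1 ≤ j → ∀ a ∈ T i, ∀ b ∈ T j,
      ∃ w : List G, w.length ≤ L ∧ (∀ y ∈ w, y ∈ T (i + j)) ∧ w.prod = ⁅a, b⁆ := by
  choose! w hw hwp using fun (j : ℕ) (hj : 1 ≤ j) (x : G) (hx : x ∈ lcs G j) =>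
    hT.exists_word hj hx
  have hfin : (⋃ i ∈ Set.Iic c, ⋃ j ∈ Set.Iic c,
      Set.image2 (fun a b => (w (i + j) ⁅a, b⁆).length) (T i) (T j)).Finite :=
    (Set.finite_Iic c).biUnion fun i _ => (Set.finite_Iic c).biUnion fun j _ =>
      (hT.finite i).image2 _ (hT.finite j)
  obtain ⟨L, hL⟩ := hfin.bddAbove
  refine ⟨L, fun i j hi hj a ha b hb => ⟨w (i + j) ⁅a, b⁆, hL ?_, hw _ (by omega) _ ?_,
    hwp _ (by omega) _ ?_⟩⟩
  · have hic : i ≤ c := by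
      by_contra h
      rw [hT.eq_empty i (by omega)] at ha
      exact ha
    have hjc : j ≤ c := by
      by_contra h
      rw [hT.eq_empty j (by omega)] at hb
      exact hb
    simp only [Set.mem_iUnion]
    exact ⟨i, hic, j, hjc, a, ha, b, hb, rfl⟩
  · exact commutatorElement_mem_lcs (hT.subset hi ha) (hT.subset hj hb)
  · exact commutatorElement_mem_lcs (hT.subset hi ha) (hT.subset hj hb)

/-- The value of a word in weighted letters. -/
def wordVal (l : List (ℕ × G)) : G := (l.map Prod.snd).prod

theorem wordVal_append (l l' : List (ℕ × G)) : wordVal (l ++ l') = wordVal l * wordVal l' := by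
  simp [wordVal]

theorem wordVal_cons (p : ℕ × G) (l : List (ℕ × G)) : wordVal (p :: l) = p.2 * wordVal l := by
  simp [wordVal]

theorem wordVal_map_mk (j : ℕ) (w : List G) : wordVal (w.map fun y => (j, y)) = w.prod := by
  simp [wordVal, Function.comp_def]

/-- The number of letters of weight `j` in a word. -/
def weightCount (j : ℕ) (l : List (ℕ × G)) : ℕ := l.countP fun p => p.1 = j

theorem weightCount_append (j : ℕ) (l l' : List (ℕ × G)) :
    weightCount j (l ++ l') = weightCount j l + weightCount j l' := List.countP_append

theorem weightCount_map_mk_le (j k : ℕ) (w : List G) :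
    weightCount j (w.map fun y => (k, y)) ≤ if k = j then w.length else 0 := by
  unfold weightCount
  split_ifs with h
  · exact List.countP_le_length.trans_eq (by simp)
  · simp [List.countP_map, Function.comp_def, h]

/-- The word consists of letters of the given system, of weight at least `i`. -/
def ValidWord (T : ℕ → Set G) (i : ℕ) (l : List (ℕ × G)) : Prop := ∀ p ∈ l, i ≤ p.1 ∧ p.2 ∈ T p.1

theorem ValidWord.weightCount_eq_zero {T : ℕ → Set G} {i j : ℕ} {l : List (ℕ × G)}
    (h : ValidWord T i l) (hj : j < i) : weightCount j l = 0 := by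
  rw [weightCount, List.countP_eq_zero]
  intro p hp
  have := (h p hp).1
  simp; omega

/-- The multiset of letters of weight `i` in a word. -/
def weightLetters (i : ℕ) (l : List (ℕ × G)) : Multiset G :=
  ((l.filter fun p => p.1 = i).map Prod.snd : List G)

theorem weightLetters_append (i : ℕ) (l l' : List (ℕ × G)) :
    weightLetters i (l ++ l') = weightLetters i l + weightLetters i l' := by
  simp [weightLetters]

theorem card_weightLetters (i : ℕ) (l : List (ℕ × G)) :
    (weightLetters i l).card = weightCount i l := by
  simp [weightLetters, weightCount, List.countP_eq_length_filter]

theorem weightLetters_map_mk_of_ne {i k : ℕ} (h : k ≠ i) (w : List G) :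
    weightLetters i (w.map fun y => (k, y)) = 0 := by
  rw [← Multiset.card_eq_zero, card_weightLetters]
  simpa [h] using weightCount_map_mk_le i k w

theorem mem_weightLetters {i : ℕ} {l : List (ℕ × G)} {a : G} :
    a ∈ weightLetters i l ↔ (i, a) ∈ l := by
  simp [weightLetters]

theorem exists_move_letter {T : ℕ → Set G} {c L : ℕ} (hT : LetterSystem T c)
    (hL : ∀ i j, 1 ≤ i → 1 ≤ j → ∀ a ∈ T i, ∀ b ∈ T j,
      ∃ w : List G, w.length ≤ L ∧ (∀ y ∈ w, y ∈ T (i + j)) ∧ w.prod = ⁅a, b⁆)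
    {i : ℕ} (hi : 1 ≤ i) {a : G} (ha : a ∈ T i) (l : List (ℕ × G)) (hl : ValidWord T i l) :
    ∃ l', wordVal l * a = a * wordVal l' ∧ ValidWord T i l' ∧
      weightLetters i l' = weightLetters i l ∧
      ∀ j, weightCount (j + i) l' ≤ weightCount (j + i) l + L * weightCount j l := by
  induction l with
  | nil => exact ⟨[], by simp [wordVal], hl, rfl, fun j => by simp [weightCount]⟩
  | cons p l ih =>
    obtain ⟨l', h1, h2, h3, h4⟩ := ih fun q hq => hl q (List.mem_cons_of_mem _ hq)
    obtain ⟨k, b⟩ := p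
    obtain ⟨hk, hb⟩ : i ≤ k ∧ b ∈ T k := hl _ List.mem_cons_self
    obtain ⟨w, hwL, hwT, hw⟩ := hL k i (hi.trans hk) hi b⁻¹ (hT.inv_mem _ _ hb) a⁻¹
      (hT.inv_mem _ _ ha)
    refine ⟨(k, b) :: ((w.map fun y => (k + i, y)) ++ l'), ?_, ?_, ?_, ?_⟩
    · rw [wordVal_cons, wordVal_cons, wordVal_append, wordVal_map_mk, hw, mul_assoc, h1]
      simp only [commutatorElement_def]
      group
    · intro q hq
      rcases List.mem_cons.1 hq with rfl | hq
      · exact ⟨hk, hb⟩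
      rcases List.mem_append.1 hq with hq | hq
      · obtain ⟨y, hy, rfl⟩ := List.mem_map.1 hq
        exact ⟨by simp, hwT y hy⟩
      · exact h2 q hq
    · rw [← List.singleton_append, weightLetters_append, weightLetters_append,
        weightLetters_map_mk_of_ne (by omega), zero_add, h3, ← weightLetters_append,
        List.singleton_append]
    · intro j
      have h5 := weightCount_map_mk_le (j + i) (k + i) w
      have h6 := h4 j
      rw [← List.singleton_append, weightCount_append, weightCount_append,
        ← List.singleton_append (l := l), weightCount_append, weightCount_append, mul_add]
      have h7 : weightCount (j + i) (w.map fun y => (k + i, y)) ≤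
          L * weightCount j [(k, b)] := by
        refine h5.trans ?_
        by_cases hkj : k = j
        · subst hkj
          simpa [weightCount] using hwL
        · simp [hkj]
      omega

/-- The number of letters of weight `j` is at most `B * n ^ j`. -/
def BoundedWord (B : ℝ) (n : ℕ) (l : List (ℕ × G)) : Prop :=
  ∀ j, (weightCount j l : ℝ) ≤ B * (n : ℝ) ^ j

theorem exists_pull_letters {T : ℕ → Set G} {c L : ℕ} (hT : LetterSystem T c)
    (hL : ∀ i j, 1 ≤ i → 1 ≤ j → ∀ a ∈ T i, ∀ b ∈ T j,
      ∃ w : List G, w.length ≤ L ∧ (∀ y ∈ w, y ∈ T (i + j)) ∧ w.prod = ⁅a, b⁆)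
    {i : ℕ} (hi : 1 ≤ i) {n : ℕ} (hn : 1 ≤ n) (r : List G) :
    ∀ (B : ℝ) (l : List (ℕ × G)), ValidWord T i l → BoundedWord B n l →
      (r : Multiset G) ≤ weightLetters i l →
      ∃ l', wordVal l = r.prod * wordVal l' ∧ ValidWord T i l' ∧
        weightLetters i l = r + weightLetters i l' ∧
        BoundedWord (B * (1 + L / (n : ℝ) ^ i) ^ r.length) n l' := by
  induction r with
  | nil => intro B l hl hB _; exact ⟨l, by simp, hl, by simp, by simpa using hB⟩
  | cons a r ih =>
    intro B l hl hB hr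
    have ha : (i, a) ∈ l := mem_weightLetters.1 (Multiset.mem_of_le hr (by simp))
    have haT : a ∈ T i := (hl _ ha).2
    obtain ⟨l₁, l₂, rfl⟩ := List.append_of_mem ha
    have hl₁ : ValidWord T i l₁ := fun q hq => hl q (List.mem_append_left _ hq)
    obtain ⟨l₁', h1, h2, h3, h4⟩ := exists_move_letter hT hL hi haT l₁ hl₁
    have hl' : ValidWord T i (l₁' ++ l₂) := by
      intro q hq
      rcases List.mem_append.1 hq with hq | hq
      · exact h2 q hq
      · exact hl q (List.mem_append_right _ (List.mem_cons_of_mem _ hq))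
    have hsplit : weightLetters i (l₁ ++ (i, a) :: l₂) = a ::ₘ weightLetters i (l₁' ++ l₂) := by
      rw [weightLetters_append, weightLetters_append, h3, ← List.singleton_append,
        weightLetters_append, ← Multiset.singleton_add, add_left_comm]
      simp [weightLetters]
    have hBl : BoundedWord (B * (1 + L / (n : ℝ) ^ i)) n (l₁' ++ l₂) := by
      intro j
      have hn0 : (0 : ℝ) < n := by exact_mod_cast hn
      rcases Nat.lt_or_ge j i with hj | hj
      · rw [hl'.weightCount_eq_zero hj]
        have h5 := hB 0
        rw [pow_zero, mul_one] at h5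
        have : 0 ≤ B := (Nat.cast_nonneg _).trans h5
        rw [Nat.cast_zero]
        positivity
      · obtain ⟨j, rfl⟩ : ∃ k, j = k + i := ⟨j - i, by omega⟩
        have h5 := hB (j + i)
        have h6 := hB j
        have h7 := h4 j
        have h8 : ∀ j, weightCount j (l₁ ++ (i, a) :: l₂) = weightCount j l₁ +
            (weightCount j [(i, a)] + weightCount j l₂) := by
          intro j
          rw [weightCount_append, ← List.singleton_append (l := l₂), weightCount_append]
        have h9 : weightCount (j + i) (l₁' ++ l₂) ≤
            weightCount (j + i) (l₁ ++ (i, a) :: l₂) + L * weightCount j (l₁ ++ (i, a) :: l₂) := by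
          rw [weightCount_append, h8, h8]
          nlinarith
        have h10 : (weightCount (j + i) (l₁' ++ l₂) : ℝ) ≤
            weightCount (j + i) (l₁ ++ (i, a) :: l₂) + L * weightCount j (l₁ ++ (i, a) :: l₂) := by
          exact_mod_cast h9
        have h11 : B * (1 + L / (n : ℝ) ^ i) * (n : ℝ) ^ (j + i) =
            B * (n : ℝ) ^ (j + i) + L * (B * (n : ℝ) ^ j) := by
          rw [pow_add]; field_simp
        rw [h11]
        exact h10.trans (add_le_add h5 (mul_le_mul_of_nonneg_left h6 (Nat.cast_nonneg _)))
    rw [hsplit, ← Multiset.cons_coe, Multiset.cons_le_cons_iff] at hr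
    obtain ⟨l', h5, h6, h7, h8⟩ := ih _ _ hl' hBl hr
    refine ⟨l', ?_, h6, ?_, ?_⟩
    · rw [List.prod_cons, mul_assoc, ← h5, wordVal_append, wordVal_append, wordVal_cons,
        ← mul_assoc, h1, mul_assoc]
    · rw [hsplit, h7, ← Multiset.cons_coe, Multiset.cons_add]
    · rw [List.length_cons, pow_succ']
      rwa [mul_assoc] at h8

end Collection

section Reduction

open scoped commutatorElement

variable {G : Type*}

/-- **Dickson's lemma** for multisets supported in a finite set. -/
theorem Set.Finite.exists_finite_minimal_multisets {T : Set G} (hT : T.Finite)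
    (P : Multiset G → Prop) :
    ∃ A : Set (Multiset G), A.Finite ∧ (∀ M ∈ A, P M) ∧
      ∀ M : Multiset G, (∀ x ∈ M, x ∈ T) → P M → ∃ M₀ ∈ A, M₀ ≤ M := by
  classical
  have := hT.to_subtype
  have hmono : Monotone fun f : T →₀ ℕ => (Finsupp.toMultiset f).map Subtype.val :=
    fun f g h => Multiset.map_le_map (Finsupp.toMultiset_strictMono.monotone h)
  have hpwo := (Set.isPWO_of_wellQuasiOrderedLE (Set.univ : Set (T →₀ ℕ))).image_of_monotone hmono
  set A₀ : Set (Multiset G) := {M | (∀ x ∈ M, x ∈ T) ∧ P M}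
  have hA₀ : A₀.IsPWO := by
    refine hpwo.mono fun M hM => ?_
    refine ⟨Multiset.toFinsupp (M.attach.map fun x => ⟨x.1, hM.1 _ x.2⟩), trivial, ?_⟩
    simp [Multiset.map_map, Function.comp_def]
  refine ⟨{M | Minimal (· ∈ A₀) M}, ?_, fun M hM => hM.1.2, fun M h1 h2 => ?_⟩
  · exact (setOfPred_minimal_antichain _).finite_of_partiallyWellOrderedOn
      (hA₀.mono fun M hM => hM.1)
  · obtain ⟨M₀, hle, hmin⟩ := exists_minimal_le_of_wellFoundedLT (· ∈ A₀) M ⟨h1, h2⟩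
    exact ⟨M₀, hmin, hle⟩

variable [Group G]

theorem mk_prod_eq_of_perm {i : ℕ} {l l' : List G} (h : l.Perm l') (hl : ∀ x ∈ l, x ∈ lcs G i) :
    ((l.prod : G) : G ⧸ lcs G (i + 1)) = (l'.prod : G) := by
  have h1 : ∀ l : List G, ((l.prod : G) : G ⧸ lcs G (i + 1)) =
      (l.map (QuotientGroup.mk' (lcs G (i + 1)))).prod := fun l =>
    map_list_prod (QuotientGroup.mk' (lcs G (i + 1))) l
  rw [h1, h1]
  refine (h.map _).prod_eq' ?_
  rw [List.pairwise_map]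
  exact List.pairwise_of_forall_mem_list fun a ha b _ => mk_lcs_commute (hl a ha) b

theorem LetterSystem.exists_relation_bound {T : ℕ → Set G} {c : ℕ} (hT : LetterSystem T c) {i : ℕ}
    (hi : 1 ≤ i) : ∃ Λ : ℕ, ∀ M : List G, (∀ x ∈ M, x ∈ T i) → M ≠ [] →
      M.prod ∈ lcs G (i + 1) → ∃ r : List G, r ≠ [] ∧ (r : Multiset G) ≤ M ∧
        ∃ w : List G, w.length ≤ Λ ∧ (∀ y ∈ w, y ∈ T (i + 1)) ∧ w.prod = r.prod := by
  obtain ⟨A, hAfin, hA, hA'⟩ := (hT.finite i).exists_finite_minimal_multisets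
    fun M => M ≠ 0 ∧ M.toList.prod ∈ lcs G (i + 1)
  choose! w hw hwp using fun (x : G) (hx : x ∈ lcs G (i + 1)) => hT.exists_word (by omega) hx
  obtain ⟨Λ, hΛ⟩ := (hAfin.image fun M => (w M.toList.prod).length).bddAbove
  refine ⟨Λ, fun M hM hM0 hMp => ?_⟩
  obtain ⟨M₀, hM₀, hle⟩ := hA' (M : Multiset G) hM ⟨by simpa using hM0, by
    rw [← QuotientGroup.eq_one_iff] at hMp ⊢
    rw [← hMp]
    refine (mk_prod_eq_of_perm (Multiset.coe_eq_coe.1 (Multiset.coe_toList _).symm) ?_).symm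
    exact fun x hx => hT.subset hi (hM x hx)⟩
  refine ⟨M₀.toList, by simpa using (hA M₀ hM₀).1, by simpa using hle,
    w M₀.toList.prod, hΛ ⟨M₀, hM₀, rfl⟩, hw _ (hA M₀ hM₀).2, hwp _ (hA M₀ hM₀).2⟩

theorem ValidWord.mk_wordVal {T : ℕ → Set G} {c : ℕ} (hT : LetterSystem T c) {i : ℕ} (hi : 1 ≤ i)
    (l : List (ℕ × G)) (hl : ValidWord T i l) :
    ((wordVal l : G) : G ⧸ lcs G (i + 1)) =
      (((l.filter fun p => p.1 = i).map Prod.snd).prod : G) := by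
  induction l with
  | nil => rfl
  | cons p l ih =>
    have ih := ih fun q hq => hl q (List.mem_cons_of_mem _ hq)
    obtain ⟨hp, hpT⟩ := hl p List.mem_cons_self
    rw [wordVal_cons, QuotientGroup.mk_mul, ih]
    by_cases h : p.1 = i
    · rw [List.filter_cons_of_pos (by simpa using h), List.map_cons, List.prod_cons,
        QuotientGroup.mk_mul]
    · rw [List.filter_cons_of_neg (by simpa using h)]
      have : p.2 ∈ lcs G (i + 1) :=
        lcs_antitone G (by omega : i + 1 ≤ p.1) (hT.subset (by omega) hpT)
      rw [(QuotientGroup.eq_one_iff _).2 this, one_mul]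

theorem BoundedWord.nonneg {B : ℝ} {n : ℕ} {l : List (ℕ × G)} (h : BoundedWord B n l) : 0 ≤ B := by
  have h5 := h 0
  rw [pow_zero, mul_one] at h5
  exact (Nat.cast_nonneg _).trans h5

theorem BoundedWord.mono {B B' : ℝ} {n : ℕ} {l : List (ℕ × G)} (h : BoundedWord B n l)
    (hB : B ≤ B') : BoundedWord B' n l := fun j =>
  (h j).trans (mul_le_mul_of_nonneg_right hB (by positivity))

theorem exists_reduction {T : ℕ → Set G} {c L Λ : ℕ} (hT : LetterSystem T c)
    (hL : ∀ i j, 1 ≤ i → 1 ≤ j → ∀ a ∈ T i, ∀ b ∈ T j,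
      ∃ w : List G, w.length ≤ L ∧ (∀ y ∈ w, y ∈ T (i + j)) ∧ w.prod = ⁅a, b⁆)
    {i : ℕ} (hi : 1 ≤ i)
    (hΛ : ∀ M : List G, (∀ x ∈ M, x ∈ T i) → M ≠ [] →
      M.prod ∈ lcs G (i + 1) → ∃ r : List G, r ≠ [] ∧ (r : Multiset G) ≤ M ∧
        ∃ w : List G, w.length ≤ Λ ∧ (∀ y ∈ w, y ∈ T (i + 1)) ∧ w.prod = r.prod)
    {n : ℕ} (hn : 1 ≤ n) (k : ℕ) :
    ∀ (B : ℝ) (l : List (ℕ × G)), ValidWord T i l → BoundedWord B n l → weightCount i l ≤ k →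
      wordVal l ∈ lcs G (i + 1) →
      ∃ (w : List G) (E : List (ℕ × G)), wordVal l = w.prod * wordVal E ∧
        (∀ y ∈ w, y ∈ T (i + 1)) ∧ w.length ≤ Λ * k ∧ ValidWord T (i + 1) E ∧
        BoundedWord (B * (1 + L / (n : ℝ) ^ i) ^ k) n E := by
  induction k using Nat.strong_induction_on with
  | _ k ih =>
  intro B l hl hB hk hlcs
  have hone : (1 : ℝ) ≤ 1 + L / (n : ℝ) ^ i := le_add_of_nonneg_right (by positivity)
  by_cases h0 : weightCount i l = 0
  · refine ⟨[], l, by simp, by simp, by simp, fun p hp => ?_, ?_⟩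
    · obtain ⟨h1, h2⟩ := hl p hp
      refine ⟨?_, h2⟩
      rw [weightCount, List.countP_eq_zero] at h0
      have := h0 p hp
      simp only [decide_eq_true_eq] at this
      omega
    · exact hB.mono (le_mul_of_one_le_right hB.nonneg (one_le_pow₀ hone))
  · set M := (l.filter fun p => p.1 = i).map Prod.snd with hM
    have hMT : ∀ x ∈ M, x ∈ T i := by
      intro x hx
      have : x ∈ weightLetters i l := hx
      exact (hl _ (mem_weightLetters.1 this)).2
    have hM0 : M ≠ [] := by
      intro h
      apply h0
      rw [← card_weightLetters]
      change ((M : Multiset G)).card = 0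
      rw [h]; rfl
    obtain ⟨r, hr0, hrM, w, hwΛ, hwT, hwr⟩ := hΛ M hMT hM0 (by
      rw [← QuotientGroup.eq_one_iff] at hlcs ⊢
      rw [← hlcs, ValidWord.mk_wordVal hT hi l hl])
    obtain ⟨l', h1, h2, h3, h4⟩ := exists_pull_letters hT hL hi hn r B l hl hB hrM
    have hcard : weightCount i l = r.length + weightCount i l' := by
      rw [← card_weightLetters, h3, Multiset.card_add, card_weightLetters, Multiset.coe_card]
    have hrpos : 0 < r.length := List.length_pos_iff.2 hr0
    have hwl : w.prod ∈ lcs G (i + 1) :=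
      Subgroup.list_prod_mem _ fun y hy => hT.subset (by omega) (hwT y hy)
    obtain ⟨w', E, h5, h6, h7, h8, h9⟩ := ih (k - r.length) (by omega) _ l' h2 h4 (by omega) (by
      rw [h1, ← hwr] at hlcs
      exact (Subgroup.mul_mem_cancel_left _ hwl).1 hlcs)
    refine ⟨w ++ w', E, ?_, ?_, ?_, h8, ?_⟩
    · rw [h1, h5, List.prod_append, hwr, mul_assoc]
    · intro y hy
      rcases List.mem_append.1 hy with hy | hy
      · exact hwT y hy
      · exact h6 y hy
    · rw [List.length_append]
      have : k = (k - r.length) + r.length := by omega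
      calc w.length + w'.length ≤ Λ * r.length + Λ * (k - r.length) :=
            add_le_add (hwΛ.trans (Nat.le_mul_of_pos_right _ hrpos)) h7
        _ = Λ * k := by rw [← mul_add]; congr 1; omega
    · rw [mul_assoc, ← pow_add] at h9
      rwa [show r.length + (k - r.length) = k by omega] at h9

theorem exists_raise_weight {T : ℕ → Set G} {c : ℕ} (hT : LetterSystem T c) {i : ℕ} (hi : 1 ≤ i)
    (B : ℝ) : ∃ B' : ℝ, ∀ n : ℕ, 1 ≤ n → ∀ l : List (ℕ × G), ValidWord T i l → BoundedWord B n l →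
      wordVal l ∈ lcs G (i + 1) →
      ∃ l', wordVal l' = wordVal l ∧ ValidWord T (i + 1) l' ∧ BoundedWord B' n l' := by
  obtain ⟨L, hL⟩ := hT.exists_commutator_bound
  obtain ⟨Λ, hΛ⟩ := hT.exists_relation_bound hi
  refine ⟨Λ * B + B * Real.exp (L * B), fun n hn l hl hB hlcs => ?_⟩
  obtain ⟨w, E, h1, h2, h3, h4, h5⟩ := exists_reduction hT hL hi hΛ hn _ B l hl hB le_rfl hlcs
  have hn1 : (1 : ℝ) ≤ n := by exact_mod_cast hn
  have hn0 : (0 : ℝ) < (n : ℝ) ^ i := by positivity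
  have hB0 := hB.nonneg
  have hexp : (1 + L / (n : ℝ) ^ i) ^ weightCount i l ≤ Real.exp (L * B) := by
    calc (1 + L / (n : ℝ) ^ i) ^ weightCount i l
        ≤ Real.exp (L / (n : ℝ) ^ i) ^ weightCount i l :=
          pow_le_pow_left₀ (by positivity) (by linarith [Real.add_one_le_exp (L / (n : ℝ) ^ i)]) _
      _ = Real.exp (weightCount i l * (L / (n : ℝ) ^ i)) := (Real.exp_nat_mul _ _).symm
      _ ≤ Real.exp (L * B) := by
          refine Real.exp_le_exp.2 ?_
          calc weightCount i l * (L / (n : ℝ) ^ i) ≤ (B * n ^ i) * (L / (n : ℝ) ^ i) :=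
                mul_le_mul_of_nonneg_right (hB i) (by positivity)
            _ = L * B := by field_simp
  refine ⟨(w.map fun y => (i + 1, y)) ++ E, ?_, ?_, fun j => ?_⟩
  · rw [wordVal_append, wordVal_map_mk, h1]
  · intro q hq
    rcases List.mem_append.1 hq with hq | hq
    · obtain ⟨y, hy, rfl⟩ := List.mem_map.1 hq
      exact ⟨le_rfl, h2 y hy⟩
    · exact h4 q hq
  · rw [weightCount_append, Nat.cast_add, add_mul]
    refine add_le_add ?_ ((h5 j).trans ?_)
    · have h6 := weightCount_map_mk_le j (i + 1) w
      split_ifs at h6 with hj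
      · subst hj
        calc (weightCount (i + 1) (w.map fun y => (i + 1, y)) : ℝ) ≤ (Λ * weightCount i l : ℕ) := by
              exact_mod_cast h6.trans h3
          _ = Λ * weightCount i l := by push_cast; rfl
          _ ≤ Λ * (B * n ^ i) := mul_le_mul_of_nonneg_left (hB i) (Nat.cast_nonneg _)
          _ ≤ Λ * (B * n ^ (i + 1)) := by gcongr; omega
          _ = Λ * B * n ^ (i + 1) := by ring
      · rw [Nat.le_zero.1 h6, Nat.cast_zero]
        positivity
    · gcongr

theorem exists_short_word_last {T : ℕ → Set G} {c : ℕ} (hT : LetterSystem T c) (hc : 1 ≤ c)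
    (B : ℕ) : ∃ K : ℕ, ∀ n : ℕ, 1 ≤ n → ∀ w : List G, (∀ y ∈ w, y ∈ T 1) → w.length ≤ B * n →
      w.prod ∈ lcs G c →
      ∃ w' : List G, w'.prod = w.prod ∧ (∀ y ∈ w', y ∈ T c) ∧ w'.length ≤ K * n ^ c := by
  have key : ∀ i, 1 ≤ i → ∃ B' : ℝ, ∀ n : ℕ, 1 ≤ n → ∀ w : List G, (∀ y ∈ w, y ∈ T 1) →
      w.length ≤ B * n → w.prod ∈ lcs G i →
      ∃ l, wordVal l = w.prod ∧ ValidWord T i l ∧ BoundedWord B' n l := by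
    intro i hi
    induction i, hi using Nat.le_induction with
    | base =>
      refine ⟨B, fun n hn w hw hwB _ => ⟨w.map fun y => (1, y), wordVal_map_mk 1 w, ?_, ?_⟩⟩
      · intro q hq
        obtain ⟨y, hy, rfl⟩ := List.mem_map.1 hq
        exact ⟨le_rfl, hw y hy⟩
      · intro j
        have h6 := weightCount_map_mk_le j 1 w
        split_ifs at h6 with hj
        · subst hj
          rw [pow_one]
          exact_mod_cast h6.trans hwB
        · rw [Nat.le_zero.1 h6, Nat.cast_zero]
          positivity
    | succ i hi ih =>
      obtain ⟨B', hB'⟩ := ih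
      obtain ⟨B'', hB''⟩ := exists_raise_weight hT hi B'
      refine ⟨B'', fun n hn w hw hwB hwl => ?_⟩
      obtain ⟨l, h1, h2, h3⟩ := hB' n hn w hw hwB (lcs_antitone G (by omega) hwl)
      obtain ⟨l', h4, h5, h6⟩ := hB'' n hn l h2 h3 (h1 ▸ hwl)
      exact ⟨l', h4.trans h1, h5, h6⟩
  obtain ⟨B', hB'⟩ := key c hc
  refine ⟨⌈B'⌉₊, fun n hn w hw hwB hwl => ?_⟩
  obtain ⟨l, h1, h2, h3⟩ := hB' n hn w hw hwB hwl
  have hwt : ∀ p ∈ l, p.1 = c := by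
    intro p hp
    obtain ⟨h4, h5⟩ := h2 p hp
    by_contra h
    rw [hT.eq_empty p.1 (by omega)] at h5
    exact h5
  refine ⟨l.map Prod.snd, h1, fun y hy => ?_, ?_⟩
  · obtain ⟨p, hp, rfl⟩ := List.mem_map.1 hy
    exact hwt p hp ▸ (h2 p hp).2
  · have h4 : weightCount c l = l.length := by
      rw [weightCount, List.countP_eq_length]
      simpa using hwt
    rw [List.length_map, ← h4]
    have h5 := h3 c
    have h6 : (weightCount c l : ℝ) ≤ (⌈B'⌉₊ : ℝ) * (n : ℝ) ^ c :=
      h5.trans (mul_le_mul_of_nonneg_right (Nat.le_ceil _) (by positivity))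
    exact_mod_cast h6

end Reduction

section Distortion

open scoped commutatorElement Pointwise

variable {G : Type*} [Group G]

/-- A finite symmetric subset containing `1` whose powers exhaust the group. -/
structure SymmetricGenerators (T : Set G) : Prop where
  finite : T.Finite
  one_mem : (1 : G) ∈ T
  inv_mem : ∀ x ∈ T, x⁻¹ ∈ T
  exists_mem_pow : ∀ g, ∃ n, g ∈ T ^ n

namespace SymmetricGenerators

variable {T : Set G} (hT : SymmetricGenerators T)

include hT

theorem pow_mono {m n : ℕ} (h : m ≤ n) : T ^ m ⊆ T ^ n := Set.pow_mono_of_one_mem hT.one_mem h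

theorem inv_mem_pow {n : ℕ} {x : G} (hx : x ∈ T ^ n) : x⁻¹ ∈ T ^ n := by
  have h1 : T⁻¹ = T := by
    ext y
    exact ⟨fun hy => by simpa using hT.inv_mem _ hy, fun hy => hT.inv_mem _ hy⟩
  have h2 : x⁻¹ ∈ (T ^ n)⁻¹ := by simpa using hx
  rwa [← inv_pow, h1] at h2

theorem closure_eq : Subgroup.closure T = ⊤ := by
  refine (Subgroup.eq_top_iff' _).2 fun g => ?_
  obtain ⟨n, hn⟩ := hT.exists_mem_pow g
  obtain ⟨f, rfl⟩ := Set.mem_pow.1 hn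
  refine Subgroup.list_prod_mem _ fun x hx => ?_
  obtain ⟨i, rfl⟩ := List.mem_ofFn.1 hx
  exact Subgroup.subset_closure (f i).2

theorem map {H : Type*} [Group H] (f : G →* H) (hf : Function.Surjective f) :
    SymmetricGenerators (f '' T) where
  finite := hT.finite.image f
  one_mem := ⟨1, hT.one_mem, map_one f⟩
  inv_mem := by
    rintro _ ⟨x, hx, rfl⟩
    exact ⟨x⁻¹, hT.inv_mem x hx, map_inv f x⟩
  exists_mem_pow g := by
    obtain ⟨x, rfl⟩ := hf g
    obtain ⟨n, hn⟩ := hT.exists_mem_pow x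
    exact ⟨n, Set.image_pow f T n ▸ ⟨x, hn, rfl⟩⟩

theorem exists_power_approx {i : ℕ} (hi : 1 ≤ i) : ∀ y ∈ lcs G i, ∃ C : ℕ, ∀ p : ℕ,
    ∃ y' ∈ T ^ (C * p), ((y' : G) : G ⧸ lcs G (i + 1)) = (y : G ⧸ lcs G (i + 1)) ^ p ^ i := by
  induction i, hi using Nat.le_induction with
  | base =>
    intro y _
    obtain ⟨C, hC⟩ := hT.exists_mem_pow y
    exact ⟨C, fun p => ⟨y ^ p, pow_mul T C p ▸ Set.pow_mem_pow hC, by simp⟩⟩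
  | succ i hi ih =>
    intro y hy
    rw [lcs_succ G hi, Subgroup.commutator_def] at hy
    have key : y ∈ lcs G (i + 1) ∧ ∃ C : ℕ, ∀ p : ℕ, ∃ y' ∈ T ^ (C * p),
        ((y' : G) : G ⧸ lcs G (i + 1 + 1)) = (y : G ⧸ lcs G (i + 1 + 1)) ^ p ^ (i + 1) := by
      induction hy using Subgroup.closure_induction with
      | mem y hy =>
        obtain ⟨x, hx, s, -, rfl⟩ := hy
        have hs : s ∈ lcs G 1 := lcs_one G ▸ Subgroup.mem_top s
        refine ⟨commutatorElement_mem_lcs hx hs, ?_⟩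
        obtain ⟨C, hC⟩ := ih x hx
        obtain ⟨m, hm⟩ := hT.exists_mem_pow s
        refine ⟨C + m + C + m, fun p => ?_⟩
        obtain ⟨x', hx', hxx⟩ := hC p
        have hsp : s ^ p ∈ T ^ (m * p) := pow_mul T m p ▸ Set.pow_mem_pow hm
        refine ⟨⁅x', s ^ p⁆, ?_, ?_⟩
        · rw [commutatorElement_def, add_mul, add_mul, add_mul, pow_add, pow_add, pow_add]
          exact Set.mul_mem_mul (Set.mul_mem_mul (Set.mul_mem_mul hx' hsp) (hT.inv_mem_pow hx'))
            (hT.inv_mem_pow hsp)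
        · obtain ⟨e, rfl⟩ : ∃ e, x' = x ^ p ^ i * e := ⟨(x ^ p ^ i)⁻¹ * x', by group⟩
          have he : e ∈ lcs G (i + 1) := by
            rw [← QuotientGroup.eq_one_iff]
            rw [QuotientGroup.mk_mul, QuotientGroup.mk_pow] at hxx
            exact mul_eq_left.1 hxx
          have hspl : s ^ p ∈ lcs G 1 := lcs_one G ▸ Subgroup.mem_top _
          rw [mk_commutator_mul_left (lcs_antitone G (Nat.le_succ i) he) hspl,
            mk_commutator_pow hx hs,
            (QuotientGroup.eq_one_iff ⁅e, s ^ p⁆).2 (commutatorElement_mem_lcs he hspl), mul_one,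
            pow_succ]
      | one => exact ⟨Subgroup.one_mem _, 0, fun p => ⟨1, by simp, by simp⟩⟩
      | mul x y _ _ hx hy =>
        obtain ⟨hx, Cx, hCx⟩ := hx
        obtain ⟨hy, Cy, hCy⟩ := hy
        refine ⟨Subgroup.mul_mem _ hx hy, Cx + Cy, fun p => ?_⟩
        obtain ⟨x', hx', hxx⟩ := hCx p
        obtain ⟨y', hy', hyy⟩ := hCy p
        refine ⟨x' * y', ?_, ?_⟩
        · rw [add_mul, pow_add]
          exact Set.mul_mem_mul hx' hy'
        · rw [QuotientGroup.mk_mul, hxx, hyy, QuotientGroup.mk_mul, (mk_lcs_commute hx y).mul_pow]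
      | inv x _ hx =>
        obtain ⟨hx, C, hC⟩ := hx
        refine ⟨Subgroup.inv_mem _ hx, C, fun p => ?_⟩
        obtain ⟨x', hx', hxx⟩ := hC p
        exact ⟨x'⁻¹, hT.inv_mem_pow hx', by
          rw [QuotientGroup.mk_inv, hxx, QuotientGroup.mk_inv, inv_pow]⟩
    exact key.2

theorem exists_pow_mem {c : ℕ} (hc1 : 1 ≤ c) (hc : lcs G (c + 1) = ⊥) {y : G} (hy : y ∈ lcs G c) :
    ∃ C : ℕ, ∀ m q : ℕ, q ≤ m ^ c → y ^ q ∈ T ^ (C * m) := by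
  obtain ⟨C, hC⟩ := hT.exists_power_approx hc1 y hy
  have hC' : ∀ p : ℕ, y ^ p ^ c ∈ T ^ (C * p) := by
    intro p
    obtain ⟨y', hy', h⟩ := hC p
    rw [← QuotientGroup.mk_pow, QuotientGroup.eq, hc, Subgroup.mem_bot, inv_mul_eq_one] at h
    exact h ▸ hy'
  have key : ∀ k q : ℕ, q < 2 ^ (c * k) → y ^ q ∈ T ^ (2 ^ c * C * 2 ^ k) := by
    intro k
    induction k with
    | zero =>
      intro q hq
      have : q = 0 := by simpa using hq
      rw [this, pow_zero y]
      exact Set.one_mem_pow hT.one_mem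
    | succ k ih =>
      intro q hq
      have hpos : 0 < 2 ^ (c * k) := by positivity
      have hq' : q / 2 ^ (c * k) < 2 ^ c := by
        rw [Nat.div_lt_iff_lt_mul hpos, ← pow_add]
        convert hq using 2; ring
      have h1 := ih _ (Nat.mod_lt q hpos)
      have h2 : (y ^ (2 ^ k) ^ c) ^ (q / 2 ^ (c * k)) ∈ T ^ (2 ^ c * C * 2 ^ k) := by
        have h3 := Set.pow_mem_pow (n := q / 2 ^ (c * k)) (hC' (2 ^ k))
        rw [← pow_mul] at h3
        refine hT.pow_mono ?_ h3
        calc C * 2 ^ k * (q / 2 ^ (c * k)) ≤ C * 2 ^ k * 2 ^ c := Nat.mul_le_mul_left _ hq'.le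
          _ = 2 ^ c * C * 2 ^ k := by ring
      have h4 : y ^ q = (y ^ (2 ^ k) ^ c) ^ (q / 2 ^ (c * k)) * y ^ (q % 2 ^ (c * k)) := by
        rw [← pow_mul, ← pow_mul, ← pow_add, mul_comm k c, Nat.div_add_mod]
      rw [h4, pow_succ, ← mul_assoc, mul_two, pow_add]
      exact Set.mul_mem_mul h2 h1
  refine ⟨2 ^ c * C * 2, fun m q hq => ?_⟩
  rcases Nat.eq_zero_or_pos m with rfl | hm
  · have : q = 0 := by simpa [show c ≠ 0 by omega] using hq
    simp [this]
  · have h1 : m < 2 ^ (Nat.log 2 m + 1) := Nat.lt_pow_succ_log_self (by norm_num) m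
    have h2 : 2 ^ Nat.log 2 m ≤ m := Nat.pow_log_le_self 2 hm.ne'
    refine hT.pow_mono ?_ (key (Nat.log 2 m + 1) q (hq.trans_lt ?_))
    · calc 2 ^ c * C * 2 ^ (Nat.log 2 m + 1) = 2 ^ c * C * 2 * 2 ^ Nat.log 2 m := by ring
        _ ≤ 2 ^ c * C * 2 * m := Nat.mul_le_mul_left _ h2
    · rw [mul_comm c, pow_mul]
      exact Nat.pow_lt_pow_left h1 (by omega)

end SymmetricGenerators

end Distortion

section Doubling

open scoped commutatorElement Pointwise IsMulCommutative

universe u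

variable {G : Type*} [Group G]

namespace SymmetricGenerators

variable {T : Set G} (hT : SymmetricGenerators T)

include hT

theorem finite_pow (n : ℕ) : (T ^ n).Finite := hT.finite.pow_nat n

theorem ncard_pow_mono {m n : ℕ} (h : m ≤ n) : (T ^ m).ncard ≤ (T ^ n).ncard :=
  Set.ncard_le_ncard (hT.pow_mono h) (hT.finite_pow n)

theorem ncard_pow_pos (n : ℕ) : 0 < (T ^ n).ncard :=
  (Set.ncard_pos (hT.finite_pow n)).2 ⟨1, Set.one_mem_pow hT.one_mem⟩

theorem exists_prod_pow_mem {c : ℕ} (hc1 : 1 ≤ c) (hc : lcs G (c + 1) = ⊥)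
    (s : Finset (Subgroup.center G)) (hs : ∀ b ∈ s, (b : G) ∈ lcs G c) :
    ∃ C : ℕ, ∀ m : ℕ, ∀ r : Subgroup.center G → ℕ, (∀ b, r b ≤ m ^ c) →
      ((∏ b ∈ s, b ^ r b : Subgroup.center G) : G) ∈ T ^ (C * m) := by
  classical
  induction s using Finset.induction_on with
  | empty => exact ⟨0, fun m r _ => by simp⟩
  | insert a s ha ih =>
    obtain ⟨C, hC⟩ := ih fun b hb => hs b (Finset.mem_insert_of_mem hb)
    obtain ⟨C', hC'⟩ := hT.exists_pow_mem hc1 hc (hs a (Finset.mem_insert_self a s))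
    refine ⟨C' + C, fun m r hr => ?_⟩
    rw [Finset.prod_insert ha, add_mul, pow_add]
    exact Set.mul_mem_mul (hC' m (r a) (hr a)) (hC m r hr)

/-- The intersections of balls with the last term of the lower central series are doubling. -/
theorem exists_ncard_inter_le {c : ℕ} (hc1 : 1 ≤ c) (hc : lcs G (c + 1) = ⊥) :
    ∃ K n₀ : ℕ, ∀ n : ℕ, n₀ ≤ n → ((lcs G c : Set G) ∩ T ^ (16 * n)).ncard ≤
      K * ((lcs G c : Set G) ∩ T ^ n).ncard := by
  classical
  obtain ⟨R, hR, hR1⟩ := exists_letterSystem hT.finite hT.inv_mem hT.closure_eq hc1 hc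
  obtain ⟨K, hK⟩ := exists_short_word_last hR hc1 16
  have hcen : lcs G c ≤ Subgroup.center G := by
    intro x hx
    rw [Subgroup.mem_center_iff]
    intro g
    have h1 := commutatorElement_mem_lcs hx (lcs_one G ▸ Subgroup.mem_top g : g ∈ lcs G 1)
    rw [hc, Subgroup.mem_bot, commutatorElement_eq_one_iff_mul_comm] at h1
    exact h1.symm
  have hsfin : (Subtype.val ⁻¹' R c : Set (Subgroup.center G)).Finite :=
    (hR.finite c).preimage Subtype.val_injective.injOn
  set s := hsfin.toFinset with hs
  have hmem : ∀ b : Subgroup.center G, b ∈ s ↔ (b : G) ∈ R c := fun b => by simp [hs]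
  obtain ⟨C, hC⟩ := hT.exists_prod_pow_mem hc1 hc s fun b hb => hR.subset hc1 ((hmem b).1 hb)
  set Q := K * (4 * (C + 1)) ^ c
  refine ⟨(Q + 1) ^ s.card, 2 * (C + 1), fun n hn => ?_⟩
  obtain ⟨m, hm⟩ : ∃ m, m = n / (C + 1) := ⟨_, rfl⟩
  have hm1 : 1 ≤ m := by
    rw [hm, Nat.le_div_iff_mul_le (Nat.succ_pos C)]; omega
  have hmn : m * (C + 1) ≤ n := hm ▸ Nat.div_mul_le_self n (C + 1)
  have hnm : n < (m + 1) * (C + 1) := by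
    rw [hm]; exact Nat.lt_mul_of_div_lt (Nat.lt_succ_self _) (Nat.succ_pos C)
  have hn4 : n ≤ 4 * (C + 1) * m := by nlinarith
  have hpos : 0 < m ^ c := by positivity
  let X : Set G := Set.range fun q : s → Fin (Q + 1) =>
    ((∏ b : s, (b : Subgroup.center G) ^ (m ^ c * (q b : ℕ)) : Subgroup.center G) : G)
  have hX : X.ncard ≤ (Q + 1) ^ s.card := by
    calc X.ncard ≤ Nat.card (s → Fin (Q + 1)) := by
          rw [← Nat.card_coe_set_eq]
          exact Finite.card_range_le _
      _ = (Q + 1) ^ s.card := by simp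
  have hXfin : X.Finite := Set.finite_range _
  have hsub : (lcs G c : Set G) ∩ T ^ (16 * n) ⊆ X * ((lcs G c : Set G) ∩ T ^ n) := by
    rintro z ⟨hz, hzT⟩
    obtain ⟨f, rfl⟩ := Set.mem_pow.1 hzT
    obtain ⟨w, hw, hwT, hwl⟩ := hK n (by omega) (List.ofFn fun i => (f i : G)) (by
      intro y hy
      obtain ⟨i, rfl⟩ := List.mem_ofFn.1 hy
      exact hR1 ▸ (f i).2) (by simp) hz
    have hwc : ∀ y ∈ w, y ∈ Subgroup.center G := fun y hy => hcen (hR.subset hc1 (hwT y hy))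
    obtain ⟨v, rfl⟩ : ∃ v : List (Subgroup.center G), v.map Subtype.val = w :=
      ⟨w.attach.map fun x => ⟨x.1, hwc _ x.2⟩, by simp [List.map_map, Function.comp_def]⟩
    have hvprod : ((v.prod : Subgroup.center G) : G) = (v.map Subtype.val).prod :=
      map_list_prod (Subgroup.center G).subtype v
    obtain ⟨e, he, hvs⟩ : ∃ e : Subgroup.center G → ℕ, (∀ b, e b ≤ v.length) ∧
        v.prod = ∏ b ∈ s, b ^ e b := by
      have hvs := Finset.prod_list_count_of_subset v s fun b hb => ?_
      · exact ⟨fun b => @List.count _ instBEqOfDecidableEq b v,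
          fun b => @List.count_le_length _ instBEqOfDecidableEq b v, hvs⟩
      rw [hmem]
      exact hwT _ (List.mem_map_of_mem (List.mem_toFinset.1 hb))
    have hcount : ∀ b, e b / m ^ c ≤ Q := by
      intro b
      have h1 : e b ≤ K * n ^ c := by
        refine (he b).trans ?_
        simpa using hwl
      refine Nat.div_le_of_le_mul (h1.trans ?_)
      calc K * n ^ c ≤ K * (4 * (C + 1) * m) ^ c := by gcongr
        _ = m ^ c * Q := by rw [mul_pow]; ring
    rw [← hw, ← hvprod, hvs]
    have hsplit : ∏ b ∈ s, b ^ e b =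
        (∏ b ∈ s, b ^ (m ^ c * (e b / m ^ c))) * ∏ b ∈ s, b ^ (e b % m ^ c) := by
      rw [← Finset.prod_mul_distrib]
      refine Finset.prod_congr rfl fun b _ => ?_
      rw [← pow_add, Nat.div_add_mod]
    rw [hsplit, Subgroup.coe_mul]
    refine Set.mul_mem_mul ⟨fun b => ⟨e (b : Subgroup.center G) / m ^ c,
      Nat.lt_succ_of_le (hcount b)⟩, ?_⟩ ⟨?_, ?_⟩
    · simp only
      rw [Finset.prod_coe_sort s fun b => b ^ (m ^ c * (e b / m ^ c))]
    · have : (∏ b ∈ s, b ^ (e b % m ^ c)) ∈ (lcs G c).subgroupOf (Subgroup.center G) :=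
        Subgroup.prod_mem _ fun b hb => Subgroup.pow_mem _
          (Subgroup.mem_subgroupOf.2 (hR.subset hc1 ((hmem b).1 hb))) _
      exact Subgroup.mem_subgroupOf.1 this
    · exact hT.pow_mono (by nlinarith)
        (hC m (fun b => e b % m ^ c) fun b => (Nat.mod_lt _ hpos).le)
  calc ((lcs G c : Set G) ∩ T ^ (16 * n)).ncard
      ≤ (X * ((lcs G c : Set G) ∩ T ^ n)).ncard :=
        Set.ncard_le_ncard hsub (hXfin.mul ((hT.finite_pow n).inter_of_right _))
    _ ≤ X.ncard * ((lcs G c : Set G) ∩ T ^ n).ncard := by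
        simpa only [Nat.card_coe_set_eq] using Set.natCard_mul_le
    _ ≤ _ := Nat.mul_le_mul_right _ hX

theorem ncard_pow_le_quotient (N : Subgroup G) [N.Normal] (n : ℕ) :
    (T ^ n).ncard ≤ ((QuotientGroup.mk' N '' T) ^ n).ncard * ((N : Set G) ∩ T ^ (2 * n)).ncard := by
  classical
  have hfin := hT.finite_pow n
  have hfin' : ((N : Set G) ∩ T ^ (2 * n)).Finite := (hT.finite_pow _).inter_of_right _
  rw [← Set.image_pow]
  choose! s hs hs' using fun (q : G ⧸ N) (hq : q ∈ QuotientGroup.mk' N '' T ^ n) => hq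
  rw [← Set.ncard_prod]
  refine Set.ncard_le_ncard_of_injOn (fun x => ((x : G ⧸ N), (s x)⁻¹ * x)) ?_ ?_
    ((hfin.image _).prod hfin')
  · intro x hx
    have hq : (x : G ⧸ N) ∈ QuotientGroup.mk' N '' T ^ n := ⟨x, hx, rfl⟩
    refine ⟨hq, QuotientGroup.eq.1 (hs' _ hq), ?_⟩
    rw [two_mul, pow_add]
    exact Set.mul_mem_mul (hT.inv_mem_pow (hs _ hq)) hx
  · intro x _ y _ hxy
    simp only [Prod.mk.injEq] at hxy
    rw [hxy.1] at hxy
    exact mul_left_cancel hxy.2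

theorem quotient_mul_le_ncard_pow (N : Subgroup G) [N.Normal] (n : ℕ) :
    ((QuotientGroup.mk' N '' T) ^ n).ncard * ((N : Set G) ∩ T ^ n).ncard ≤ (T ^ (2 * n)).ncard := by
  classical
  rw [← Set.image_pow]
  choose! s hs hs' using fun (q : G ⧸ N) (hq : q ∈ QuotientGroup.mk' N '' T ^ n) => hq
  rw [← Set.ncard_prod]
  refine Set.ncard_le_ncard_of_injOn (fun p => s p.1 * p.2) ?_ ?_ (hT.finite_pow _)
  · rintro ⟨q, z⟩ ⟨hq, hz⟩
    rw [two_mul, pow_add]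
    exact Set.mul_mem_mul (hs q hq) hz.2
  · rintro ⟨q, z⟩ ⟨hq, hz⟩ ⟨q', z'⟩ ⟨hq', hz'⟩ h
    have h1 : ∀ q z, q ∈ QuotientGroup.mk' N '' T ^ n → z ∈ (N : Set G) ∩ T ^ n →
        QuotientGroup.mk' N (s q * z) = q := by
      intro q z hq hz
      rw [map_mul, hs' q hq, (QuotientGroup.eq_one_iff z).2 hz.1 |> fun h => (h : QuotientGroup.mk' N z = 1), mul_one]
    have h2 : q = q' := by
      rw [← h1 q z hq hz, ← h1 q' z' hq' hz']
      exact congrArg _ h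
    subst h2
    exact Prod.ext rfl (mul_left_cancel h)

theorem exists_doubling_of_large {D n₀ : ℕ}
    (h : ∀ n, n₀ ≤ n → (T ^ (2 * n)).ncard ≤ D * (T ^ n).ncard) :
    ∃ D : ℕ, ∀ n, (T ^ (2 * n)).ncard ≤ D * (T ^ n).ncard := by
  refine ⟨D + (T ^ (2 * n₀)).ncard, fun n => ?_⟩
  rcases le_or_gt n₀ n with hn | hn
  · exact (h n hn).trans (Nat.mul_le_mul_right _ (Nat.le_add_right _ _))
  · calc (T ^ (2 * n)).ncard ≤ (T ^ (2 * n₀)).ncard := hT.ncard_pow_mono (by omega)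
      _ ≤ (D + (T ^ (2 * n₀)).ncard) * 1 := by omega
      _ ≤ _ := Nat.mul_le_mul_left _ (hT.ncard_pow_pos n)

end SymmetricGenerators

theorem exists_doubling_of_lcs (c : ℕ) : ∀ {G : Type u} [Group G] {T : Set G},
    SymmetricGenerators T → lcs G (c + 1) = ⊥ →
    ∃ D : ℕ, ∀ n, (T ^ (2 * n)).ncard ≤ D * (T ^ n).ncard := by
  induction c with
  | zero =>
    intro G _ T hT hc
    rw [zero_add, lcs_one] at hc
    have : Subsingleton G := Subgroup.subsingleton_iff.1 (subsingleton_iff_bot_eq_top.1 hc.symm)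
    refine ⟨1, fun n => ?_⟩
    have h1 : (T ^ (2 * n)).ncard ≤ 1 := Set.ncard_le_one_of_subsingleton _
    have h2 := hT.ncard_pow_pos n
    omega
  | succ c ih =>
    intro G _ T hT hc
    set N := lcs G (c + 1) with hN
    have hT' := hT.map (QuotientGroup.mk' N) (QuotientGroup.mk'_surjective N)
    have hlcs : lcs (G ⧸ N) (c + 1) = ⊥ := by
      have h1 := Subgroup.map_lowerCentralSeries (S := (⊤ : Subgroup G)) (QuotientGroup.mk' N) c
      rw [Subgroup.map_top_of_surjective _ (QuotientGroup.mk'_surjective N)] at h1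
      change (⊤ : Subgroup (G ⧸ N)).lowerCentralSeries c = ⊥
      rw [← h1, Subgroup.map_eq_bot_iff, QuotientGroup.ker_mk']
      exact le_rfl
    obtain ⟨D, hD⟩ := ih hT' hlcs
    obtain ⟨K, n₀, hK⟩ := hT.exists_ncard_inter_le (Nat.le_add_left 1 c) hc
    refine hT.exists_doubling_of_large (D := D ^ 3 * K) (n₀ := 2 * (n₀ + 1)) fun n hn => ?_
    obtain ⟨h, hh⟩ : ∃ h, h = n / 2 := ⟨_, rfl⟩
    have hq : ((QuotientGroup.mk' N '' T) ^ (2 * n)).ncard ≤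
        D ^ 3 * ((QuotientGroup.mk' N '' T) ^ h).ncard := by
      calc ((QuotientGroup.mk' N '' T) ^ (2 * n)).ncard
          ≤ ((QuotientGroup.mk' N '' T) ^ (2 * (2 * (2 * h)))).ncard :=
            hT'.ncard_pow_mono (by omega)
        _ ≤ D * (D * (D * ((QuotientGroup.mk' N '' T) ^ h).ncard)) :=
            (hD _).trans (Nat.mul_le_mul_left _ ((hD _).trans (Nat.mul_le_mul_left _ (hD _))))
        _ = _ := by ring
    calc (T ^ (2 * n)).ncard
        ≤ ((QuotientGroup.mk' N '' T) ^ (2 * n)).ncard * ((N : Set G) ∩ T ^ (2 * (2 * n))).ncard :=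
          hT.ncard_pow_le_quotient N (2 * n)
      _ ≤ (D ^ 3 * ((QuotientGroup.mk' N '' T) ^ h).ncard) *
            (K * ((N : Set G) ∩ T ^ h).ncard) := by
          refine Nat.mul_le_mul hq (le_trans ?_ (hK h (by omega)))
          exact Set.ncard_le_ncard (Set.inter_subset_inter_right _ (hT.pow_mono (by omega)))
            ((hT.finite_pow _).inter_of_right _)
      _ = D ^ 3 * K * (((QuotientGroup.mk' N '' T) ^ h).ncard * ((N : Set G) ∩ T ^ h).ncard) := by
          ring
      _ ≤ D ^ 3 * K * (T ^ n).ncard := Nat.mul_le_mul_left _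
          ((hT.quotient_mul_le_ncard_pow N h).trans (hT.ncard_pow_mono (by omega)))

end Doubling

section FiniteIndex

open scoped Pointwise

universe u

theorem SymmetricGenerators.exists_subset_pow {G : Type*} [Group G] {T : Set G}
    (hT : SymmetricGenerators T) {U : Set G} (hU : U.Finite) : ∃ R : ℕ, U ⊆ T ^ R := by
  choose n hn using hT.exists_mem_pow
  obtain ⟨R, hR⟩ := (hU.image n).bddAbove
  exact ⟨R, fun x hx => hT.pow_mono (hR ⟨x, hx, rfl⟩) (hn x)⟩

theorem Set.pow_mul_subset_mul_pow {G : Type*} [Monoid G] {T F U : Set G} (h : T * F ⊆ F * U)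
    (n : ℕ) : T ^ n * F ⊆ F * U ^ n := by
  induction n with
  | zero => simp
  | succ n ih =>
    calc T ^ (n + 1) * F = T ^ n * (T * F) := by rw [pow_succ, mul_assoc]
      _ ⊆ T ^ n * (F * U) := Set.mul_subset_mul_left h
      _ = T ^ n * F * U := (mul_assoc _ _ _).symm
      _ ⊆ F * U ^ n * U := Set.mul_subset_mul_right ih
      _ = F * U ^ (n + 1) := by rw [pow_succ, mul_assoc]

/-- A finite index subgroup admits generators controlling the growth of the ambient group. -/
theorem SymmetricGenerators.exists_finiteIndex {G : Type*} [Group G] {T : Set G}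
    (hT : SymmetricGenerators T) (N : Subgroup G) [N.FiniteIndex] :
    ∃ (U : Set N) (F : Set G), SymmetricGenerators U ∧ F.Finite ∧
      ∀ n, T ^ n ⊆ F * (N.subtype '' U) ^ n := by
  classical
  set F : Set G := insert 1 (Set.range fun q : G ⧸ N => Quotient.out q) with hF
  have hFfin : F.Finite := (Set.finite_range _).insert 1
  have hF1 : (1 : G) ∈ F := Set.mem_insert _ _
  set V : Set G := F⁻¹ * T * F ∪ (F ∪ F⁻¹) with hV
  have hVfin : V.Finite := ((hFfin.inv.mul hT.finite).mul hFfin).union (hFfin.union hFfin.inv)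
  set U : Set N := Subtype.val ⁻¹' V with hU
  have hdec : ∀ g : G, ∃ f ∈ F, f⁻¹ * g ∈ N := fun g =>
    ⟨_, Set.mem_insert_of_mem _ ⟨(g : G ⧸ N), rfl⟩, QuotientGroup.eq.1 (QuotientGroup.out_eq' _)⟩
  have hstep : T * F ⊆ F * (N.subtype '' U) := by
    rintro _ ⟨t, ht, f, hf, rfl⟩
    obtain ⟨f', hf', h⟩ := hdec (t * f)
    refine ⟨f', hf', f'⁻¹ * (t * f), ⟨⟨_, h⟩, Or.inl ?_, rfl⟩, by group⟩
    change f'⁻¹ * (t * f) ∈ F⁻¹ * T * F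
    rw [← mul_assoc]
    exact Set.mul_mem_mul (Set.mul_mem_mul (Set.inv_mem_inv.2 hf') ht) hf
  have hsub : ∀ n, T ^ n ⊆ F * (N.subtype '' U) ^ n := fun n =>
    (Set.subset_mul_left _ hF1).trans (Set.pow_mul_subset_mul_pow hstep n)
  refine ⟨U, F, ⟨hVfin.preimage Subtype.val_injective.injOn, Or.inr (Or.inl hF1), ?_, ?_⟩,
    hFfin, hsub⟩
  · rintro x (hx | hx | hx)
    · obtain ⟨_, ⟨f', hf', t, ht, rfl⟩, f, hf, h⟩ := hx
      refine Or.inl ⟨f⁻¹ * t⁻¹, Set.mul_mem_mul (Set.inv_mem_inv.2 hf) (hT.inv_mem t ht),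
        f'⁻¹, hf', ?_⟩
      simp only at h ⊢
      rw [Subgroup.coe_inv, ← h]
      group
    · exact Or.inr (Or.inr (by simpa using hx))
    · exact Or.inr (Or.inl (by simpa using hx))
  · intro g
    obtain ⟨n, hn⟩ := hT.exists_mem_pow g
    obtain ⟨f, hf, _, hv, h⟩ := hsub n hn
    rw [← Set.image_pow] at hv
    obtain ⟨v, hv, rfl⟩ := hv
    have hfN : f ∈ N := by
      have : f = g * (v : G)⁻¹ := by rw [← h]; simp
      rw [this]
      exact N.mul_mem g.2 (N.inv_mem v.2)
    refine ⟨n + 1, ?_⟩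
    have hg : g = ⟨f, hfN⟩ * v := Subtype.ext h.symm
    rw [hg, pow_succ']
    exact Set.mul_mem_mul (Or.inr (Or.inl hf)) hv

theorem SymmetricGenerators.exists_doubling_of_isVirtuallyNilpotent {G : Type u} [Group G]
    {T : Set G} (hT : SymmetricGenerators T) (N : Subgroup G) [N.FiniteIndex]
    [Group.IsNilpotent N] : ∃ D : ℕ, ∀ n, (T ^ (2 * n)).ncard ≤ D * (T ^ n).ncard := by
  obtain ⟨U, F, hU, hF, hTU⟩ := hT.exists_finiteIndex N
  obtain ⟨c, hc⟩ := Subgroup.nilpotent_iff_lowerCentralSeries.1 ‹Group.IsNilpotent N›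
  obtain ⟨D, hD⟩ := exists_doubling_of_lcs c hU hc
  have hD' : ∀ k n, (U ^ (2 ^ k * n)).ncard ≤ D ^ k * (U ^ n).ncard := by
    intro k n
    induction k with
    | zero => simp
    | succ k ih =>
      calc (U ^ (2 ^ (k + 1) * n)).ncard = (U ^ (2 * (2 ^ k * n))).ncard := by
            rw [pow_succ']; ring_nf
        _ ≤ D * (D ^ k * (U ^ n).ncard) := (hD _).trans (Nat.mul_le_mul_left _ ih)
        _ = D ^ (k + 1) * (U ^ n).ncard := by ring
  obtain ⟨R, hR⟩ := hT.exists_subset_pow (hU.finite.image N.subtype)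
  refine hT.exists_doubling_of_large (D := F.ncard * D ^ (4 * (R + 1))) (n₀ := R + 1)
    fun n hn => ?_
  obtain ⟨h, hh⟩ : ∃ h, h = n / (R + 1) := ⟨_, rfl⟩
  have hh1 : 1 ≤ h := by rw [hh, Nat.le_div_iff_mul_le (Nat.succ_pos R)]; omega
  have hhn : h * (R + 1) ≤ n := hh ▸ Nat.div_mul_le_self n (R + 1)
  have hnh : n < (h + 1) * (R + 1) := by
    rw [hh]; exact Nat.lt_mul_of_div_lt (Nat.lt_succ_self _) (Nat.succ_pos R)
  have h2n : 2 * n ≤ 2 ^ (4 * (R + 1)) * h := by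
    calc 2 * n ≤ 4 * (R + 1) * h := by nlinarith
      _ ≤ _ := Nat.mul_le_mul_right _ Nat.lt_two_pow_self.le
  have hcard : ∀ m, ((N.subtype '' U) ^ m).ncard = (U ^ m).ncard := fun m => by
    rw [← Set.image_pow, Set.ncard_image_of_injective _ N.subtype_injective]
  calc (T ^ (2 * n)).ncard ≤ (F * (N.subtype '' U) ^ (2 * n)).ncard :=
        Set.ncard_le_ncard (hTU _) (hF.mul ((hU.finite.image _).pow_nat _))
    _ ≤ F.ncard * ((N.subtype '' U) ^ (2 * n)).ncard := by
        simpa only [Nat.card_coe_set_eq] using Set.natCard_mul_le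
    _ ≤ F.ncard * (D ^ (4 * (R + 1)) * (U ^ h).ncard) := by
        rw [hcard]
        exact Nat.mul_le_mul_left _ ((hU.ncard_pow_mono h2n).trans (hD' _ _))
    _ = F.ncard * D ^ (4 * (R + 1)) * (U ^ h).ncard := (mul_assoc _ _ _).symm
    _ ≤ F.ncard * D ^ (4 * (R + 1)) * (T ^ n).ncard := by
        refine Nat.mul_le_mul_left _ ?_
        rw [← hcard]
        refine Set.ncard_le_ncard ?_ (hT.finite_pow n)
        refine (Set.pow_subset_pow_left hR).trans ?_
        rw [← pow_mul]
        exact hT.pow_mono (by nlinarith)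

end FiniteIndex

section Assembly

open scoped Pointwise

variable {Γ : Type*} [Group Γ] {S : Set Γ}

/-- The unit ball for the word metric. -/
def unitBall (S : Set Γ) : Set Γ := {x | x ∈ S ∨ x⁻¹ ∈ S ∨ x = 1}

theorem mem_unitBall_pow_iff (hS : Subgroup.closure S = ⊤) {n : ℕ} {g : Γ} :
    g ∈ unitBall S ^ n ↔ wordNorm S g ≤ n := by
  have hone : (1 : Γ) ∈ unitBall S := Or.inr (Or.inr rfl)
  rw [wordNorm_le_iff hS]
  constructor
  · induction n generalizing g with
    | zero =>
      intro hg
      rw [pow_zero, Set.mem_one] at hg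
      exact ⟨[], by simp [hg]⟩
    | succ n ih =>
      rw [pow_succ]
      rintro ⟨a, ha, b, hb, rfl⟩
      obtain ⟨l, hl, hm, rfl⟩ := ih ha
      by_cases hb1 : b = 1
      · exact ⟨l, by omega, hm, by simp [hb1]⟩
      · refine ⟨l ++ [b], by simpa using hl, fun x hx => ?_, by simp⟩
        rcases List.mem_append.1 hx with h | h
        · exact hm x h
        · rw [List.mem_singleton.1 h]
          rcases hb with hb | hb | hb
          · exact Or.inl hb
          · exact Or.inr hb
          · exact absurd hb hb1
  · rintro ⟨l, hl, hm, rfl⟩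
    refine Set.pow_mono_of_one_mem hone hl ?_
    clear hl
    induction l with
    | nil => simp
    | cons x l ih =>
      rw [List.length_cons, List.prod_cons, pow_succ']
      refine Set.mul_mem_mul ?_ (ih fun y hy => hm y (List.mem_cons_of_mem _ hy))
      exact (hm x List.mem_cons_self).imp id Or.inl

theorem symmetricGenerators_unitBall (hfin : S.Finite) (hS : Subgroup.closure S = ⊤) :
    SymmetricGenerators (unitBall S) where
  finite := by
    refine ((hfin.union hfin.inv).union (Set.finite_singleton 1)).subset ?_
    rintro x (hx | hx | hx)
    · exact Or.inl (Or.inl hx)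
    · exact Or.inl (Or.inr hx)
    · exact Or.inr hx
  one_mem := Or.inr (Or.inr rfl)
  inv_mem := by
    rintro x (hx | hx | hx)
    · exact Or.inr (Or.inl (by simpa using hx))
    · exact Or.inl hx
    · exact Or.inr (Or.inr (by simp [hx]))
  exists_mem_pow g := ⟨wordNorm S g, (mem_unitBall_pow_iff hS).2 le_rfl⟩

theorem GeodesicLength.growth_eq_ncard (hS : Subgroup.closure S = ⊤)
    (hN : GeodesicLength (wordNorm S)) (n : ℕ) : hN.growth n = (unitBall S ^ n).ncard := by
  have h : (hN.ball 1 n : Set Γ) = unitBall S ^ n := by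
    ext y
    rw [Finset.mem_coe, hN.mem_ball, mem_unitBall_pow_iff hS, one_mul, hN.inv]
  rw [← h, Set.ncard_coe_finset]
  rfl

theorem GeodesicLength.polyGrowth (hfin : S.Finite) (hS : Subgroup.closure S = ⊤)
    (hN : GeodesicLength (wordNorm S)) {C : ℝ} {d : ℕ}
    (h : ∀ n : ℕ, 1 ≤ n → (hN.growth n : ℝ) ≤ C * (n : ℝ) ^ d) : PolyGrowth d Γ := by
  have hT := symmetricGenerators_unitBall hfin hS
  intro U hU
  obtain ⟨R, hR⟩ := hT.exists_subset_pow hU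
  refine ⟨⌈C * ((R + 1 : ℕ) : ℝ) ^ d⌉₊, fun n hn => ?_⟩
  have h1 : (U ^ n).ncard ≤ hN.growth ((R + 1) * n) := by
    rw [hN.growth_eq_ncard hS, pow_mul]
    refine Set.ncard_le_ncard
      (Set.pow_subset_pow_left (hR.trans (hT.pow_mono (Nat.le_succ R)))) ?_
    rw [← pow_mul]
    exact hT.finite_pow _
  have h2 := h ((R + 1) * n) (Nat.mul_pos (Nat.succ_pos R) hn)
  have h3 : ((U ^ n).ncard : ℝ) ≤ (⌈C * ((R + 1 : ℕ) : ℝ) ^ d⌉₊ : ℝ) * (n : ℝ) ^ d := by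
    calc ((U ^ n).ncard : ℝ) ≤ hN.growth ((R + 1) * n) := by exact_mod_cast h1
      _ ≤ C * (((R + 1) * n : ℕ) : ℝ) ^ d := h2
      _ = C * ((R + 1 : ℕ) : ℝ) ^ d * (n : ℝ) ^ d := by rw [Nat.cast_mul, mul_pow, mul_assoc]
      _ ≤ _ := mul_le_mul_of_nonneg_right (Nat.le_ceil _) (by positivity)
  exact_mod_cast h3

/-- A group of polynomial growth has doubling balls. -/
theorem GeodesicLength.exists_growth_doubling (hfin : S.Finite) (hS : Subgroup.closure S = ⊤)
    (hN : GeodesicLength (wordNorm S)) {C : ℝ} {d : ℕ}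
    (h : ∀ n : ℕ, 1 ≤ n → (hN.growth n : ℝ) ≤ C * (n : ℝ) ^ d) :
    ∃ D : ℝ, ∀ n, (hN.growth (2 * n) : ℝ) ≤ D * hN.growth n := by
  have hfg : Group.FG Γ := ⟨⟨hfin.toFinset, by simpa using hS⟩⟩
  obtain ⟨N, _, _⟩ := (hN.polyGrowth hfin hS h).isVirtuallyNilpotent d hfg
  obtain ⟨D, hD⟩ :=
    (symmetricGenerators_unitBall hfin hS).exists_doubling_of_isVirtuallyNilpotent N
  refine ⟨D, fun n => ?_⟩
  rw [hN.growth_eq_ncard hS, hN.growth_eq_ncard hS]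
  exact_mod_cast hD n

end Assembly

/-- Hochman's upcrossing theorem for groups of polynomial growth. -/
theorem stmt17 {Γ : Type*} [Group Γ] (S : Set Γ) (hSfin : S.Finite)
    (hSgen : Subgroup.closure S = ⊤)
    -- Γ has polynomial growth:
    (hpoly : ∃ (Cg : ℝ) (dg : ℕ), 0 < Cg ∧ ∀ n : ℕ, 1 ≤ n →
      (Nat.card (wordBall S 1 n) : ℝ) ≤ Cg * (n : ℝ) ^ dg)
    (α β : ℝ) (hαβ : α < β) :
    ∃ δ₀ > (0:ℝ), ∀ δ ∈ Set.Ioo (0:ℝ) δ₀, ∃ c > (0:ℝ), ∃ ρ ∈ Set.Ioo (0:ℝ) 1,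
      ∀ (X : Type) (_ : MeasurableSpace X) (P : Measure X), IsProbabilityMeasure P →
      ∀ F : Γ → ℕ → X → ℝ, (∀ g r, Measurable (F g r)) →
      -- stationarity of the process (S_{B(g,r)}) = (F g r):
      (∀ h : Γ, Measure.map (fun x => fun p : Γ × ℕ => F (p.1 * h) p.2 x) P =
        Measure.map (fun x => fun p : Γ × ℕ => F p.1 p.2 x) P) →
      ∀ k : ℕ, 1 ≤ k →
      -- probability of at least k upcrossings of (S_{B(i)})_{i ≥ 1} across (α,β):
      P {x | ∃ i j : ℕ → ℕ,
          (∀ m < k, 1 ≤ i m ∧ i m < j m ∧ F 1 (i m) x < α ∧ β < F 1 (j m) x) ∧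
          (∀ m, m + 1 < k → j m < i (m + 1))}
        ≤ ENNReal.ofReal (c * ρ ^ k) +
          P {x | ∃ n : ℕ, k < n ∧ β < F 1 n x ∧
            ∃ (m : ℕ) (ctr : Fin m → Γ) (rad : Fin m → ℕ),
              (∀ i, wordBall S (ctr i) (rad i) ⊆ wordBall S 1 n) ∧
              (Pairwise fun i i' =>
                Disjoint (wordBall S (ctr i) (rad i)) (wordBall S (ctr i') (rad i'))) ∧
              ((Nat.card ↥(wordBall S 1 n \ ⋃ i, wordBall S (ctr i) (rad i)) : ℝ)
                < δ * (Nat.card (wordBall S 1 n) : ℝ)) ∧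
              (∀ i, F (ctr i) (rad i) x < α)} := by
  have hN := geodesicLength_wordNorm hSfin hSgen
  obtain ⟨C, d, -, hC⟩ := hpoly
  obtain ⟨D, hD⟩ := hN.exists_growth_doubling hSfin hSgen (C := C) (d := d) fun n hn => by
    have h := hC n hn
    rw [← hN.coe_ball, Nat.card_coe_set_eq, Set.ncard_coe_finset] at h
    exact h
  have : Countable S := hSfin.countable
  have : Countable Γ := Function.Surjective.countable (f := FreeGroup.lift ((↑) : S → Γ)) <| by
    rw [← MonoidHom.range_eq_top, FreeGroup.range_lift_eq_closure, Subtype.range_coe, hSgen]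
  exact ⟨1, one_pos, fun δ hδ => upcrossing_inequality_of_doubling hN hD α β hδ.1 hδ.2⟩
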